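/- Let 𝒞 be an arrangement of m ≥ 2 cameras with pairwise distinct centers such that no four camera centers are collinear. Then the ideal I_𝒞 ⊆ R has codimension 2m − 4 and is a Cohen–Macaulay ideal, i.e. the quotient ring R/I_𝒞 is a Cohen–Macaulay ring. -/

import Mathlib

open MvPolynomial

noncomputable section

abbrev Vec3 := Fin 3 → ℂ
abbrev Vec4 := Fin 4 → ℂ
abbrev Camera := Matrix (Fin 3) (Fin 4) ℂ

/-- The polynomial ring `R = ℂ[ℓ_{i,j} : 1 ≤ i ≤ 3, 1 ≤ j ≤ m]`. -/
abbrev LineRing (m : ℕ) := MvPolynomial (Fin 3 × Fin m) ℂ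

/-- `c` is (a representative of) the center of the camera `C`. -/
def IsCenter (C : Camera) (c : Vec4) : Prop := c ≠ 0 ∧ C.mulVec c = 0

/-- A camera arrangement: `m ≥ 2` cameras of rank 3 with pairwise distinct centers. -/
def IsCameraArrangement {m : ℕ} (𝒞 : Fin m → Camera) : Prop :=
  2 ≤ m ∧ (∀ i, (𝒞 i).rank = 3) ∧
    ∀ i j : Fin m, i ≠ j → ¬ ∃ c : Vec4, IsCenter (𝒞 i) c ∧ IsCenter (𝒞 j) c

/-- The cameras indexed by `S` have collinear centers: all of their centers lie on a
common projective line in ℙ³, i.e. in a common linear subspace of dimension ≤ 2 of ℂ⁴. -/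
def CollinearCenters {m : ℕ} (𝒞 : Fin m → Camera) (S : Set (Fin m)) : Prop :=
  ∃ W : Submodule ℂ Vec4, Module.finrank ℂ W ≤ 2 ∧
    ∀ i ∈ S, ∃ c : Vec4, IsCenter (𝒞 i) c ∧ c ∈ W

/-- No four camera centers are collinear. -/
def NoFourCollinear {m : ℕ} (𝒞 : Fin m → Camera) : Prop :=
  ∀ S : Finset (Fin m), S.card = 4 → ¬ CollinearCenters 𝒞 ↑S

/-- The 4×m matrix `M(ℓ)` of polynomials whose `j`-th column is `C_jᵀ ℓ_j`,
where the entries of `ℓ_j` are the variables `ℓ_{i,j}`. -/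
def MmatPoly {m : ℕ} (𝒞 : Fin m → Camera) : Matrix (Fin 4) (Fin m) (LineRing m) :=
  Matrix.of fun r j => ∑ i : Fin 3, MvPolynomial.C (𝒞 j i r) * MvPolynomial.X (i, j)

/-- The ideal `I_𝒞 ⊆ R` generated by the 3×3 minors of `M(ℓ)`. -/
def minorsIdeal {m : ℕ} (𝒞 : Fin m → Camera) : Ideal (LineRing m) :=
  Ideal.span {p | ∃ (ri : Fin 3 → Fin 4) (ci : Fin 3 → Fin m),
    Function.Injective ri ∧ Function.Injective ci ∧
      p = ((MmatPoly 𝒞).submatrix ri ci).det}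

/-- The codimension (height) of an ideal `I`: the minimum over primes `J ⊇ I` of the
height of `J`, i.e. of the maximal length of a chain of primes descending from `J`
(equivalently, the Krull dimension of the localization at `J`). -/
def idealCodim {A : Type*} [CommRing A] (I : Ideal A) : ℕ∞ :=
  ⨅ (J : PrimeSpectrum A) (_ : I ≤ J.asIdeal), Order.height J

/-- The depth of a commutative ring `S` with respect to an ideal `𝔪`: the supremum of
the lengths of regular sequences on `S` consisting of elements of `𝔪`. -/
def ringDepthWrt (S : Type*) [CommRing S] (𝔪 : Ideal S) : ℕ∞ :=
  sSup {n : ℕ∞ | ∃ rs : List S, n = rs.length ∧ (∀ x ∈ rs, x ∈ 𝔪) ∧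
    RingTheory.Sequence.IsRegular S rs}

/-- The irrelevant maximal ideal of the quotient of `R` by an ideal `I`: the image of
the ideal generated by all the variables. -/
def irrelevantMax {m : ℕ} (I : Ideal (LineRing m)) : Ideal (LineRing m ⧸ I) :=
  Ideal.map (Ideal.Quotient.mk I)
    (Ideal.span (Set.range (MvPolynomial.X : Fin 3 × Fin m → LineRing m)))

/-- Vanishing of `Ext^i(R/𝔪, M)` for `i < n`; by Rees' theorem this says that the depth of `M`
with respect to `𝔪` is at least `n`. -/
def DepthGE {R : Type*} [CommRing R] (𝔪 : Ideal R) (M : Type _) [AddCommGroup M] [Module R M]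
    (n : ℕ) : Prop :=
  ∀ i < n, Subsingleton (CategoryTheory.Abelian.Ext
    (ModuleCat.of R (R ⧸ 𝔪)) (ModuleCat.of R M) i)

namespace DepthGE

open CategoryTheory CategoryTheory.Abelian

universe u
variable {R : Type u} [CommRing R] {𝔪 : Ideal R}
variable {A B C : Type u} [AddCommGroup A] [Module R A] [AddCommGroup B] [Module R B]
  [AddCommGroup C] [Module R C]

lemma mono {n k : ℕ} (h : DepthGE 𝔪 A n) (hk : k ≤ n) : DepthGE 𝔪 A k :=
  fun i hi => h i (hi.trans_le hk)

lemma zero : DepthGE 𝔪 A 0 := fun i hi => absurd hi (Nat.not_lt_zero i)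

lemma shortExact_mk {f : A →ₗ[R] B} {g : B →ₗ[R] C}
    (hf : Function.Injective f) (hfg : Function.Exact f g) (hg : Function.Surjective g) :
    (ModuleCat.shortComplexOfCompEqZero f g hfg.linearMap_comp_eq_zero).ShortExact :=
  ModuleCat.shortComplex_shortExact _ hfg hf hg

lemma middle {n : ℕ} {f : A →ₗ[R] B} {g : B →ₗ[R] C}
    (hf : Function.Injective f) (hfg : Function.Exact f g) (hg : Function.Surjective g)
    (hA : DepthGE 𝔪 A n) (hC : DepthGE 𝔪 C n) : DepthGE 𝔪 B n := by
  intro i hi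
  have h1 := hA i hi
  have h2 := hC i hi
  have hS := shortExact_mk hf hfg hg
  have key : ∀ x : Ext (ModuleCat.of R (R ⧸ 𝔪)) (ModuleCat.of R B) i, x = 0 := by
    intro x
    obtain ⟨y, rfl⟩ := Ext.covariant_sequence_exact₂ _ hS x (h2.elim _ _)
    rw [h1.elim y 0]
    exact Ext.zero_comp ..
  exact ⟨fun x y => (key x).trans (key y).symm⟩

lemma left {n : ℕ} {f : A →ₗ[R] B} {g : B →ₗ[R] C}
    (hf : Function.Injective f) (hfg : Function.Exact f g) (hg : Function.Surjective g)
    (hB : DepthGE 𝔪 B (n + 1)) (hC : DepthGE 𝔪 C n) : DepthGE 𝔪 A (n + 1) := by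
  intro i hi
  have h1 := hB i hi
  have hS := shortExact_mk hf hfg hg
  have key : ∀ x : Ext (ModuleCat.of R (R ⧸ 𝔪)) (ModuleCat.of R A) i, x = 0 := by
    intro x
    rcases i with _ | i
    · have : Mono (ModuleCat.ofHom f) := hS.mono_f
      exact Ext.postcomp_mk₀_injective_of_mono (ModuleCat.of R (R ⧸ 𝔪)) (ModuleCat.ofHom f)
        (h1.elim _ _)
    · have h2 := hC i (by omega)
      obtain ⟨y, rfl⟩ := Ext.covariant_sequence_exact₁ _ hS x (h1.elim _ _) rfl
      rw [h2.elim y 0]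
      exact Ext.zero_comp ..
  exact ⟨fun x y => (key x).trans (key y).symm⟩

lemma of_isSMulRegular {n : ℕ} {x : R} (hx : x ∈ 𝔪) {g : A →ₗ[R] C} (hreg : IsSMulRegular A x)
    (hfg : Function.Exact (LinearMap.lsmul R A x) g) (hg : Function.Surjective g)
    (hC : DepthGE 𝔪 C n) : DepthGE 𝔪 A (n + 1) := by
  intro i hi
  have hS := shortExact_mk (f := LinearMap.lsmul R A x) hreg hfg hg
  have hann : x ∈ Module.annihilator R (ModuleCat.of R (R ⧸ 𝔪)) := by
    change x ∈ Module.annihilator R (R ⧸ 𝔪)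
    rwa [Ideal.annihilator_quotient]
  have h0 : ∀ y : Ext (ModuleCat.of R (R ⧸ 𝔪)) (ModuleCat.of R A) i,
      y.comp (Ext.mk₀ (ModuleCat.shortComplexOfCompEqZero (LinearMap.lsmul R A x) g
        hfg.linearMap_comp_eq_zero).f) (add_zero i) = 0 := by
    intro y
    have := Ext.postcomp_smul_id_eq_zero_of_mem_annihilator (M := ModuleCat.of R A) hann i
    exact congrArg (fun t => t.hom y) this
  have key : ∀ z : Ext (ModuleCat.of R (R ⧸ 𝔪)) (ModuleCat.of R A) i, z = 0 := by
    intro z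
    rcases i with _ | i
    · have : Mono (ModuleCat.ofHom (LinearMap.lsmul R A x)) := hS.mono_f
      exact Ext.postcomp_mk₀_injective_of_mono (ModuleCat.of R (R ⧸ 𝔪))
        (ModuleCat.ofHom (LinearMap.lsmul R A x))
        ((h0 z).trans (h0 0).symm)
    · have h2 := hC i (by omega)
      obtain ⟨y, rfl⟩ := Ext.covariant_sequence_exact₁ _ hS z (h0 z) rfl
      rw [h2.elim y 0]
      exact Ext.zero_comp ..
  exact ⟨fun x y => (key x).trans (key y).symm⟩

variable {J K P Q J₁ J₂ : Ideal R} {n : ℕ}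

lemma exact_factor (hJK : J ≤ K) {φ : A →ₗ[R] R ⧸ J}
    (hφ : ∀ z, Ideal.Quotient.mk J z ∈ LinearMap.range φ ↔ z ∈ K) :
    Function.Exact ((LinearMap.range φ).subtype.comp φ.quotKerEquivRange.toLinearMap)
      (Submodule.factor hJK) := by
  intro z
  obtain ⟨z, rfl⟩ := Ideal.Quotient.mk_surjective z
  have h1 : Submodule.factor hJK (Ideal.Quotient.mk J z) = 0 ↔ z ∈ K := by
    change (Submodule.Quotient.mk z : R ⧸ K) = 0 ↔ _
    exact Submodule.Quotient.mk_eq_zero _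
  rw [h1, ← hφ]
  constructor
  · intro h
    obtain ⟨y, hy⟩ := φ.quotKerEquivRange.surjective ⟨_, h⟩
    exact ⟨y, by simp [hy]⟩
  · rintro ⟨y, hy⟩
    rw [← hy]
    exact (φ.quotKerEquivRange y).2

lemma injective_range_subtype_comp {φ : A →ₗ[R] B} :
    Function.Injective ((LinearMap.range φ).subtype.comp φ.quotKerEquivRange.toLinearMap) :=
  (Submodule.injective_subtype _).comp φ.quotKerEquivRange.injective

lemma factor_surjective (hJK : J ≤ K) : Function.Surjective (Submodule.factor hJK) :=
  Submodule.factor_surjective hJK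

lemma quotient_of_range (hJK : J ≤ K) {φ : A →ₗ[R] R ⧸ J}
    (hφ : ∀ z, Ideal.Quotient.mk J z ∈ LinearMap.range φ ↔ z ∈ K)
    (h1 : DepthGE 𝔪 (A ⧸ LinearMap.ker φ) n) (h2 : DepthGE 𝔪 (R ⧸ K) n) :
    DepthGE 𝔪 (R ⧸ J) n :=
  middle injective_range_subtype_comp (exact_factor hJK hφ) (factor_surjective hJK) h1 h2

lemma quotKer_of_range (hJK : J ≤ K) {φ : A →ₗ[R] R ⧸ J}
    (hφ : ∀ z, Ideal.Quotient.mk J z ∈ LinearMap.range φ ↔ z ∈ K)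
    (h1 : DepthGE 𝔪 (R ⧸ J) (n + 1)) (h2 : DepthGE 𝔪 (R ⧸ K) n) :
    DepthGE 𝔪 (A ⧸ LinearMap.ker φ) (n + 1) :=
  left injective_range_subtype_comp (exact_factor hJK hφ) (factor_surjective hJK) h1 h2

lemma mk_mem_range_toSpanSingleton {x z : R} :
    Ideal.Quotient.mk J z ∈ LinearMap.range
      (LinearMap.toSpanSingleton R (R ⧸ J) (Ideal.Quotient.mk J x)) ↔ z ∈ J ⊔ Ideal.span {x} := by
  rw [sup_comm, Ideal.mem_span_singleton_sup]
  constructor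
  · rintro ⟨r, hr⟩
    refine ⟨r, z - r * x, ?_, by ring⟩
    rw [← Ideal.Quotient.eq, ← hr, map_mul]
    rfl
  · rintro ⟨r, b, hb, rfl⟩
    refine ⟨r, ?_⟩
    rw [map_add, Ideal.Quotient.eq_zero_iff_mem.mpr hb, add_zero, map_mul]
    rfl

/-- The exact sequence `0 → R/(J : x) → R/J → R/(J + x) → 0`. -/
lemma of_colon {x : R} (hP : ∀ p, p * x ∈ J ↔ p ∈ P) (h1 : DepthGE 𝔪 (R ⧸ P) n)
    (h2 : DepthGE 𝔪 (R ⧸ (J ⊔ Ideal.span {x})) n) : DepthGE 𝔪 (R ⧸ J) n := by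
  have hker : LinearMap.ker (LinearMap.toSpanSingleton R (R ⧸ J) (Ideal.Quotient.mk J x)) = P := by
    ext p
    rw [LinearMap.mem_ker, ← hP, ← Ideal.Quotient.eq_zero_iff_mem, map_mul]
    rfl
  refine quotient_of_range (φ := LinearMap.toSpanSingleton R (R ⧸ J) (Ideal.Quotient.mk J x))
    le_sup_left (fun z => mk_mem_range_toSpanSingleton) ?_ h2
  rw [hker]
  exact h1

/-- The colon sequence when `J : x` is a prime `P`. -/
lemma of_colon_prime [hP : P.IsPrime] {x : R} (hJP : J ≤ P) (hx : x ∉ P) (hxP : ∀ p ∈ P, p * x ∈ J)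
    (h1 : DepthGE 𝔪 (R ⧸ P) n) (h2 : DepthGE 𝔪 (R ⧸ (J ⊔ Ideal.span {x})) n) :
    DepthGE 𝔪 (R ⧸ J) n :=
  of_colon (fun p => ⟨fun h => (hP.mem_or_mem (hJP h)).resolve_right hx, hxP p⟩) h1 h2

lemma of_nonZeroDivisor {x : R} (hx : x ∈ 𝔪) (hreg : ∀ p, p * x ∈ J → p ∈ J)
    (h : DepthGE 𝔪 (R ⧸ (J ⊔ Ideal.span {x})) n) : DepthGE 𝔪 (R ⧸ J) (n + 1) := by
  refine of_isSMulRegular (x := x) (g := Submodule.factor le_sup_left) hx ?_ ?_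
    (factor_surjective (le_sup_left : J ≤ J ⊔ Ideal.span {x})) h
  · rw [isSMulRegular_iff_right_eq_zero_of_smul]
    intro z hz
    obtain ⟨z, rfl⟩ := Ideal.Quotient.mk_surjective z
    rw [Ideal.Quotient.eq_zero_iff_mem]
    refine hreg _ ?_
    rw [mul_comm, ← Ideal.Quotient.eq_zero_iff_mem]
    exact hz
  · intro z
    obtain ⟨z, rfl⟩ := Ideal.Quotient.mk_surjective z
    have h1 : Submodule.factor (le_sup_left : J ≤ J ⊔ Ideal.span {x}) (Ideal.Quotient.mk J z) = 0
        ↔ z ∈ J ⊔ Ideal.span {x} := Submodule.Quotient.mk_eq_zero _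
    rw [h1, ← mk_mem_range_toSpanSingleton]
    constructor
    · rintro ⟨r, hr⟩
      refine ⟨Ideal.Quotient.mk J r, hr ▸ ?_⟩
      change (Ideal.Quotient.mk J) (x * r) = (Ideal.Quotient.mk J) (r * x)
      rw [mul_comm]
    · rintro ⟨r, hr⟩
      obtain ⟨r, rfl⟩ := Ideal.Quotient.mk_surjective r
      refine ⟨r, hr ▸ ?_⟩
      change (Ideal.Quotient.mk J) (r * x) = (Ideal.Quotient.mk J) (x * r)
      rw [mul_comm]

lemma prod (hA : DepthGE 𝔪 A n) (hB : DepthGE 𝔪 B n) : DepthGE 𝔪 (A × B) n :=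
  middle (f := LinearMap.inl R A B) (g := LinearMap.snd R A B) LinearMap.inl_injective
    (fun x => ⟨fun h => ⟨x.1, Prod.ext rfl h.symm⟩, by rintro ⟨y, rfl⟩; rfl⟩)
    LinearMap.snd_surjective hA hB

/-- The Mayer–Vietoris sequence `0 → R/(J₁ ∩ J₂) → R/J₁ ⊕ R/J₂ → R/(J₁ + J₂) → 0`. -/
lemma inf (h1 : DepthGE 𝔪 (R ⧸ J₁) (n + 1)) (h2 : DepthGE 𝔪 (R ⧸ J₂) (n + 1))
    (h3 : DepthGE 𝔪 (R ⧸ (J₁ ⊔ J₂)) n) : DepthGE 𝔪 (R ⧸ (J₁ ⊓ J₂)) (n + 1) := by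
  let f : (R ⧸ (J₁ ⊓ J₂)) →ₗ[R] (R ⧸ J₁) × (R ⧸ J₂) :=
    (Submodule.factor inf_le_left).prod (Submodule.factor inf_le_right)
  let g : (R ⧸ J₁) × (R ⧸ J₂) →ₗ[R] R ⧸ (J₁ ⊔ J₂) :=
    (Submodule.factor le_sup_left).comp (LinearMap.fst R _ _) -
      (Submodule.factor le_sup_right).comp (LinearMap.snd R _ _)
  refine left (f := f) (g := g) ?_ ?_ ?_ (prod h1 h2) h3
  · rw [← LinearMap.ker_eq_bot, LinearMap.ker_eq_bot']
    intro z hz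
    obtain ⟨z, rfl⟩ := Ideal.Quotient.mk_surjective z
    have h1 : Ideal.Quotient.mk J₁ z = 0 := congrArg Prod.fst hz
    have h2 : Ideal.Quotient.mk J₂ z = 0 := congrArg Prod.snd hz
    rw [Ideal.Quotient.eq_zero_iff_mem] at *
    exact ⟨h1, h2⟩
  · rintro ⟨a, b⟩
    obtain ⟨a, rfl⟩ := Ideal.Quotient.mk_surjective a
    obtain ⟨b, rfl⟩ := Ideal.Quotient.mk_surjective b
    have hg : g (Ideal.Quotient.mk J₁ a, Ideal.Quotient.mk J₂ b) =
      Ideal.Quotient.mk (J₁ ⊔ J₂) (a - b) := rfl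
    rw [hg, Ideal.Quotient.eq_zero_iff_mem, Submodule.mem_sup]
    constructor
    · rintro ⟨y, hy, z, hz, hyz⟩
      refine ⟨Ideal.Quotient.mk _ (a - y), Prod.ext ?_ ?_⟩
      · change Ideal.Quotient.mk J₁ (a - y) = Ideal.Quotient.mk J₁ a
        rw [Ideal.Quotient.eq]
        simpa using hy
      · change Ideal.Quotient.mk J₂ (a - y) = Ideal.Quotient.mk J₂ b
        rw [Ideal.Quotient.eq]
        convert hz using 1
        linear_combination -hyz
    · rintro ⟨y, hy⟩
      obtain ⟨y, rfl⟩ := Ideal.Quotient.mk_surjective y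
      have h1 : Ideal.Quotient.mk J₁ y = Ideal.Quotient.mk J₁ a := congrArg Prod.fst hy
      have h2 : Ideal.Quotient.mk J₂ y = Ideal.Quotient.mk J₂ b := congrArg Prod.snd hy
      rw [Ideal.Quotient.eq] at h1 h2
      refine ⟨a - y, by simpa using J₁.neg_mem h1, y - b, h2, by ring⟩
  · intro z
    obtain ⟨z, rfl⟩ := Ideal.Quotient.mk_surjective z
    refine ⟨(Ideal.Quotient.mk J₁ z, 0), ?_⟩
    change Ideal.Quotient.mk (J₁ ⊔ J₂) z - 0 = _
    rw [sub_zero]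

lemma mk_mem_range_coprod {x y z : R} :
    Ideal.Quotient.mk J z ∈ LinearMap.range
      ((LinearMap.toSpanSingleton R (R ⧸ J) (Ideal.Quotient.mk J x)).coprod
        (LinearMap.toSpanSingleton R (R ⧸ J) (Ideal.Quotient.mk J y))) ↔
      z ∈ J ⊔ Ideal.span {x, y} := by
  rw [sup_comm, Submodule.mem_sup]
  constructor
  · rintro ⟨⟨r, s⟩, hr⟩
    refine ⟨r * x + s * y, Ideal.mem_span_pair.mpr ⟨r, s, rfl⟩, z - (r * x + s * y), ?_, by ring⟩
    rw [← Ideal.Quotient.eq, ← hr, map_add, map_mul, map_mul]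
    rfl
  · rintro ⟨r, hr, b, hb, rfl⟩
    obtain ⟨r, s, rfl⟩ := Ideal.mem_span_pair.mp hr
    refine ⟨(r, s), ?_⟩
    rw [map_add, Ideal.Quotient.eq_zero_iff_mem.mpr hb, add_zero, map_add, map_mul, map_mul]
    rfl

/-- If the ideals generated by `y, y'` modulo `J` and by `a, b` modulo `Q` have the same
syzygies, depth bounds can be transferred from `Q` to `J`. -/
lemma of_same_syzygies {y y' a b : R} (hsyz : ∀ f g, f * y + g * y' ∈ J ↔ f * a + g * b ∈ Q)
    (hQ : DepthGE 𝔪 (R ⧸ Q) (n + 1)) (hQab : DepthGE 𝔪 (R ⧸ (Q ⊔ Ideal.span {a, b})) n)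
    (hJ : DepthGE 𝔪 (R ⧸ (J ⊔ Ideal.span {y, y'})) (n + 1)) : DepthGE 𝔪 (R ⧸ J) (n + 1) := by
  have h1 := quotKer_of_range le_sup_left (fun z => mk_mem_range_coprod (x := a) (y := b)) hQ hQab
  refine quotient_of_range le_sup_left (fun z => mk_mem_range_coprod (x := y) (y := y')) ?_ hJ
  have hker : LinearMap.ker ((LinearMap.toSpanSingleton R (R ⧸ J) (Ideal.Quotient.mk J y)).coprod
        (LinearMap.toSpanSingleton R (R ⧸ J) (Ideal.Quotient.mk J y'))) =
      LinearMap.ker ((LinearMap.toSpanSingleton R (R ⧸ Q) (Ideal.Quotient.mk Q a)).coprod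
        (LinearMap.toSpanSingleton R (R ⧸ Q) (Ideal.Quotient.mk Q b))) := by
    ext ⟨f, g⟩
    have := hsyz f g
    rw [← Ideal.Quotient.eq_zero_iff_mem, ← Ideal.Quotient.eq_zero_iff_mem, map_add, map_mul,
      map_mul, map_add, map_mul, map_mul] at this
    rw [LinearMap.mem_ker, LinearMap.mem_ker]
    exact this
  rw [hker]
  exact h1

end DepthGE

/-- Cameras of rank three with chosen representatives of their centers. -/
structure CameraData (m : ℕ) where
  cam : Fin m → Camera
  c : Fin m → Vec4
  isCenter : ∀ j, IsCenter (cam j) (c j)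
  rank_eq : ∀ j, (cam j).rank = 3

namespace CameraData

variable {m : ℕ} (X : CameraData m)

/-- The linear form obtained by contracting the `j`-th column of `M(ℓ)` with `φ`. -/
def L (j : Fin m) : Vec4 →ₗ[ℂ] LineRing m where
  toFun φ := ∑ i : Fin 3, C ((X.cam j).mulVec φ i) * MvPolynomial.X (i, j)
  map_add' φ ψ := by simp [Matrix.mulVec_add, add_mul, Finset.sum_add_distrib]
  map_smul' a φ := by
    simp [Matrix.mulVec_smul, Finset.smul_sum, smul_eq_C_mul, mul_assoc]

/-- The ideal of maximal minors considered in the main theorem. -/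
abbrev I : Ideal (LineRing m) := minorsIdeal X.cam

lemma L_apply (j : Fin m) (φ : Vec4) :
    X.L j φ = ∑ i : Fin 3, C ((X.cam j).mulVec φ i) * MvPolynomial.X (i, j) := rfl

lemma L_c (j : Fin m) : X.L j (X.c j) = 0 := by
  simp [L_apply, (X.isCenter j).2]

lemma L_eq_sum (j : Fin m) (φ : Vec4) : X.L j φ = ∑ r, φ r • MmatPoly X.cam r j := by
  simp only [L_apply, MmatPoly, Matrix.of_apply, Finset.smul_sum, smul_eq_C_mul]
  rw [Finset.sum_comm]
  refine Finset.sum_congr rfl fun i _ => ?_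
  simp only [Matrix.mulVec, dotProduct, map_sum, Finset.sum_mul, map_mul]
  exact Finset.sum_congr rfl fun r _ => by ring

lemma L_single (j : Fin m) (r : Fin 4) : X.L j (Pi.single r 1) = MmatPoly X.cam r j := by
  rw [L_eq_sum, Finset.sum_eq_single r]
  · simp
  · intro b _ hb
    simp [Pi.single_eq_of_ne hb]
  · simp

/-- The determinant of the contractions of three columns with three vectors. -/
def minor (i j k : Fin m) (φ ψ χ : Vec4) : LineRing m :=
  X.L i φ * (X.L j ψ * X.L k χ - X.L k ψ * X.L j χ)
    - X.L i ψ * (X.L j φ * X.L k χ - X.L k φ * X.L j χ)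
    + X.L i χ * (X.L j φ * X.L k ψ - X.L k φ * X.L j ψ)

lemma det_eq_minor (i j k : Fin m) (v : Fin 3 → Vec4) :
    (Matrix.of fun p q => X.L (![i, j, k] q) (v p)).det = X.minor i j k (v 0) (v 1) (v 2) := by
  rw [Matrix.det_fin_three]
  simp [minor]
  ring

lemma minor_mem (i j k : Fin m) (φ ψ χ : Vec4) : X.minor i j k φ ψ χ ∈ X.I := by
  have h := X.det_eq_minor i j k ![φ, ψ, χ]
  simp only [Matrix.cons_val_zero, Matrix.cons_val_one, Matrix.cons_val] at h
  rw [← h]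
  set ci : Fin 3 → Fin m := ![i, j, k]
  set v : Fin 3 → Vec4 := ![φ, ψ, χ]
  have h1 : (Matrix.of fun p q => X.L (ci q) (v p)) =
      fun p => ∑ r : Fin 4, (v p r) • (fun q => MmatPoly X.cam r (ci q)) := by
    ext p q : 2
    rw [Matrix.of_apply, L_eq_sum, Finset.sum_apply]
    rfl
  have h2 : (Matrix.of fun p q => X.L (ci q) (v p)).det =
      ∑ f : Fin 3 → Fin 4, (∏ p, C (v p (f p)) : LineRing m) •
        ((MmatPoly X.cam).submatrix f ci).det := by
    rw [h1]
    change Matrix.detRowAlternating _ = _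
    rw [← AlternatingMap.coe_multilinearMap, MultilinearMap.map_sum]
    refine Finset.sum_congr rfl fun f _ => ?_
    rw [show ((MmatPoly X.cam).submatrix f ci).det = (Matrix.detRowAlternating (R := LineRing m)
      (n := Fin 3)).toMultilinearMap (fun p q => MmatPoly X.cam (f p) (ci q)) from rfl,
      ← MultilinearMap.map_smul_univ]
    congr 1
    ext p q : 2
    simp [smul_eq_C_mul]
  rw [h2]
  refine Ideal.sum_mem _ fun f _ => Ideal.mul_mem_left _ _ ?_
  by_cases hf : Function.Injective f
  · by_cases hc : Function.Injective ci
    · exact Ideal.subset_span ⟨f, ci, hf, hc, rfl⟩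
    · simp only [Function.Injective, not_forall] at hc
      obtain ⟨a, b, hab, hne⟩ := hc
      rw [Matrix.det_zero_of_column_eq hne (by intro r; simp [hab])]
      exact zero_mem _
  · simp only [Function.Injective, not_forall] at hf
    obtain ⟨a, b, hab, hne⟩ := hf
    rw [Matrix.det_zero_of_row_eq hne (by ext r; simp [hab])]
    exact zero_mem _

lemma I_le_of_minor {J : Ideal (LineRing m)}
    (h : ∀ i j k, i ≠ j → i ≠ k → j ≠ k → ∀ φ ψ χ, X.minor i j k φ ψ χ ∈ J) : X.I ≤ J := by
  refine Ideal.span_le.mpr ?_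
  rintro _ ⟨ri, ci, -, hci, rfl⟩
  have h1 := X.det_eq_minor (ci 0) (ci 1) (ci 2) (fun p => Pi.single (ri p) 1)
  have h2 : (MmatPoly X.cam).submatrix ri ci =
      Matrix.of fun p q => X.L (![ci 0, ci 1, ci 2] q) (Pi.single (ri p) 1) := by
    ext p q : 2
    rw [Matrix.of_apply, L_single]
    fin_cases q <;> rfl
  rw [h2, h1]
  exact h _ _ _ (hci.ne (by decide)) (hci.ne (by decide)) (hci.ne (by decide)) _ _ _

lemma exists_rightInverse (j : Fin m) : ∃ D : Matrix (Fin 4) (Fin 3) ℂ, X.cam j * D = 1 := by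
  have h : Function.Surjective (X.cam j).mulVecLin := by
    rw [← LinearMap.range_eq_top]
    apply Submodule.eq_top_of_finrank_eq
    have := X.rank_eq j
    rw [Matrix.rank] at this
    rw [this]; simp
  obtain ⟨g, hg⟩ := (X.cam j).mulVecLin.exists_rightInverse_of_surjective
    (LinearMap.range_eq_top.mpr h)
  refine ⟨LinearMap.toMatrix' g, ?_⟩
  apply Matrix.toLin'.injective
  rw [Matrix.toLin'_mul, Matrix.toLin'_toMatrix', Matrix.toLin'_one]
  exact hg

lemma mulVec_eq_zero_iff (j : Fin m) (φ : Vec4) :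
    (X.cam j).mulVec φ = 0 ↔ φ ∈ Submodule.span ℂ {X.c j} := by
  have h1 : Module.finrank ℂ (LinearMap.ker (X.cam j).mulVecLin) = 1 := by
    have := (X.cam j).mulVecLin.finrank_range_add_finrank_ker
    have h2 := X.rank_eq j
    rw [Matrix.rank] at h2
    rw [h2] at this
    simp at this
    omega
  have h2 : Submodule.span ℂ {X.c j} = LinearMap.ker (X.cam j).mulVecLin := by
    apply Submodule.eq_of_le_of_finrank_eq
    · rw [Submodule.span_singleton_le_iff_mem]
      exact (X.isCenter j).2
    · rw [h1, finrank_span_singleton (X.isCenter j).1]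
  rw [h2]; rfl

lemma L_eq_zero_iff (j : Fin m) (φ : Vec4) : X.L j φ = 0 ↔ φ ∈ Submodule.span ℂ {X.c j} := by
  rw [← mulVec_eq_zero_iff]
  constructor
  · intro h
    ext i
    have := congrArg (coeff (Finsupp.single (i, j) 1)) h
    simpa [L_apply, coeff_sum, coeff_C_mul, coeff_X, Finsupp.single_left_inj, Prod.ext_iff]
      using this
  · intro h
    simp [L_apply, h]

lemma exists_L_eq_X (i : Fin 3) (j : Fin m) : ∃ φ, X.L j φ = MvPolynomial.X (i, j) := by
  obtain ⟨D, hD⟩ := X.exists_rightInverse j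
  refine ⟨D.mulVec (Pi.single i 1), ?_⟩
  rw [L_apply, Matrix.mulVec_mulVec, hD, Matrix.one_mulVec, Finset.sum_eq_single i]
  · simp
  · intro b _ hb
    simp [Pi.single_eq_of_ne hb]
  · simp

lemma exists_lift {B : Type*} [CommRing B] [Algebra ℂ B] (h : Fin m → Vec4 →ₗ[ℂ] B)
    (hc : ∀ j, h j (X.c j) = 0) : ∃ F : LineRing m →ₐ[ℂ] B, ∀ j φ, F (X.L j φ) = h j φ := by
  choose D hD using X.exists_rightInverse
  refine ⟨aeval fun p => h p.2 ((D p.2).mulVec (Pi.single p.1 1)), fun j φ => ?_⟩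
  have h1 : X.L j ((D j).mulVec ((X.cam j).mulVec φ) - φ) = 0 := by
    rw [L_apply, Matrix.mulVec_sub, Matrix.mulVec_mulVec, hD, Matrix.one_mulVec]
    simp
  rw [L_eq_zero_iff, Submodule.mem_span_singleton] at h1
  obtain ⟨a, ha⟩ := h1
  have h2 : h j ((D j).mulVec ((X.cam j).mulVec φ)) = h j φ := by
    rw [← sub_eq_zero, ← map_sub, ← ha, map_smul, hc, smul_zero]
  rw [← h2, L_apply, map_sum]
  have h3 : (X.cam j).mulVec φ = ∑ i, (X.cam j).mulVec φ i • Pi.single i (1 : ℂ) := by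
    ext i
    simp [Finset.sum_apply, Pi.single_apply]
  conv_rhs => rw [h3, ← Matrix.mulVecLin_apply, map_sum, map_sum]
  refine Finset.sum_congr rfl fun i _ => ?_
  rw [map_mul, aeval_X, map_smul, map_smul, aeval_C, Algebra.smul_def]
  rfl

lemma hom_ext {B : Type*} [CommRing B] [Algebra ℂ B] {F G : LineRing m →ₐ[ℂ] B}
    (h : ∀ j φ, F (X.L j φ) = G (X.L j φ)) : F = G := by
  apply MvPolynomial.algHom_ext
  rintro ⟨i, j⟩
  obtain ⟨φ, hφ⟩ := X.exists_L_eq_X i j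
  rw [← hφ, h]

/-- The irrelevant maximal ideal. -/
def 𝔪 (m : ℕ) : Ideal (LineRing m) :=
  Ideal.span (Set.range (MvPolynomial.X : Fin 3 × Fin m → LineRing m))

lemma L_mem_𝔪 (j : Fin m) (φ : Vec4) : X.L j φ ∈ 𝔪 m := by
  rw [L_apply]
  exact (𝔪 m).sum_mem fun i _ => (𝔪 m).mul_mem_left _ (Ideal.subset_span ⟨(i, j), rfl⟩)

lemma isHomogeneous_L (j : Fin m) (φ : Vec4) : (X.L j φ).IsHomogeneous 1 :=
  IsHomogeneous.sum _ _ _ fun i _ => by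
    simpa using (isHomogeneous_C _ ((X.cam j).mulVec φ i)).mul (isHomogeneous_X ℂ (i, j))

lemma isHomogeneous_minor (i j k : Fin m) (φ ψ χ : Vec4) :
    (X.minor i j k φ ψ χ).IsHomogeneous 3 := by
  have h (i j k : Fin m) (φ ψ χ : Vec4) :
      (X.L i φ * (X.L j ψ * X.L k χ - X.L k ψ * X.L j χ)).IsHomogeneous 3 :=
    (X.isHomogeneous_L i φ).mul (m := 1) (n := 2)
      (IsHomogeneous.sub ((X.isHomogeneous_L j ψ).mul (X.isHomogeneous_L k χ))
        ((X.isHomogeneous_L k ψ).mul (X.isHomogeneous_L j χ)))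
  exact ((h i j k φ ψ χ).sub (h i j k ψ φ χ)).add (h i j k χ φ ψ)

attribute [local instance] MvPolynomial.gradedAlgebra

/-- A homogeneous ideal: it contains the homogeneous components of its elements. -/
def Homog (J : Ideal (LineRing m)) : Prop := ∀ f ∈ J, ∀ d, homogeneousComponent d f ∈ J

lemma homog_span {s : Set (LineRing m)} (hs : ∀ f ∈ s, ∃ d, f.IsHomogeneous d) :
    Homog (Ideal.span s) := by
  have h := Ideal.homogeneous_span (homogeneousSubmodule (Fin 3 × Fin m) ℂ) s
    (fun f hf => by obtain ⟨d, hd⟩ := hs f hf; exact ⟨d, hd⟩)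
  exact fun f hf d => (mem_iff_homogeneousComponent_mem h f).mp hf d

lemma Homog.sup {J K : Ideal (LineRing m)} (hJ : Homog J) (hK : Homog K) : Homog (J ⊔ K) := by
  intro f hf d
  obtain ⟨a, ha, b, hb, rfl⟩ := Submodule.mem_sup.mp hf
  rw [map_add]
  exact add_mem (Ideal.mem_sup_left (hJ a ha d)) (Ideal.mem_sup_right (hK b hb d))

lemma homog_I : Homog X.I := by
  refine homog_span ?_
  rintro _ ⟨ri, ci, -, -, rfl⟩
  refine ⟨3, ?_⟩
  have h1 := X.det_eq_minor (ci 0) (ci 1) (ci 2) (fun p => Pi.single (ri p) 1)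
  have h2 : (MmatPoly X.cam).submatrix ri ci =
      Matrix.of fun p q => X.L (![ci 0, ci 1, ci 2] q) (Pi.single (ri p) 1) := by
    ext p q : 2
    rw [Matrix.of_apply, L_single]
    fin_cases q <;> rfl
  rw [h2, h1]
  exact X.isHomogeneous_minor _ _ _ _ _ _

/-- Graded Nakayama: if `J ⊆ I + (x)` and `x` is a nonzerodivisor modulo `J`, then `J ⊆ I`. -/
lemma Homog.le_of_le_sup_span {I J : Ideal (LineRing m)} (hI : Homog I) (hIJ : I ≤ J)
    {x : LineRing m} (hx : x.IsHomogeneous 1) (hJ : J ≤ I ⊔ Ideal.span {x})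
    (hreg : ∀ f, f * x ∈ J → f ∈ J) : J ≤ I := by
  have h1 : ∀ n : ℕ, ∀ f ∈ J, ∃ g ∈ J, f - g * x ^ n ∈ I := by
    intro n
    induction n with
    | zero => exact fun f hf => ⟨f, hf, by simp⟩
    | succ n ih =>
      intro f hf
      obtain ⟨g, hg, hfg⟩ := ih f hf
      have h2 := hJ hg
      rw [sup_comm, Ideal.mem_span_singleton_sup] at h2
      obtain ⟨h, b, hb, rfl⟩ := h2
      refine ⟨h, hreg h ?_, ?_⟩
      · have := J.sub_mem hg (hIJ hb)
        simpa using this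
      · have := I.add_mem hfg (I.mul_mem_right (x ^ n) hb)
        convert this using 1
        ring
  intro f hf
  obtain ⟨g, -, hg⟩ := h1 (f.totalDegree + 1) f hf
  rw [← sum_homogeneousComponent f]
  refine I.sum_mem fun d hd => ?_
  have h2 := hI _ hg d
  have h3 : homogeneousComponent d (g * x ^ (f.totalDegree + 1)) = 0 := by
    rw [← sum_homogeneousComponent g, Finset.sum_mul, map_sum]
    refine Finset.sum_eq_zero fun e _ => ?_
    have h4 := (homogeneousComponent_isHomogeneous e g).mul (hx.pow (f.totalDegree + 1))
    rw [homogeneousComponent_of_mem h4, if_neg]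
    have := Finset.mem_range.mp hd
    omega
  rwa [map_sub, h3, sub_zero] at h2

end CameraData

namespace CameraData

variable {m : ℕ} (X : CameraData m)

/-- The ideal generated by the linear forms `L j φ` for `φ ∈ K j`. -/
def P (K : Fin m → Submodule ℂ Vec4) : Ideal (LineRing m) :=
  Ideal.span {p | ∃ j, ∃ φ ∈ K j, X.L j φ = p}

variable {X} {K : Fin m → Submodule ℂ Vec4}

lemma L_mem_P {j : Fin m} {φ : Vec4} (h : φ ∈ K j) : X.L j φ ∈ X.P K :=
  Ideal.subset_span ⟨j, φ, h, rfl⟩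

lemma P_le_iff {J : Ideal (LineRing m)} : X.P K ≤ J ↔ ∀ j, ∀ φ ∈ K j, X.L j φ ∈ J := by
  refine Ideal.span_le.trans ⟨fun h j φ hφ => h ⟨j, φ, hφ, rfl⟩, ?_⟩
  rintro h _ ⟨j, φ, hφ, rfl⟩
  exact h j φ hφ

lemma P_mono {K K' : Fin m → Submodule ℂ Vec4} (h : ∀ j, K j ≤ K' j) : X.P K ≤ X.P K' :=
  P_le_iff.mpr fun j _ hφ => L_mem_P (h j hφ)

lemma exists_retraction (K : Submodule ℂ Vec4) :
    ∃ q : Vec4 →ₗ[ℂ] Vec4, LinearMap.ker q = K ∧ ∀ x, x - q x ∈ K := by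
  obtain ⟨f, hf⟩ := K.mkQ.exists_rightInverse_of_surjective K.range_mkQ
  have hf' : ∀ x, K.mkQ (f x) = x := fun x => LinearMap.congr_fun hf x
  refine ⟨f.comp K.mkQ, ?_, fun x => ?_⟩
  · ext x
    rw [LinearMap.mem_ker, LinearMap.comp_apply]
    constructor
    · intro h
      have := hf' (K.mkQ x)
      rw [h, map_zero] at this
      exact (Submodule.Quotient.mk_eq_zero K).mp this.symm
    · intro h
      rw [show K.mkQ x = 0 from (Submodule.Quotient.mk_eq_zero K).mpr h, map_zero]
  · rw [← Submodule.Quotient.mk_eq_zero K]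
    change K.mkQ _ = 0
    rw [map_sub, LinearMap.comp_apply, hf', sub_self]

lemma exists_ker_eq_P (hK : ∀ j, X.c j ∈ K j) :
    ∃ F : LineRing m →ₐ[ℂ] LineRing m, RingHom.ker F = X.P K ∧
      ∀ j φ, F (X.L j φ) = 0 ↔ φ ∈ K j := by
  choose q hq hq' using fun j => exists_retraction (K j)
  obtain ⟨F, hF⟩ := X.exists_lift (fun j => (X.L j).comp (q j)) (fun j => by
    have : q j (X.c j) = 0 := by rw [← LinearMap.mem_ker, hq]; exact hK j
    simp [this])
  have hL : ∀ j φ, F (X.L j φ) = 0 ↔ φ ∈ K j := by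
    intro j φ
    rw [hF, LinearMap.comp_apply, L_eq_zero_iff]
    constructor
    · intro h
      have h1 : q j φ ∈ K j := (Submodule.span_singleton_le_iff_mem _ _).mpr (hK j) h
      have := (K j).add_mem (hq' j φ) h1
      simpa using this
    · intro h
      rw [← hq j] at h
      rw [LinearMap.mem_ker.mp h]
      exact zero_mem _
  refine ⟨F, le_antisymm ?_ ?_, hL⟩
  · have h1 : (Ideal.Quotient.mkₐ ℂ (X.P K)).comp F = Ideal.Quotient.mkₐ ℂ (X.P K) := by
      apply X.hom_ext
      intro j φ
      rw [AlgHom.comp_apply, hF, eq_comm, ← sub_eq_zero, ← map_sub, LinearMap.comp_apply,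
        ← map_sub]
      exact Ideal.Quotient.eq_zero_iff_mem.mpr (L_mem_P (hq' j φ))
    intro x hx
    have h2 := AlgHom.congr_fun h1 x
    rw [AlgHom.comp_apply, RingHom.mem_ker.mp hx, map_zero] at h2
    exact Ideal.Quotient.eq_zero_iff_mem.mp h2.symm
  · exact P_le_iff.mpr fun j φ hφ => (hL j φ).mpr hφ

lemma P_isPrime (hK : ∀ j, X.c j ∈ K j) : (X.P K).IsPrime := by
  obtain ⟨F, hF, -⟩ := exists_ker_eq_P hK
  rw [← hF]
  exact RingHom.ker_isPrime F

lemma L_mem_P_iff (hK : ∀ j, X.c j ∈ K j) {j : Fin m} {φ : Vec4} :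
    X.L j φ ∈ X.P K ↔ φ ∈ K j := by
  obtain ⟨F, hF, hL⟩ := exists_ker_eq_P hK
  rw [← hF, RingHom.mem_ker, hL]

lemma P_update_sup (j : Fin m) (x : Vec4) :
    X.P (Function.update K j (K j ⊔ Submodule.span ℂ {x})) = X.P K ⊔ Ideal.span {X.L j x} := by
  apply le_antisymm
  · rw [P_le_iff]
    intro i φ hφ
    by_cases hij : i = j
    · subst hij
      rw [Function.update_self] at hφ
      obtain ⟨a, ha, b, hb, rfl⟩ := Submodule.mem_sup.mp hφ
      obtain ⟨t, rfl⟩ := Submodule.mem_span_singleton.mp hb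
      rw [map_add, map_smul, smul_eq_C_mul]
      exact add_mem (Ideal.mem_sup_left (L_mem_P ha)) (Ideal.mem_sup_right
        (Ideal.mul_mem_left _ _ (Ideal.mem_span_singleton_self _)))
    · rw [Function.update_of_ne hij] at hφ
      exact Ideal.mem_sup_left (L_mem_P hφ)
  · refine sup_le (P_mono fun i => ?_) ((Ideal.span_singleton_le_iff_mem _).mpr (L_mem_P ?_))
    · by_cases hij : i = j
      · subst hij
        rw [Function.update_self]
        exact le_sup_left
      · rw [Function.update_of_ne hij]
    · rw [Function.update_self]
      exact Submodule.mem_sup_right (Submodule.mem_span_singleton_self x)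

lemma finrank_le_four (K : Submodule ℂ Vec4) : Module.finrank ℂ K ≤ 4 := by
  simpa using K.finrank_le

lemma finrank_sup_span_singleton {K : Submodule ℂ Vec4} {x : Vec4} (hx : x ∉ K) :
    Module.finrank ℂ (K ⊔ Submodule.span ℂ {x} : Submodule ℂ Vec4) = Module.finrank ℂ K + 1 := by
  have h1 : x ≠ 0 := fun h => hx (h ▸ zero_mem _)
  have h2 : K ⊓ Submodule.span ℂ {x} = ⊥ := by
    rw [← disjoint_iff, Submodule.disjoint_span_singleton' h1]
    exact hx
  have := Submodule.finrank_sup_add_finrank_inf_eq K (Submodule.span ℂ {x})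
  rw [h2, finrank_bot, finrank_span_singleton h1] at this
  simpa using this

lemma depthGE_P (n : ℕ) : ∀ K : Fin m → Submodule ℂ Vec4, (∀ j, X.c j ∈ K j) →
    n ≤ ∑ j, (4 - Module.finrank ℂ (K j)) → DepthGE (𝔪 m) (LineRing m ⧸ X.P K) n := by
  induction n with
  | zero => exact fun _ _ _ => DepthGE.zero
  | succ n ih =>
    intro K hK hn
    obtain ⟨j, -, hj⟩ : ∃ j ∈ Finset.univ, 4 - Module.finrank ℂ (K j) ≠ 0 := by
      by_contra! h
      rw [Finset.sum_eq_zero h] at hn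
      omega
    obtain ⟨x, hx⟩ : ∃ x, x ∉ K j := by
      by_contra! h
      rw [Submodule.eq_top_iff'.mpr h] at hj
      simp at hj
    have := P_isPrime hK
    refine DepthGE.of_nonZeroDivisor (X.L_mem_𝔪 j x)
      (fun p hp => (Ideal.IsPrime.mem_or_mem this hp).resolve_right
        (fun h => hx ((L_mem_P_iff hK).mp h))) ?_
    rw [← P_update_sup]
    refine ih _ (fun i => ?_) ?_
    · by_cases hij : i = j
      · subst hij
        rw [Function.update_self]
        exact Submodule.mem_sup_left (hK i)
      · rw [Function.update_of_ne hij]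
        exact hK i
    · rw [← Finset.add_sum_erase _ _ (Finset.mem_univ j)] at hn ⊢
      rw [Function.update_self, finrank_sup_span_singleton hx]
      rw [Finset.sum_congr rfl (g := fun i => 4 - Module.finrank ℂ (K i))]
      · have := finrank_le_four (K j)
        omega
      · intro i hi
        rw [Function.update_of_ne (Finset.ne_of_mem_erase hi)]

end CameraData

namespace CameraData

variable {m : ℕ} (X : CameraData m) (w : Fin m → Vec4)

/-- The plane of `ℂ⁴` spanned by the `j`-th center and the auxiliary vector `w j`. -/
def 𝓛 (j : Fin m) : Submodule ℂ Vec4 := Submodule.span ℂ {X.c j, w j}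

variable {X w}

lemma c_mem_𝓛 (j : Fin m) : X.c j ∈ X.𝓛 w j := Submodule.subset_span (by simp)

lemma w_mem_𝓛 (j : Fin m) : w j ∈ X.𝓛 w j := Submodule.subset_span (by simp)

variable (X w)

/-- Restrict a family of subspaces to the columns in `B`, all other columns being killed. -/
def onCols (B : Finset (Fin m)) (K : Fin m → Submodule ℂ Vec4) : Fin m → Submodule ℂ Vec4 :=
  fun j => if j ∈ B then K j else ⊤

variable {X w}

lemma c_mem_onCols {B : Finset (Fin m)} {K : Fin m → Submodule ℂ Vec4}
    (h : ∀ j ∈ B, X.c j ∈ K j) (j : Fin m) : X.c j ∈ onCols B K j := by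
  unfold onCols
  split_ifs with hj
  · exact h j hj
  · trivial

lemma mem_onCols {B : Finset (Fin m)} {K : Fin m → Submodule ℂ Vec4} {j : Fin m} {φ : Vec4} :
    φ ∈ onCols B K j ↔ (j ∈ B → φ ∈ K j) := by
  unfold onCols
  split_ifs with hj <;> simp [hj]

lemma sum_finrank_onCols {B : Finset (Fin m)} {K : Fin m → Submodule ℂ Vec4} {d : ℕ}
    (h : ∀ j ∈ B, 4 - Module.finrank ℂ (K j) = d) :
    ∑ j, (4 - Module.finrank ℂ (onCols B K j)) = B.card * d := by
  rw [← Finset.sum_subset (Finset.subset_univ B)]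
  · rw [Finset.sum_congr rfl (g := fun _ => d), Finset.sum_const, smul_eq_mul]
    intro j hj
    rw [onCols, if_pos hj, h j hj]
  · intro j _ hj
    rw [onCols, if_neg hj]
    simp

variable (X w)

/-- Coordinates on the quotients `ℂ⁴ / 𝓛 j` for `j ∈ B`, with lifts of the dual bases. -/
structure Coord (B : Finset (Fin m)) where
  α : Fin m → Vec4 →ₗ[ℂ] ℂ
  β : Fin m → Vec4 →ₗ[ℂ] ℂ
  p : Fin m → Vec4
  q : Fin m → Vec4
  αp : ∀ j ∈ B, α j (p j) = 1
  αq : ∀ j ∈ B, α j (q j) = 0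
  βp : ∀ j ∈ B, β j (p j) = 0
  βq : ∀ j ∈ B, β j (q j) = 1
  mem_𝓛 : ∀ j ∈ B, ∀ φ, φ ∈ X.𝓛 w j ↔ α j φ = 0 ∧ β j φ = 0

variable {X w}

namespace Coord

variable {B B' : Finset (Fin m)} (e : X.Coord w B)

/-- Exchange the two coordinates. -/
@[simps] def swap : X.Coord w B where
  α := e.β
  β := e.α
  p := e.q
  q := e.p
  αp := e.βq
  αq := e.βp
  βp := e.αq
  βq := e.αp
  mem_𝓛 j hj φ := (e.mem_𝓛 j hj φ).trans and_comm

/-- Restrict coordinates to fewer columns. -/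
@[simps] def restrict (h : B' ⊆ B) : X.Coord w B' where
  α := e.α
  β := e.β
  p := e.p
  q := e.q
  αp j hj := e.αp j (h hj)
  αq j hj := e.αq j (h hj)
  βp j hj := e.βp j (h hj)
  βq j hj := e.βq j (h hj)
  mem_𝓛 j hj := e.mem_𝓛 j (h hj)

/-- The first coordinate of column `j`. -/
def a (j : Fin m) : LineRing m := X.L j (e.p j)

/-- The second coordinate of column `j`. -/
def b (j : Fin m) : LineRing m := X.L j (e.q j)

/-- The `2 × 2` minor of columns `i` and `j`. -/
def br (i j : Fin m) : LineRing m := e.a i * e.b j - e.b i * e.a j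

/-- The prime ideal of the locus where all first coordinates vanish. -/
def M : Ideal (LineRing m) := X.P (onCols B fun j => LinearMap.ker (e.β j))

/-- The ideal generated by all `2 × 2` minors in the columns in `B`. -/
def Q : Ideal (LineRing m) :=
  X.P (onCols B (X.𝓛 w)) ⊔ Ideal.span {x | ∃ i ∈ B, ∃ j ∈ B, e.br i j = x}

variable {e}

lemma decomp {j : Fin m} (hj : j ∈ B) (φ : Vec4) :
    φ - e.α j φ • e.p j - e.β j φ • e.q j ∈ X.𝓛 w j := by
  rw [e.mem_𝓛 j hj]
  simp [e.αp j hj, e.αq j hj, e.βp j hj, e.βq j hj]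

lemma L_sub_mem {j : Fin m} (hj : j ∈ B) (φ : Vec4) :
    X.L j φ - (C (e.α j φ) * e.a j + C (e.β j φ) * e.b j) ∈ X.P (onCols B (X.𝓛 w)) := by
  have h := L_mem_P (X := X) (K := onCols B (X.𝓛 w))
    (mem_onCols.mpr fun _ => e.decomp hj φ)
  rw [map_sub, map_sub, map_smul, map_smul, smul_eq_C_mul, smul_eq_C_mul] at h
  rwa [sub_sub] at h

lemma α_c {j : Fin m} (hj : j ∈ B) : e.α j (X.c j) = 0 :=
  ((e.mem_𝓛 j hj _).mp (c_mem_𝓛 j)).1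

lemma β_c {j : Fin m} (hj : j ∈ B) : e.β j (X.c j) = 0 :=
  ((e.mem_𝓛 j hj _).mp (c_mem_𝓛 j)).2

lemma M_isPrime : e.M.IsPrime :=
  P_isPrime (c_mem_onCols fun _ hj => LinearMap.mem_ker.mpr (β_c hj))

lemma a_mem_M (j : Fin m) : e.a j ∈ e.M :=
  L_mem_P (mem_onCols.mpr fun hj => LinearMap.mem_ker.mpr (e.βp j hj))

lemma b_notMem_M {j : Fin m} (hj : j ∈ B) : e.b j ∉ e.M := by
  rw [M, b, L_mem_P_iff (c_mem_onCols fun _ hj => LinearMap.mem_ker.mpr (β_c hj)), mem_onCols]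
  intro h
  simpa [e.βq j hj] using h hj

lemma P_le_M : X.P (onCols B (X.𝓛 w)) ≤ e.M :=
  P_mono fun j φ hφ => mem_onCols.mpr fun hj =>
    LinearMap.mem_ker.mpr ((e.mem_𝓛 j hj φ).mp (mem_onCols.mp hφ hj)).2

lemma br_mem_M (i j : Fin m) : e.br i j ∈ e.M :=
  sub_mem (Ideal.mul_mem_right _ _ (a_mem_M i)) (Ideal.mul_mem_left _ _ (a_mem_M j))

lemma Q_le {J : Ideal (LineRing m)} (h1 : X.P (onCols B (X.𝓛 w)) ≤ J)
    (h2 : ∀ i ∈ B, ∀ j ∈ B, e.br i j ∈ J) : e.Q ≤ J := by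
  refine sup_le h1 (Ideal.span_le.mpr ?_)
  rintro _ ⟨i, hi, j, hj, rfl⟩
  exact h2 i hi j hj

lemma P_le_Q : X.P (onCols B (X.𝓛 w)) ≤ e.Q := le_sup_left

lemma br_mem_Q {i j : Fin m} (hi : i ∈ B) (hj : j ∈ B) : e.br i j ∈ e.Q :=
  Ideal.mem_sup_right (Ideal.subset_span ⟨i, hi, j, hj, rfl⟩)

lemma Q_le_M : e.Q ≤ e.M := Q_le P_le_M fun i _ j _ => br_mem_M i j

/-- Induction principle for membership in the ideal `M`. -/
lemma M_le {J : Ideal (LineRing m)} (h1 : X.P (onCols B (X.𝓛 w)) ≤ J) (h2 : ∀ j ∈ B, e.a j ∈ J) :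
    e.M ≤ J := by
  refine P_le_iff.mpr fun j φ hφ => ?_
  by_cases hj : j ∈ B
  · have h := h1 (e.L_sub_mem hj φ)
    rw [LinearMap.mem_ker.mp (mem_onCols.mp hφ hj), C_0, zero_mul, add_zero] at h
    have := J.add_mem h (J.mul_mem_left (C (e.α j φ)) (h2 j hj))
    simpa using this
  · exact h1 (L_mem_P (mem_onCols.mpr fun h => absurd h hj))

lemma homog_P {K : Fin m → Submodule ℂ Vec4} : Homog (X.P K) := by
  refine homog_span ?_
  rintro _ ⟨j, φ, -, rfl⟩
  exact ⟨1, X.isHomogeneous_L j φ⟩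

lemma homog_Q : Homog e.Q := by
  refine homog_P.sup (homog_span ?_)
  rintro _ ⟨i, -, j, -, rfl⟩
  exact ⟨2, ((X.isHomogeneous_L i _).mul (X.isHomogeneous_L j _)).sub
    ((X.isHomogeneous_L i _).mul (X.isHomogeneous_L j _))⟩

lemma Q_restrict_le {r : Fin m} :
    (e.restrict (B.erase_subset r)).Q ≤ e.Q ⊔ Ideal.span {e.a r} ⊔ Ideal.span {e.b r} := by
  refine Q_le (P_le_iff.mpr fun j φ hφ => ?_) fun i hi j hj => ?_
  · by_cases hjr : j = r
    · subst hjr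
      by_cases hj : j ∈ B
      · have h := e.L_sub_mem hj φ
        rw [show X.L j φ = (X.L j φ - (C (e.α j φ) * e.a j + C (e.β j φ) * e.b j)) +
          C (e.α j φ) * e.a j + C (e.β j φ) * e.b j by ring]
        refine add_mem (add_mem ?_ ?_) ?_
        · exact Ideal.mem_sup_left (Ideal.mem_sup_left (P_le_Q h))
        · exact Ideal.mem_sup_left (Ideal.mem_sup_right
            (Ideal.mul_mem_left _ _ (Ideal.mem_span_singleton_self _)))
        · exact Ideal.mem_sup_right (Ideal.mul_mem_left _ _ (Ideal.mem_span_singleton_self _))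
      · exact Ideal.mem_sup_left (Ideal.mem_sup_left (P_le_Q (L_mem_P
          (mem_onCols.mpr fun h => absurd h hj))))
    · exact Ideal.mem_sup_left (Ideal.mem_sup_left (P_le_Q (L_mem_P (mem_onCols.mpr fun h =>
        mem_onCols.mp hφ (Finset.mem_erase.mpr ⟨hjr, h⟩)))))
  · exact Ideal.mem_sup_left (Ideal.mem_sup_left
      (br_mem_Q (Finset.mem_of_mem_erase hi) (Finset.mem_of_mem_erase hj)))

lemma Q_le_restrict (r : Fin m) : e.Q ≤ (e.restrict (B.erase_subset r)).Q := by
  have hr : ∀ φ, X.L r φ ∈ (e.restrict (B.erase_subset r)).Q := fun φ =>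
    P_le_Q (L_mem_P (mem_onCols.mpr fun h => absurd rfl (Finset.ne_of_mem_erase h)))
  refine Q_le (le_trans (P_mono fun j φ hφ => ?_) P_le_Q) fun i hi j hj => ?_
  · exact mem_onCols.mpr fun h => mem_onCols.mp hφ (Finset.mem_of_mem_erase h)
  · by_cases hir : i = r
    · subst hir
      exact sub_mem (Ideal.mul_mem_right _ _ (hr _)) (Ideal.mul_mem_right _ _ (hr _))
    · by_cases hjr : j = r
      · subst hjr
        exact sub_mem (Ideal.mul_mem_left _ _ (hr _)) (Ideal.mul_mem_left _ _ (hr _))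
      · exact br_mem_Q (e := e.restrict (B.erase_subset r))
          (Finset.mem_erase.mpr ⟨hir, hi⟩) (Finset.mem_erase.mpr ⟨hjr, hj⟩)

variable (e) in
/-- A parametrization of the columns in `B` as multiples of a common vector. -/
def IsParam (σ : LineRing m →ₐ[ℂ] MvPolynomial (Fin 2 ⊕ Fin m) ℂ) : Prop :=
  ∀ j φ, σ (X.L j φ) = if j ∈ B then
    (e.α j φ • MvPolynomial.X (Sum.inl 0) + e.β j φ • MvPolynomial.X (Sum.inl 1)) *
      MvPolynomial.X (Sum.inr j) else 0

variable (e) in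
lemma exists_isParam : ∃ σ, e.IsParam σ := by
  obtain ⟨σ, hσ⟩ := X.exists_lift (B := MvPolynomial (Fin 2 ⊕ Fin m) ℂ) (fun j => if j ∈ B then
    (LinearMap.mulRight ℂ (MvPolynomial.X (Sum.inr j))).comp
      ((e.α j).smulRight (MvPolynomial.X (Sum.inl 0)) +
        (e.β j).smulRight (MvPolynomial.X (Sum.inl 1))) else 0) (fun j => by
      split_ifs with hj
      · simp [α_c hj, β_c hj]
      · rfl)
  refine ⟨σ, fun j φ => ?_⟩
  rw [hσ]
  split_ifs <;> simp

variable {σ : LineRing m →ₐ[ℂ] MvPolynomial (Fin 2 ⊕ Fin m) ℂ}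

lemma IsParam.a (hσ : e.IsParam σ) {j : Fin m} (hj : j ∈ B) :
    σ (e.a j) = MvPolynomial.X (Sum.inl 0) * MvPolynomial.X (Sum.inr j) := by
  rw [Coord.a, hσ, if_pos hj, e.αp j hj, e.βp j hj]
  simp

lemma IsParam.b (hσ : e.IsParam σ) {j : Fin m} (hj : j ∈ B) :
    σ (e.b j) = MvPolynomial.X (Sum.inl 1) * MvPolynomial.X (Sum.inr j) := by
  rw [Coord.b, hσ, if_pos hj, e.αq j hj, e.βq j hj]
  simp

lemma IsParam.Q_le_ker (hσ : e.IsParam σ) : e.Q ≤ RingHom.ker σ := by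
  refine Q_le (P_le_iff.mpr fun j φ hφ => ?_) fun i hi j hj => ?_
  · rw [RingHom.mem_ker]
    rw [hσ]
    split_ifs with hj
    · have := (e.mem_𝓛 j hj φ).mp (mem_onCols.mp hφ hj)
      rw [this.1, this.2]
      simp
    · rfl
  · rw [RingHom.mem_ker]
    rw [br, map_sub, map_mul, map_mul, hσ.a hi, hσ.b hj, hσ.b hi, hσ.a hj]
    ring

lemma IsParam.ker_le_M (hσ : e.IsParam σ) : RingHom.ker σ ≤ e.M := by
  let T : MvPolynomial (Fin 2 ⊕ Fin m) ℂ →ₐ[ℂ] (LineRing m ⧸ e.M) :=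
    aeval (Sum.elim ![0, 1] fun j => Ideal.Quotient.mk e.M (e.b j))
  have h : T.comp σ = Ideal.Quotient.mkₐ ℂ e.M := by
    apply X.hom_ext
    intro j φ
    rw [AlgHom.comp_apply, hσ]
    split_ifs with hj
    · have h1 : X.L j φ - C (e.β j φ) * e.b j ∈ e.M := by
        have h2 := e.M.add_mem (P_le_M (e.L_sub_mem hj φ))
          (e.M.mul_mem_left (C (e.α j φ)) (a_mem_M j))
        convert h2 using 1
        ring
      have h3 : Ideal.Quotient.mkₐ ℂ e.M (X.L j φ) =
          Ideal.Quotient.mk e.M (C (e.β j φ) * e.b j) := Ideal.Quotient.eq.mpr h1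
      rw [h3, ← smul_eq_C_mul]
      simp only [T, map_mul, map_add, map_smul, aeval_X, Sum.elim_inl, Sum.elim_inr,
        Matrix.cons_val_zero, Matrix.cons_val_one, smul_zero, zero_add, smul_mul_assoc, one_mul]
      rfl
    · rw [map_zero, eq_comm]
      exact Ideal.Quotient.eq_zero_iff_mem.mpr
        (L_mem_P (mem_onCols.mpr fun h => absurd h hj))
  intro f hf
  have h1 := AlgHom.congr_fun h f
  rw [AlgHom.comp_apply, RingHom.mem_ker.mp hf, map_zero] at h1
  exact Ideal.Quotient.eq_zero_iff_mem.mp h1.symm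

lemma IsParam.ker_le_ker_restrict (hσ : e.IsParam σ) (r : Fin m)
    {τ : LineRing m →ₐ[ℂ] MvPolynomial (Fin 2 ⊕ Fin m) ℂ}
    (hτ : (e.restrict (B.erase_subset r)).IsParam τ) : RingHom.ker σ ≤ RingHom.ker τ := by
  let T : MvPolynomial (Fin 2 ⊕ Fin m) ℂ →ₐ[ℂ] MvPolynomial (Fin 2 ⊕ Fin m) ℂ :=
    aeval (Sum.elim (fun i => MvPolynomial.X (Sum.inl i))
      fun j => if j = r then 0 else MvPolynomial.X (Sum.inr j))
  have h : T.comp σ = τ := by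
    apply X.hom_ext
    intro j φ
    rw [AlgHom.comp_apply, hσ, hτ]
    by_cases hj : j ∈ B
    · by_cases hjr : j = r
      · subst hjr
        simp [hj, T]
      · simp [hj, hjr, T]
    · simp [hj]
  intro f hf
  rw [RingHom.mem_ker] at hf ⊢
  have h1 := AlgHom.congr_fun h f
  rw [AlgHom.comp_apply, show σ f = 0 from hf, map_zero] at h1
  exact h1.symm

lemma M_mul_b_mem {r : Fin m} (hr : r ∈ B) {f : LineRing m} (hf : f ∈ e.M) :
    f * e.b r ∈ e.Q ⊔ Ideal.span {e.a r} := by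
  suffices h : e.M ≤ (e.Q ⊔ Ideal.span {e.a r}).colon {e.b r} by
    have := h hf
    rw [Submodule.mem_colon_singleton] at this
    simpa using this
  refine M_le (fun x hx => ?_) fun j hj => ?_
  · rw [Submodule.mem_colon_singleton]
    exact Ideal.mul_mem_right _ _ (Ideal.mem_sup_left (P_le_Q hx))
  · rw [Submodule.mem_colon_singleton, smul_eq_mul,
      show e.a j * e.b r = e.br j r + e.b j * e.a r by rw [br]; ring]
    exact add_mem (Ideal.mem_sup_left (br_mem_Q hj hr))
      (Ideal.mem_sup_right (Ideal.mul_mem_left _ _ (Ideal.mem_span_singleton_self _)))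

lemma ker_eq_Q_aux (n : ℕ) : ∀ (B : Finset (Fin m)) (e : X.Coord w B)
    (σ : LineRing m →ₐ[ℂ] MvPolynomial (Fin 2 ⊕ Fin m) ℂ), B.card = n → e.IsParam σ →
    RingHom.ker σ ≤ e.Q := by
  induction n with
  | zero =>
    intro B e σ hB hσ
    refine hσ.ker_le_M.trans (le_trans (P_mono fun j φ _ => mem_onCols.mpr fun hj => ?_) P_le_Q)
    rw [Finset.card_eq_zero.mp hB] at hj
    simp at hj
  | succ n ih =>
    intro B e σ hB hσ
    obtain ⟨r, hr⟩ : B.Nonempty := Finset.card_pos.mp (by omega)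
    obtain ⟨τ, hτ⟩ := (e.restrict (B.erase_subset r)).exists_isParam
    refine homog_Q.le_of_le_sup_span hσ.Q_le_ker (x := e.a r) (X.isHomogeneous_L r _) ?_ ?_
    · intro f hf
      have h1 := Q_restrict_le (ih _ _ τ (by rw [Finset.card_erase_of_mem hr]; omega) hτ
        (hσ.ker_le_ker_restrict r hτ hf))
      rw [sup_comm, Ideal.mem_span_singleton_sup] at h1
      obtain ⟨h, g, hg, rfl⟩ := h1
      refine add_mem ?_ hg
      have h2 : e.Q ⊔ Ideal.span {e.a r} ≤ e.M :=
        sup_le Q_le_M ((Ideal.span_singleton_le_iff_mem _).mpr (a_mem_M r))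
      have h3 : h * e.b r ∈ e.M := by
        have := e.M.sub_mem (hσ.ker_le_M hf) (h2 hg)
        simpa using this
      exact M_mul_b_mem hr ((M_isPrime.mem_or_mem h3).resolve_right (b_notMem_M hr))
    · intro f hf
      rw [RingHom.mem_ker] at hf ⊢
      change σ _ = 0 at hf
      rw [map_mul, hσ.a hr] at hf
      simpa using hf

lemma IsParam.ker_eq_Q (hσ : e.IsParam σ) : RingHom.ker σ = e.Q :=
  le_antisymm (ker_eq_Q_aux _ _ e σ rfl hσ) hσ.Q_le_ker

variable (e) in
lemma Q_isPrime : e.Q.IsPrime := by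
  obtain ⟨σ, hσ⟩ := e.exists_isParam
  rw [← hσ.ker_eq_Q]
  exact RingHom.ker_isPrime σ

lemma a_notMem_Q {j : Fin m} (hj : j ∈ B) : e.a j ∉ e.Q := by
  obtain ⟨σ, hσ⟩ := e.exists_isParam
  rw [← hσ.ker_eq_Q, RingHom.mem_ker]
  change σ _ ≠ 0
  rw [hσ.a hj]
  simp

lemma finrank_ker_β {j : Fin m} (hj : j ∈ B) :
    Module.finrank ℂ (LinearMap.ker (e.β j)) = 3 := by
  have h1 := (e.β j).finrank_range_add_finrank_ker
  have h2 : LinearMap.range (e.β j) = ⊤ := by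
    rw [LinearMap.range_eq_top]
    apply LinearMap.surjective_of_ne_zero
    intro h
    have := e.βq j hj
    rw [h] at this
    simp at this
  rw [h2, finrank_top] at h1
  simp at h1
  omega

lemma depthGE_M : DepthGE (𝔪 m) (LineRing m ⧸ e.M) B.card :=
  depthGE_P _ _ (c_mem_onCols fun _ hj => LinearMap.mem_ker.mpr (β_c hj))
    (by rw [sum_finrank_onCols (d := 1) fun j hj => by rw [finrank_ker_β hj], mul_one])

lemma finrank_𝓛_le (j : Fin m) : Module.finrank ℂ (X.𝓛 w j) ≤ 2 := by
  have := finrank_span_le_card (R := ℂ) ({X.c j, w j} : Set Vec4)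
  refine this.trans ?_
  simpa using Finset.card_le_two (a := X.c j) (b := w j)

lemma depthGE_P𝓛 (B : Finset (Fin m)) :
    DepthGE (𝔪 m) (LineRing m ⧸ X.P (onCols B (X.𝓛 w))) (2 * B.card) := by
  refine depthGE_P _ _ (c_mem_onCols fun j _ => c_mem_𝓛 j) ?_
  rw [← Finset.sum_subset (Finset.subset_univ B), mul_comm, ← smul_eq_mul, ← Finset.sum_const]
  · refine Finset.sum_le_sum fun j hj => ?_
    rw [onCols, if_pos hj]
    have := finrank_𝓛_le (X := X) (w := w) j
    omega
  · intro j _ hj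
    rw [onCols, if_neg hj]
    simp

lemma Q_sup_eq (r : Fin m) :
    e.Q ⊔ Ideal.span {e.a r} ⊔ Ideal.span {e.b r} = (e.restrict (B.erase_subset r)).Q := by
  have hr : ∀ φ, X.L r φ ∈ (e.restrict (B.erase_subset r)).Q := fun φ =>
    P_le_Q (L_mem_P (mem_onCols.mpr fun h => absurd rfl (Finset.ne_of_mem_erase h)))
  exact le_antisymm (sup_le (sup_le (Q_le_restrict r)
    ((Ideal.span_singleton_le_iff_mem _).mpr (hr _)))
    ((Ideal.span_singleton_le_iff_mem _).mpr (hr _))) Q_restrict_le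

lemma depthGE_Q_aux (n : ℕ) : ∀ (B : Finset (Fin m)) (e : X.Coord w B), B.card = n + 1 →
    DepthGE (𝔪 m) (LineRing m ⧸ e.Q) (n + 2) := by
  induction n with
  | zero =>
    intro B e hB
    have h := depthGE_P𝓛 (X := X) (w := w) B
    have hQ : e.Q = X.P (onCols B (X.𝓛 w)) := by
      refine le_antisymm (Q_le le_rfl fun i hi j hj => ?_) P_le_Q
      have : i = j := Finset.card_le_one.mp hB.le i hi j hj
      subst this
      rw [br, mul_comm, sub_self]
      exact zero_mem _
    rw [hQ]
    rw [hB] at h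
    exact h
  | succ n ih =>
    intro B e hB
    obtain ⟨r, hr⟩ : B.Nonempty := Finset.card_pos.mp (by omega)
    have hQ := e.Q_isPrime
    have hM := M_isPrime (e := e)
    refine DepthGE.of_nonZeroDivisor (X.L_mem_𝔪 r (e.p r))
      (fun p hp => (hQ.mem_or_mem hp).resolve_right (a_notMem_Q hr)) ?_
    refine DepthGE.of_colon_prime (P := e.M) (x := e.b r)
      (sup_le Q_le_M ((Ideal.span_singleton_le_iff_mem _).mpr (a_mem_M r))) (b_notMem_M hr)
      (fun p hp => M_mul_b_mem hr hp) (by rw [← hB]; exact depthGE_M) ?_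
    have h := ih _ (e.restrict (B.erase_subset r)) (by rw [Finset.card_erase_of_mem hr]; omega)
    rw [← Q_sup_eq r] at h
    exact h

lemma depthGE_Q (hB : B.Nonempty) : DepthGE (𝔪 m) (LineRing m ⧸ e.Q) (B.card + 1) := by
  obtain ⟨n, hn⟩ := Nat.exists_eq_succ_of_ne_zero (Finset.card_ne_zero.mpr hB)
  rw [hn]
  exact depthGE_Q_aux n B e hn

end Coord

end CameraData

namespace CameraData

variable {m : ℕ} (X : CameraData m) (w : Fin m → Vec4)

/-- A basis of `ℂ⁴` in which the planes `𝓛 j` for `j ∈ B` have simple equations. -/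
structure Frame (B : Finset (Fin m)) (i j k : Fin m) where
  e : Module.Basis (Fin 4) ℂ Vec4
  n1 : ℂ
  n2 : ℂ
  hij : i ≠ j
  hik : i ≠ k
  hjk : j ≠ k
  hi : ∀ φ, φ ∈ X.𝓛 w i ↔ e.coord 0 φ = 0 ∧ e.coord 1 φ = 0
  hj : ∀ φ, φ ∈ X.𝓛 w j ↔ e.coord 2 φ = 0 ∧ e.coord 3 φ = 0
  hk : ∀ φ, φ ∈ X.𝓛 w k ↔ e.coord 0 φ + e.coord 2 φ = 0 ∧ e.coord 1 φ + e.coord 3 φ = 0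
  other : ∀ l ∈ B, l ≠ i → l ≠ j → l ≠ k → ∀ φ, φ ∈ X.𝓛 w l ↔
    e.coord 0 φ + n1 * e.coord 2 φ = 0 ∧ e.coord 1 φ + n2 * e.coord 3 φ = 0

/-- The subspace `N` meets the plane `𝓛 j` nontrivially. -/
def Meets (N : Submodule ℂ Vec4) (j : Fin m) : Prop := ∃ x ∈ N, x ∈ X.𝓛 w j ∧ x ≠ 0

/-- The genericity conditions on the auxiliary vectors `w`. -/
structure GoodW : Prop where
  finrank : ∀ j, Module.finrank ℂ (X.𝓛 w j) = 2
  pair : ∀ i j, i ≠ j → Disjoint (X.𝓛 w i) (X.𝓛 w j)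
  triple : ∀ i j k, i ≠ j → i ≠ k → j ≠ k → Nonempty (X.Frame w {i, j, k} i j k)
  quad : ∀ i j k l, i ≠ j → i ≠ k → j ≠ k → l ≠ i → l ≠ j → l ≠ k →
    ∃ F : X.Frame w {i, j, k, l} i j k, F.n1 ≠ F.n2
  center : ∀ N : Submodule ℂ Vec4, Module.finrank ℂ N = 2 → ∀ n, X.c n ∈ N →
    ∀ s : Finset (Fin m), s.card = 3 → n ∉ s → ¬ ∀ j ∈ s, X.Meets w N j
  quint : ∀ N : Submodule ℂ Vec4, Module.finrank ℂ N = 2 →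
    ∀ s : Finset (Fin m), s.card = 5 → ¬ ∀ j ∈ s, X.Meets w N j

variable {X w}

lemma I_le_ker {B : Type*} [CommRing B] [Algebra ℂ B] (F : LineRing m →ₐ[ℂ] B) (u v : Vec4 → B)
    (h : ∀ j, ∃ s t, ∀ φ, F (X.L j φ) = s * u φ + t * v φ) : X.I ≤ RingHom.ker F := by
  choose s t h using h
  refine X.I_le_of_minor fun i j k _ _ _ φ ψ χ => ?_
  rw [RingHom.mem_ker, minor]
  simp only [map_add, map_sub, map_mul, h]
  ring

namespace Frame

variable {B : Finset (Fin m)} {i j k l : Fin m} (F : X.Frame w B i j k)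

/-- The coordinates determined by a frame. -/
def coord : X.Coord w B where
  α x := if x = i then F.e.coord 0 else if x = j then F.e.coord 2 else
    if x = k then F.e.coord 0 + F.e.coord 2 else F.e.coord 0 + F.n1 • F.e.coord 2
  β x := if x = i then F.e.coord 1 else if x = j then F.e.coord 3 else
    if x = k then F.e.coord 1 + F.e.coord 3 else F.e.coord 1 + F.n2 • F.e.coord 3
  p x := if x = j then F.e 2 else F.e 0
  q x := if x = j then F.e 3 else F.e 1
  αp x _ := by
    have := F.hij
    split_ifs <;> simp_all
  αq x _ := by
    have := F.hij
    split_ifs <;> simp_all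
  βp x _ := by
    have := F.hij
    split_ifs <;> simp_all
  βq x _ := by
    have := F.hij
    split_ifs <;> simp_all
  mem_𝓛 x hx φ := by
    split_ifs with h1 h2 h3
    · subst h1; exact F.hi φ
    · subst h2; exact F.hj φ
    · subst h3; exact F.hk φ
    · exact F.other x hx h1 h2 h3 φ

lemma a_i : F.coord.a i = X.L i (F.e 0) := by simp [Coord.a, coord, F.hij]
lemma b_i : F.coord.b i = X.L i (F.e 1) := by simp [Coord.b, coord, F.hij]
lemma a_j : F.coord.a j = X.L j (F.e 2) := by simp [Coord.a, coord]
lemma b_j : F.coord.b j = X.L j (F.e 3) := by simp [Coord.b, coord]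
lemma a_k : F.coord.a k = X.L k (F.e 0) := by simp [Coord.a, coord, F.hjk.symm]
lemma b_k : F.coord.b k = X.L k (F.e 1) := by simp [Coord.b, coord, F.hjk.symm]
lemma a_l (h : l ≠ j) : F.coord.a l = X.L l (F.e 0) := by simp [Coord.a, coord, h]
lemma b_l (h : l ≠ j) : F.coord.b l = X.L l (F.e 1) := by simp [Coord.b, coord, h]

section relations

variable {J : Ideal (LineRing m)}

lemma mk_i (hP : ∀ x, ∀ φ ∈ X.𝓛 w x, X.L x φ ∈ J) :
    Ideal.Quotient.mk J (X.L i (F.e 0)) = Ideal.Quotient.mk J (F.coord.a i) ∧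
    Ideal.Quotient.mk J (X.L i (F.e 1)) = Ideal.Quotient.mk J (F.coord.b i) ∧
    Ideal.Quotient.mk J (X.L i (F.e 2)) = 0 ∧ Ideal.Quotient.mk J (X.L i (F.e 3)) = 0 := by
  rw [F.a_i, F.b_i]
  refine ⟨rfl, rfl, ?_, ?_⟩ <;>
    exact Ideal.Quotient.eq_zero_iff_mem.mpr (hP _ _ ((F.hi _).mpr (by simp)))

lemma mk_j (hP : ∀ x, ∀ φ ∈ X.𝓛 w x, X.L x φ ∈ J) :
    Ideal.Quotient.mk J (X.L j (F.e 0)) = 0 ∧ Ideal.Quotient.mk J (X.L j (F.e 1)) = 0 ∧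
    Ideal.Quotient.mk J (X.L j (F.e 2)) = Ideal.Quotient.mk J (F.coord.a j) ∧
    Ideal.Quotient.mk J (X.L j (F.e 3)) = Ideal.Quotient.mk J (F.coord.b j) := by
  rw [F.a_j, F.b_j]
  refine ⟨?_, ?_, rfl, rfl⟩ <;>
    exact Ideal.Quotient.eq_zero_iff_mem.mpr (hP _ _ ((F.hj _).mpr (by simp)))

lemma mk_k (hP : ∀ x, ∀ φ ∈ X.𝓛 w x, X.L x φ ∈ J) :
    Ideal.Quotient.mk J (X.L k (F.e 0)) = Ideal.Quotient.mk J (F.coord.a k) ∧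
    Ideal.Quotient.mk J (X.L k (F.e 1)) = Ideal.Quotient.mk J (F.coord.b k) ∧
    Ideal.Quotient.mk J (X.L k (F.e 2)) = Ideal.Quotient.mk J (F.coord.a k) ∧
    Ideal.Quotient.mk J (X.L k (F.e 3)) = Ideal.Quotient.mk J (F.coord.b k) := by
  rw [F.a_k, F.b_k]
  refine ⟨rfl, rfl, ?_, ?_⟩ <;> rw [Ideal.Quotient.eq, ← map_sub] <;>
    exact hP _ _ ((F.hk _).mpr (by simp))

lemma mk_l (hP : ∀ x, ∀ φ ∈ X.𝓛 w x, X.L x φ ∈ J) (hl : l ∈ B) (hli : l ≠ i) (hlj : l ≠ j)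
    (hlk : l ≠ k) :
    Ideal.Quotient.mk J (X.L l (F.e 0)) = Ideal.Quotient.mk J (F.coord.a l) ∧
    Ideal.Quotient.mk J (X.L l (F.e 1)) = Ideal.Quotient.mk J (F.coord.b l) ∧
    Ideal.Quotient.mk J (X.L l (F.e 2)) =
      Ideal.Quotient.mk J (C F.n1) * Ideal.Quotient.mk J (F.coord.a l) ∧
    Ideal.Quotient.mk J (X.L l (F.e 3)) =
      Ideal.Quotient.mk J (C F.n2) * Ideal.Quotient.mk J (F.coord.b l) := by
  rw [F.a_l hlj, F.b_l hlj]
  refine ⟨rfl, rfl, ?_, ?_⟩ <;>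
    rw [← map_mul, Ideal.Quotient.eq, ← smul_eq_C_mul, ← map_smul, ← map_sub] <;>
    exact hP _ _ ((F.other l hl hli hlj hlk _).mpr (by simp))

lemma mk_minor (hI : X.I ≤ J) (x y z : Fin m) (φ ψ χ : Vec4) :
    Ideal.Quotient.mk J (X.minor x y z φ ψ χ) = 0 :=
  Ideal.Quotient.eq_zero_iff_mem.mpr (hI (X.minor_mem x y z φ ψ χ))

lemma _root_.CameraData.Coord.mk_L (e : X.Coord w B) (hP : ∀ x, ∀ φ ∈ X.𝓛 w x, X.L x φ ∈ J)
    {x : Fin m} (hx : x ∈ B) (φ : Vec4) :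
    Ideal.Quotient.mk J (X.L x φ) =
      Ideal.Quotient.mk J (C (e.α x φ)) * Ideal.Quotient.mk J (e.a x) +
      Ideal.Quotient.mk J (C (e.β x φ)) * Ideal.Quotient.mk J (e.b x) := by
  rw [← map_mul, ← map_mul, ← map_add, Ideal.Quotient.eq, ← smul_eq_C_mul, ← smul_eq_C_mul,
    Coord.a, Coord.b, ← map_smul, ← map_smul, ← map_add, ← map_sub, ← sub_sub]
  exact hP _ _ (e.decomp hx φ)

/-- The minors of three columns, modulo the linear forms vanishing on the planes. -/
lemma rel3 (hI : X.I ≤ J) (hP : ∀ x, ∀ φ ∈ X.𝓛 w x, X.L x φ ∈ J) (hi : i ∈ B) (hj : j ∈ B)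
    (hk : k ∈ B) (φ : Vec4) : X.L k φ * F.coord.br i j ∈ J ∧ X.L j φ * F.coord.br i k ∈ J ∧
      X.L i φ * F.coord.br j k ∈ J := by
  simp only [← Ideal.Quotient.eq_zero_iff_mem, Coord.br, map_mul, map_sub,
    F.coord.mk_L hP hi φ, F.coord.mk_L hP hj φ, F.coord.mk_L hP hk φ]
  obtain ⟨i0, i1, i2, i3⟩ := F.mk_i hP
  obtain ⟨j0, j1, j2, j3⟩ := F.mk_j hP
  obtain ⟨k0, k1, k2, k3⟩ := F.mk_k hP
  have h1 := mk_minor hI i j k (F.e 0) (F.e 1) (F.e 2)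
  have h2 := mk_minor hI i j k (F.e 0) (F.e 1) (F.e 3)
  have h3 := mk_minor hI i j k (F.e 0) (F.e 2) (F.e 3)
  have h4 := mk_minor hI i j k (F.e 1) (F.e 2) (F.e 3)
  simp only [minor, map_add, map_sub, map_mul, i0, i1, i2, i3, j0, j1, j2, j3, k0, k1, k2, k3]
    at h1 h2 h3 h4
  generalize Ideal.Quotient.mk J (F.coord.a i) = a1 at *
  generalize Ideal.Quotient.mk J (F.coord.b i) = b1 at *
  generalize Ideal.Quotient.mk J (F.coord.a j) = a2 at *
  generalize Ideal.Quotient.mk J (F.coord.b j) = b2 at *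
  generalize Ideal.Quotient.mk J (F.coord.a k) = a3 at *
  generalize Ideal.Quotient.mk J (F.coord.b k) = b3 at *
  have g1 : a2 * (a1 * b3 - b1 * a3) = 0 := by linear_combination -h1
  have g2 : b2 * (a1 * b3 - b1 * a3) = 0 := by linear_combination -h2
  have g3 : a1 * (a2 * b3 - b2 * a3) = 0 := by linear_combination h3
  have g4 : b1 * (a2 * b3 - b2 * a3) = 0 := by linear_combination h4
  generalize Ideal.Quotient.mk J (C (F.coord.α i φ)) = s1
  generalize Ideal.Quotient.mk J (C (F.coord.β i φ)) = t1
  generalize Ideal.Quotient.mk J (C (F.coord.α j φ)) = s2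
  generalize Ideal.Quotient.mk J (C (F.coord.β j φ)) = t2
  generalize Ideal.Quotient.mk J (C (F.coord.α k φ)) = s3
  generalize Ideal.Quotient.mk J (C (F.coord.β k φ)) = t3
  refine ⟨?_, ?_, ?_⟩
  · linear_combination s3 * g1 - s3 * g3 + t3 * g2 - t3 * g4
  · linear_combination s2 * g1 + t2 * g2
  · linear_combination s1 * g3 + t1 * g4

/-- The mixed monomials of degree four vanish. -/
lemma rel4 (hI : X.I ≤ J) (hP : ∀ x, ∀ φ ∈ X.𝓛 w x, X.L x φ ∈ J) (hl : l ∈ B) (hli : l ≠ i) (hlj : l ≠ j) (hlk : l ≠ k) (hn : F.n1 ≠ F.n2) :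
    (∀ φ, X.L l φ * (F.coord.a i * F.coord.a j * F.coord.b k) ∈ J ∧
      X.L l φ * (F.coord.a i * F.coord.b j * F.coord.a k) ∈ J ∧
      X.L l φ * (F.coord.b i * F.coord.a j * F.coord.a k) ∈ J ∧
      X.L l φ * (F.coord.a i * F.coord.b j * F.coord.b k) ∈ J ∧
      X.L l φ * (F.coord.b i * F.coord.a j * F.coord.b k) ∈ J ∧
      X.L l φ * (F.coord.b i * F.coord.b j * F.coord.a k) ∈ J) ∧
    F.coord.a l * (F.coord.b i * F.coord.b j * F.coord.b k) ∈ J ∧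
    F.coord.b l * (F.coord.a i * F.coord.a j * F.coord.a k) ∈ J := by
  obtain ⟨i0, i1, i2, i3⟩ := F.mk_i hP
  obtain ⟨j0, j1, j2, j3⟩ := F.mk_j hP
  obtain ⟨k0, k1, k2, k3⟩ := F.mk_k hP
  obtain ⟨l0, l1, l2, l3⟩ := F.mk_l hP hl hli hlj hlk
  have h1 := mk_minor hI i j k (F.e 0) (F.e 1) (F.e 2)
  have h2 := mk_minor hI i j k (F.e 0) (F.e 1) (F.e 3)
  have h3 := mk_minor hI i j k (F.e 0) (F.e 2) (F.e 3)
  have h4 := mk_minor hI i j k (F.e 1) (F.e 2) (F.e 3)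
  have h5 := mk_minor hI i j l (F.e 0) (F.e 1) (F.e 2)
  have h6 := mk_minor hI i j l (F.e 0) (F.e 1) (F.e 3)
  have h7 := mk_minor hI i j l (F.e 0) (F.e 2) (F.e 3)
  have h8 := mk_minor hI i j l (F.e 1) (F.e 2) (F.e 3)
  simp only [minor, map_add, map_sub, map_mul, i0, i1, i2, i3, j0, j1, j2, j3, k0, k1, k2, k3,
    l0, l1, l2, l3] at h1 h2 h3 h4 h5 h6 h7 h8
  have hu : ∃ c, Ideal.Quotient.mk J (C c) * (Ideal.Quotient.mk J (C F.n2) -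
      Ideal.Quotient.mk J (C F.n1)) = 1 := by
    refine ⟨(F.n2 - F.n1)⁻¹, ?_⟩
    rw [← map_sub, ← map_sub, ← map_mul, ← map_mul, inv_mul_cancel₀ (sub_ne_zero.mpr hn.symm),
      C_1, map_one]
  obtain ⟨c, hc⟩ := hu
  simp only [← Ideal.Quotient.eq_zero_iff_mem, map_mul, F.coord.mk_L hP hl]
  generalize Ideal.Quotient.mk J (C c) = c at *
  generalize Ideal.Quotient.mk J (C F.n1) = n1 at *
  generalize Ideal.Quotient.mk J (C F.n2) = n2 at *
  generalize Ideal.Quotient.mk J (F.coord.a i) = a1 at *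
  generalize Ideal.Quotient.mk J (F.coord.b i) = b1 at *
  generalize Ideal.Quotient.mk J (F.coord.a j) = a2 at *
  generalize Ideal.Quotient.mk J (F.coord.b j) = b2 at *
  generalize Ideal.Quotient.mk J (F.coord.a k) = a3 at *
  generalize Ideal.Quotient.mk J (F.coord.b k) = b3 at *
  generalize Ideal.Quotient.mk J (F.coord.a l) = a4 at *
  generalize Ideal.Quotient.mk J (F.coord.b l) = b4 at *
  have g1 : a2 * (a1 * b3 - b1 * a3) = 0 := by linear_combination -h1
  have g2 : b2 * (a1 * b3 - b1 * a3) = 0 := by linear_combination -h2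
  have g3 : a1 * (a2 * b3 - b2 * a3) = 0 := by linear_combination h3
  have g4 : b1 * (a2 * b3 - b2 * a3) = 0 := by linear_combination h4
  have g5 : a2 * (a1 * b4 - b1 * a4) = 0 := by linear_combination -h5
  have g6 : b2 * (a1 * b4 - b1 * a4) = 0 := by linear_combination -h6
  have g7 : a1 * (n2 * a2 * b4 - n1 * b2 * a4) = 0 := by linear_combination h7
  have g8 : b1 * (n2 * a2 * b4 - n1 * b2 * a4) = 0 := by linear_combination h8
  clear h1 h2 h3 h4 h5 h6 h7 h8
  have t1 : a1 * a2 * a3 * b4 = 0 := by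
    linear_combination c * (a3 * g7 + n1 * (a4 * g1 - a4 * g3 - a3 * g5)) - a1 * a2 * a3 * b4 * hc
  have t2 : a1 * a2 * b3 * b4 = 0 := by
    linear_combination c * (b3 * g7 + n1 * (a4 * g2 - a3 * g6 - b4 * g3)) - a1 * a2 * b3 * b4 * hc
  have t3 : b1 * a2 * b3 * b4 = 0 := by
    linear_combination c * (b3 * g8 + n1 * (b4 * g2 - b3 * g6 - b4 * g4)) - b1 * a2 * b3 * b4 * hc
  refine ⟨fun φ => ?_, ?_, ?_⟩
  · generalize Ideal.Quotient.mk J (C (F.coord.α l φ)) = s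
    generalize Ideal.Quotient.mk J (C (F.coord.β l φ)) = t
    refine ⟨?_, ?_, ?_, ?_, ?_, ?_⟩
    · linear_combination t * t2 + s * (t1 - a3 * g5 + a4 * g1)
    · linear_combination t * (t2 - b4 * g3) + s * (t1 - a3 * g5 + a4 * g1 - a4 * g3)
    · linear_combination t * (t2 - b4 * g1) + s * (t1 - a3 * g5)
    · linear_combination t * (t3 - b4 * g4 + b4 * g2) + s * (t2 - b4 * g3 + a4 * g2 - a3 * g6)
    · linear_combination t * t3 + s * (t2 - b3 * g5)
    · linear_combination t * (t3 - b4 * g4) + s * (t2 - b4 * g3 - a3 * g6)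
  · linear_combination t3 - b4 * g4 + b4 * g2 - b3 * g6
  · linear_combination t1

lemma finrank_span_e {r s : Fin 4} (h : r ≠ s) :
    Module.finrank ℂ (Submodule.span ℂ {F.e r, F.e s}) = 2 := by
  have h1 : LinearIndependent ℂ ![F.e r, F.e s] := by
    have := F.e.linearIndependent.comp ![r, s] (by
      intro x y hxy
      fin_cases x <;> fin_cases y <;> simp_all)
    convert this using 1
    ext x
    fin_cases x <;> rfl
  have := finrank_span_eq_card h1
  rwa [Matrix.range_cons_cons_empty, Fintype.card_fin] at this

/-- The two transversals of the planes of a frame. -/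
lemma meets (hl : l ∈ B) :
    X.Meets w (Submodule.span ℂ {F.e 0, F.e 2}) l ∧
    X.Meets w (Submodule.span ℂ {F.e 1, F.e 3}) l := by
  have hr : ∀ r, F.e r ≠ 0 := F.e.ne_zero
  have h0 : ∀ {r s : Fin 4}, r ≠ s → ∀ x : ℂ, F.e r - x • F.e s ≠ 0 := by
    intro r s hrs x h
    have := congrArg (F.e.coord r) h
    simp [hrs] at this
  have hm : ∀ (r s : Fin 4) (x : ℂ), F.e s - x • F.e r ∈ Submodule.span ℂ {F.e r, F.e s} :=
    fun r s x => sub_mem (Submodule.subset_span (by simp))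
      (Submodule.smul_mem _ _ (Submodule.subset_span (by simp)))
  by_cases hli : l = i
  · subst hli
    exact ⟨⟨F.e 2, Submodule.subset_span (by simp), (F.hi _).mpr (by simp), hr 2⟩,
      ⟨F.e 3, Submodule.subset_span (by simp), (F.hi _).mpr (by simp), hr 3⟩⟩
  by_cases hlj : l = j
  · subst hlj
    exact ⟨⟨F.e 0, Submodule.subset_span (by simp), (F.hj _).mpr (by simp), hr 0⟩,
      ⟨F.e 1, Submodule.subset_span (by simp), (F.hj _).mpr (by simp), hr 1⟩⟩
  by_cases hlk : l = k
  · subst hlk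
    exact ⟨⟨F.e 2 - (1 : ℂ) • F.e 0, hm _ _ _, (F.hk _).mpr (by simp), h0 (by decide) _⟩,
      ⟨F.e 3 - (1 : ℂ) • F.e 1, hm _ _ _, (F.hk _).mpr (by simp), h0 (by decide) _⟩⟩
  · exact ⟨⟨F.e 2 - F.n1 • F.e 0, hm _ _ _, (F.other l hl hli hlj hlk _).mpr (by simp),
        h0 (by decide) _⟩,
      ⟨F.e 3 - F.n2 • F.e 1, hm _ _ _, (F.other l hl hli hlj hlk _).mpr (by simp),
        h0 (by decide) _⟩⟩

lemma exists_decomp (hw : X.GoodW w) {n : Fin m} {r s : Fin 4} (hrs : r ≠ s)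
    (h : ¬ X.Meets w (Submodule.span ℂ {F.e r, F.e s}) n) (φ : Vec4) :
    ∃ x y : ℂ, φ - (x • F.e r + y • F.e s) ∈ X.𝓛 w n := by
  have h1 : Disjoint (Submodule.span ℂ {F.e r, F.e s}) (X.𝓛 w n) := by
    rw [Submodule.disjoint_def]
    intro x hx hx'
    by_contra hne
    exact h ⟨x, hx, hx', hne⟩
  have h2 : (Submodule.span ℂ {F.e r, F.e s}) ⊔ (X.𝓛 w n) = ⊤ := by
    apply Submodule.eq_top_of_disjoint _ _ _ h1
    rw [F.finrank_span_e hrs, hw.finrank]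
    simp
  obtain ⟨a, ha, b, hb, hab⟩ := Submodule.mem_sup.mp (h2 ▸ Submodule.mem_top (x := φ))
  obtain ⟨x, y, hxy⟩ := Submodule.mem_span_pair.mp ha
  refine ⟨x, y, ?_⟩
  rw [hxy, ← hab]
  simpa using hb

/-- Products of linear forms from five columns vanish. -/
lemma rel5 (hw : X.GoodW w) (hI : X.I ≤ J) (hP : ∀ x, ∀ φ ∈ X.𝓛 w x, X.L x φ ∈ J)
    (F : X.Frame w {i, j, k, l} i j k) (hli : l ≠ i) (hlj : l ≠ j) (hlk : l ≠ k)
    (hn : F.n1 ≠ F.n2) {n : Fin m} (hni : n ≠ i) (hnj : n ≠ j) (hnk : n ≠ k) (hnl : n ≠ l)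
    (φ₁ φ₂ φ₃ φ₄ φ₅ : Vec4) :
    X.L i φ₁ * X.L j φ₂ * X.L k φ₃ * X.L l φ₄ * X.L n φ₅ ∈ J := by
  have hcard : ({n, i, j, k, l} : Finset (Fin m)).card = 5 := by
    rw [Finset.card_insert_of_notMem, Finset.card_insert_of_notMem, Finset.card_insert_of_notMem,
      Finset.card_insert_of_notMem] <;>
      simp [hni, hnj, hnk, hnl, F.hij, F.hik, F.hjk, hli.symm, hlj.symm, hlk.symm]
  have hq : ∀ N : Submodule ℂ Vec4, Module.finrank ℂ N = 2 →
      (∀ x ∈ ({i, j, k, l} : Finset (Fin m)), X.Meets w N x) → ¬ X.Meets w N n := by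
    intro N hN h1 h2
    refine hw.quint N hN _ hcard fun x hx => ?_
    rcases Finset.mem_insert.mp hx with rfl | hx
    · exact h2
    · exact h1 x hx
  obtain ⟨x, y, hxy⟩ := F.exists_decomp hw (by decide) (hq _ (F.finrank_span_e (by decide))
    fun x hx => (F.meets hx).1) φ₅
  obtain ⟨x', y', hxy'⟩ := F.exists_decomp hw (by decide) (hq _ (F.finrank_span_e (by decide))
    fun x hx => (F.meets hx).2) φ₅
  have H : ∀ {r s : Fin 4} {x y : ℂ}, φ₅ - (x • F.e r + y • F.e s) ∈ X.𝓛 w n →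
      Ideal.Quotient.mk J (X.L n φ₅) =
        Ideal.Quotient.mk J (C x) * Ideal.Quotient.mk J (X.L n (F.e r)) +
        Ideal.Quotient.mk J (C y) * Ideal.Quotient.mk J (X.L n (F.e s)) := by
    intro r s x y h
    rw [← map_mul, ← map_mul, ← map_add, Ideal.Quotient.eq, ← smul_eq_C_mul, ← smul_eq_C_mul,
      ← (X.L n).map_smul, ← (X.L n).map_smul, ← (X.L n).map_add, ← (X.L n).map_sub]
    exact hP _ _ h
  have H1 := H hxy
  have H2 := H hxy'
  obtain ⟨i0, i1, i2, i3⟩ := F.mk_i hP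
  obtain ⟨j0, j1, j2, j3⟩ := F.mk_j hP
  have h5 := mk_minor hI i j n (F.e 0) (F.e 1) (F.e 2)
  have h6 := mk_minor hI i j n (F.e 0) (F.e 1) (F.e 3)
  have h7 := mk_minor hI i j n (F.e 0) (F.e 2) (F.e 3)
  have h8 := mk_minor hI i j n (F.e 1) (F.e 2) (F.e 3)
  simp only [minor, map_add, map_sub, map_mul, i0, i1, i2, i3, j0, j1, j2, j3] at h5 h6 h7 h8
  obtain ⟨hm, hm1, hm2⟩ := F.rel4 hI hP (by simp) hli hlj hlk hn
  obtain ⟨p1, p2, p3, p4, p5, p6⟩ := hm φ₄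
  obtain ⟨q1, q2, q3, q4, q5, q6⟩ := hm (F.e 0)
  rw [← F.a_l hlj] at q1 q2 q3 q4 q5 q6
  obtain ⟨r1, r2, r3, r4, r5, r6⟩ := hm (F.e 1)
  rw [← F.b_l hlj] at r1 r2 r3 r4 r5 r6
  simp only [← Ideal.Quotient.eq_zero_iff_mem, map_mul]
    at p1 p2 p3 p4 p5 p6 q1 q2 q3 q4 q5 q6 r1 r2 r3 r4 r5 r6 hm1 hm2 ⊢
  rw [F.coord.mk_L hP (by simp) φ₄] at p1 p2 p3 p4 p5 p6 ⊢
  rw [F.coord.mk_L hP (by simp) φ₁, F.coord.mk_L hP (by simp) φ₂, F.coord.mk_L hP (by simp) φ₃]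
  generalize Ideal.Quotient.mk J (X.L n φ₅) = z at *
  generalize Ideal.Quotient.mk J (X.L n (F.e 0)) = y0 at *
  generalize Ideal.Quotient.mk J (X.L n (F.e 1)) = y1 at *
  generalize Ideal.Quotient.mk J (X.L n (F.e 2)) = y2 at *
  generalize Ideal.Quotient.mk J (X.L n (F.e 3)) = y3 at *
  generalize Ideal.Quotient.mk J (F.coord.a i) = a1 at *
  generalize Ideal.Quotient.mk J (F.coord.b i) = b1 at *
  generalize Ideal.Quotient.mk J (F.coord.a j) = a2 at *
  generalize Ideal.Quotient.mk J (F.coord.b j) = b2 at *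
  generalize Ideal.Quotient.mk J (F.coord.a k) = a3 at *
  generalize Ideal.Quotient.mk J (F.coord.b k) = b3 at *
  generalize Ideal.Quotient.mk J (F.coord.a l) = a4 at *
  generalize Ideal.Quotient.mk J (F.coord.b l) = b4 at *
  have T0 : a1 * a2 * a3 * a4 * z = 0 := by
    have e1 : a1 * a2 * a3 * a4 * y1 = 0 := by linear_combination -a3 * a4 * h5 + q3 * y0
    have e3 : a1 * a2 * a3 * a4 * y3 = 0 := by linear_combination a3 * a4 * h7 + q2 * y2
    rw [H2]
    linear_combination Ideal.Quotient.mk J (C x') * e1 + Ideal.Quotient.mk J (C y') * e3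
  have T4 : b1 * b2 * b3 * b4 * z = 0 := by
    have e0 : b1 * b2 * b3 * b4 * y0 = 0 := by linear_combination b3 * b4 * h6 + r4 * y1
    have e2 : b1 * b2 * b3 * b4 * y2 = 0 := by linear_combination -b3 * b4 * h8 + r5 * y3
    rw [H1]
    linear_combination Ideal.Quotient.mk J (C x) * e0 + Ideal.Quotient.mk J (C y) * e2
  generalize Ideal.Quotient.mk J (C (F.coord.α i φ₁)) = s1
  generalize Ideal.Quotient.mk J (C (F.coord.β i φ₁)) = t1
  generalize Ideal.Quotient.mk J (C (F.coord.α j φ₂)) = s2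
  generalize Ideal.Quotient.mk J (C (F.coord.β j φ₂)) = t2
  generalize Ideal.Quotient.mk J (C (F.coord.α k φ₃)) = s3
  generalize Ideal.Quotient.mk J (C (F.coord.β k φ₃)) = t3
  generalize Ideal.Quotient.mk J (C (F.coord.α l φ₄)) = s4 at *
  generalize Ideal.Quotient.mk J (C (F.coord.β l φ₄)) = t4 at *
  linear_combination s1 * s2 * s3 * s4 * T0 + t1 * t2 * t3 * t4 * T4 +
    z * (s1 * s2 * t3 * p1 + s1 * t2 * s3 * p2 + t1 * s2 * s3 * p3 + s1 * t2 * t3 * p4 +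
      t1 * s2 * t3 * p5 + t1 * t2 * s3 * p6) + s1 * s2 * s3 * t4 * z * hm2 +
      t1 * t2 * t3 * s4 * z * hm1

end relations

end Frame

end CameraData

namespace CameraData

variable {m : ℕ} (X : CameraData m) (w : Fin m → Vec4)

/-- The ideal of all relations, when only the columns in `A` are nonzero and lie in the
planes annihilating `𝓛`. -/
def IA (A : Finset (Fin m)) : Ideal (LineRing m) := X.I ⊔ X.P (onCols A (X.𝓛 w))

/-- The ideal of column `r`. -/
def N (r : Fin m) : Ideal (LineRing m) := Ideal.span {x | ∃ φ, X.L r φ = x}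

lemma exists_kill (r : Fin m) : ∃ F : LineRing m →ₐ[ℂ] LineRing m,
    ∀ j φ, F (X.L j φ) = (if j = r then 0 else 1) * X.L j φ := by
  obtain ⟨F, hF⟩ := X.exists_lift (fun j => if j = r then 0 else X.L j) (fun j => by
    split_ifs
    · rfl
    · exact X.L_c j)
  refine ⟨F, fun j φ => ?_⟩
  rw [hF]
  split_ifs <;> simp

/-- The substitution of zero for column `r`. -/
def kill (r : Fin m) : LineRing m →ₐ[ℂ] LineRing m := (X.exists_kill r).choose

lemma kill_L (r j : Fin m) (φ : Vec4) :
    X.kill r (X.L j φ) = (if j = r then 0 else 1) * X.L j φ := (X.exists_kill r).choose_spec j φ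

variable {X w}

lemma L_mem_N (r : Fin m) (φ : Vec4) : X.L r φ ∈ X.N r := Ideal.subset_span ⟨φ, rfl⟩

lemma N_le {r : Fin m} {J : Ideal (LineRing m)} : X.N r ≤ J ↔ ∀ φ, X.L r φ ∈ J := by
  refine Ideal.span_le.trans ⟨fun h φ => h ⟨φ, rfl⟩, ?_⟩
  rintro h _ ⟨φ, rfl⟩
  exact h φ

lemma sub_kill_mem_N (r : Fin m) (f : LineRing m) : f - X.kill r f ∈ X.N r := by
  have h : Ideal.Quotient.mkₐ ℂ (X.N r) = (Ideal.Quotient.mkₐ ℂ (X.N r)).comp (X.kill r) := by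
    refine X.hom_ext fun j φ => ?_
    rw [AlgHom.comp_apply, kill_L]
    split_ifs with hj
    · subst hj
      rw [zero_mul, map_zero]
      exact Ideal.Quotient.eq_zero_iff_mem.mpr (L_mem_N j φ)
    · rw [one_mul]
  exact Ideal.Quotient.eq.mp (AlgHom.congr_fun h f)

lemma kill_mem_I {r : Fin m} {f : LineRing m} (hf : f ∈ X.I) : X.kill r f ∈ X.I := by
  suffices h : X.I ≤ X.I.comap (X.kill r) from h hf
  refine X.I_le_of_minor fun i j k _ _ _ φ ψ χ => ?_
  rw [Ideal.mem_comap]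
  have : X.kill r (X.minor i j k φ ψ χ) = (if i = r then 0 else 1) * (if j = r then 0 else 1) *
      (if k = r then 0 else 1) * X.minor i j k φ ψ χ := by
    simp only [minor, map_add, map_sub, map_mul, kill_L]
    ring
  rw [this]
  exact Ideal.mul_mem_left _ _ (X.minor_mem i j k φ ψ χ)

variable {A A' B : Finset (Fin m)}

lemma I_le_IA : X.I ≤ X.IA w A := le_sup_left

lemma P_le_IA : X.P (onCols A (X.𝓛 w)) ≤ X.IA w A := le_sup_right

lemma L_mem_IA {x : Fin m} {φ : Vec4} (hφ : φ ∈ X.𝓛 w x) : X.L x φ ∈ X.IA w A :=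
  P_le_IA (L_mem_P (mem_onCols.mpr fun _ => hφ))

lemma L_mem_IA_of_notMem {x : Fin m} (hx : x ∉ A) (φ : Vec4) : X.L x φ ∈ X.IA w A :=
  P_le_IA (L_mem_P (mem_onCols.mpr fun h => absurd h hx))

lemma IA_mono (h : A' ⊆ A) : X.IA w A ≤ X.IA w A' :=
  sup_le_sup_left (P_mono fun _ _ hφ => mem_onCols.mpr fun hj => mem_onCols.mp hφ (h hj)) _

lemma kill_mem_IA {r : Fin m} (h : ∀ j ∈ A, j ≠ r → j ∈ A') {f : LineRing m}
    (hf : f ∈ X.IA w A') : X.kill r f ∈ X.IA w A := by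
  suffices h : X.IA w A' ≤ (X.IA w A).comap (X.kill r) from h hf
  refine sup_le (fun f hf => I_le_IA (kill_mem_I hf)) (P_le_iff.mpr fun j φ hφ => ?_)
  rw [Ideal.mem_comap, kill_L]
  split_ifs with hj
  · rw [zero_mul]
    exact zero_mem _
  · rw [one_mul]
    exact P_le_IA (L_mem_P (mem_onCols.mpr fun hA => mem_onCols.mp hφ (h j hA hj)))

lemma N_le_IA {r : Fin m} (hr : r ∉ A) : X.N r ≤ X.IA w A :=
  N_le.mpr fun φ => L_mem_IA_of_notMem hr φ

variable (X w) in
/-- The intersection of the ideals obtained from `A` by deleting one column of `B`. -/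
def K (A B : Finset (Fin m)) : Ideal (LineRing m) := ⨅ i ∈ B, X.IA w (A.erase i)

lemma mem_K {f : LineRing m} : f ∈ X.K w A B ↔ ∀ i ∈ B, f ∈ X.IA w (A.erase i) := by
  simp [K, Submodule.mem_iInf]

lemma IA_le_K : X.IA w A ≤ X.K w A B := fun _ hf =>
  mem_K.mpr fun i _ => IA_mono (A.erase_subset i) hf

lemma K_sup_IA (r : Fin m) :
    X.K w A B ⊔ X.IA w (A.erase r) = X.K w (A.erase r) B := by
  refine le_antisymm (sup_le (fun f hf => ?_) IA_le_K) fun f hf => ?_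
  · refine mem_K.mpr fun i hi => IA_mono ?_ (mem_K.mp hf i hi)
    exact Finset.erase_subset_erase i (A.erase_subset r)
  · rw [← sub_add_cancel f (X.kill r f)]
    refine add_mem (Ideal.mem_sup_right (N_le_IA (A.notMem_erase r) (sub_kill_mem_N r f)))
      (Ideal.mem_sup_left (mem_K.mpr fun i hi => kill_mem_IA (fun j hj hjr => ?_)
        (mem_K.mp hf i hi)))
    rw [Finset.mem_erase] at hj ⊢
    exact ⟨hj.1, Finset.mem_erase.mpr ⟨hjr, hj.2⟩⟩

lemma K_insert (r : Fin m) : X.K w A (insert r B) = X.K w A B ⊓ X.IA w (A.erase r) := by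
  ext f
  rw [Submodule.mem_inf, mem_K, mem_K, Finset.forall_mem_insert, and_comm]

/-- The depth of `R ⧸ J` is at least `n` and `J` contains `V`. -/
def Good (V : Ideal (LineRing m)) (n : ℕ) (J : Ideal (LineRing m)) : Prop :=
  DepthGE (𝔪 m) (LineRing m ⧸ J) n ∧ V ≤ J

namespace Good

variable {V J P : Ideal (LineRing m)} {n k : ℕ}

lemma mono (h : Good V n J) (hk : k ≤ n) : Good V k J := ⟨h.1.mono hk, h.2⟩

lemma of_colon_prime [hP : P.IsPrime] {x : LineRing m} (hJP : J ≤ P) (hx : x ∉ P)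
    (hxP : ∀ p ∈ P, p * x ∈ J) (h1 : Good V n P) (h2 : Good V n (J ⊔ Ideal.span {x})) :
    Good V n J := by
  refine ⟨DepthGE.of_colon_prime hJP hx hxP h1.1 h2.1, fun f hf => ?_⟩
  obtain ⟨j, hj, y, hy, rfl⟩ := Submodule.mem_sup.mp (h2.2 hf)
  obtain ⟨g, rfl⟩ := Ideal.mem_span_singleton'.mp hy
  refine add_mem hj (hxP g ((hP.mem_or_mem ?_).resolve_right hx))
  simpa using P.sub_mem (h1.2 hf) (hJP hj)

lemma inf {J₁ J₂ : Ideal (LineRing m)} (h1 : Good V (n + 1) J₁) (h2 : Good V (n + 1) J₂)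
    (h3 : Good V n (J₁ ⊔ J₂)) : Good V (n + 1) (J₁ ⊓ J₂) :=
  ⟨DepthGE.inf h1.1 h2.1 h3.1, le_inf h1.2 h2.2⟩

lemma of_same_syzygies {Q : Ideal (LineRing m)} {y y' a b : LineRing m}
    (hJQ : J ≤ Q) (hQ : ∀ f g, f * y + g * y' ∈ Q → f * y + g * y' ∈ J)
    (hsyz : ∀ f g, f * y + g * y' ∈ Q ↔ f * a + g * b ∈ Q)
    (h1 : Good V (n + 1) Q) (h2 : DepthGE (𝔪 m) (LineRing m ⧸ (Q ⊔ Ideal.span {a, b})) n)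
    (h3 : Good V (n + 1) (J ⊔ Ideal.span {y, y'})) : Good V (n + 1) J := by
  refine ⟨DepthGE.of_same_syzygies (fun f g => ⟨fun h => (hsyz f g).mp (hJQ h),
    fun h => hQ f g ((hsyz f g).mpr h)⟩) h1.1 h2 h3.1, fun f hf => ?_⟩
  obtain ⟨j, hj, z, hz, rfl⟩ := Submodule.mem_sup.mp (h3.2 hf)
  obtain ⟨g, h, rfl⟩ := Ideal.mem_span_pair.mp hz
  refine add_mem hj (hQ _ _ ?_)
  simpa using Q.sub_mem (h1.2 hf) (hJQ hj)

end Good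

lemma good_K {V : Ideal (LineRing m)} : ∀ A : Finset (Fin m),
    (∀ A' ⊂ A, Good V (min 4 (2 * A'.card)) (X.IA w A')) → B.Nonempty → B ⊆ A →
      Good V (min 4 (2 * A.card - B.card - 1)) (X.K w A B) := by
  induction B using Finset.induction_on with
  | empty => exact fun A _ h => absurd h (by simp)
  | insert r B hr ih =>
    intro A hA _ hB
    have hrA : r ∈ A := hB (Finset.mem_insert_self r B)
    have hBA : B ⊆ A := (Finset.subset_insert r B).trans hB
    have hcard := Finset.card_erase_of_mem hrA
    have hpos : 0 < A.card := Finset.card_pos.mpr ⟨r, hrA⟩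
    have h1 := hA _ (Finset.erase_ssubset hrA)
    rcases B.eq_empty_or_nonempty with rfl | hne
    · have : X.K w A (insert r ∅) = X.IA w (A.erase r) := by
        ext f
        simp [mem_K]
      rw [this]
      refine h1.mono ?_
      simp
      omega
    · have hBr : B ⊆ A.erase r := Finset.subset_erase.mpr ⟨hBA, hr⟩
      have hle := Finset.card_le_card hBr
      have hB0 := Finset.card_pos.mpr hne
      have h2 := ih A hA hne hBA
      have h3 := ih (A.erase r) (fun A' hA' => hA A' (hA'.trans (Finset.erase_ssubset hrA)))
        hne hBr
      rw [← K_sup_IA r] at h3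
      rw [K_insert, Finset.card_insert_of_notMem hr]
      obtain ⟨n, hn⟩ : ∃ n, min 4 (2 * A.card - (B.card + 1) - 1) = n + 1 :=
        ⟨min 4 (2 * A.card - (B.card + 1) - 1) - 1, by omega⟩
      rw [hn]
      exact (h2.mono (by omega)).inf (h1.mono (by omega)) (h3.mono (by omega))

end CameraData

namespace CameraData

variable {m : ℕ} {X : CameraData m} {w : Fin m → Vec4} {A B : Finset (Fin m)}

lemma sub_kill_mem_mul {r : Fin m} (hr : r ∉ B) : ∀ g ∈ ∏ i ∈ B, X.N i,
    g - X.kill r g ∈ X.N r * ∏ i ∈ B, X.N i := by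
  induction B using Finset.induction_on with
  | empty =>
    intro g _
    rw [Finset.prod_empty, mul_one]
    exact sub_kill_mem_N r g
  | insert x B hx ih =>
    have hrx : x ≠ r := fun h => hr (h ▸ Finset.mem_insert_self x B)
    have ih := ih fun h => hr (Finset.mem_insert_of_mem h)
    intro g hg
    rw [Finset.prod_insert hx] at hg ⊢
    rw [mul_left_comm]
    refine Submodule.mul_induction_on hg (fun y hy z hz => ?_) fun y z hy hz => ?_
    · revert z
      refine Submodule.span_induction (p := fun y _ => ∀ z ∈ ∏ i ∈ B, X.N i,
        y * z - X.kill r (y * z) ∈ X.N x * (X.N r * ∏ i ∈ B, X.N i)) ?_ ?_ ?_ ?_ hy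
      · rintro _ ⟨φ, rfl⟩ z hz
        rw [map_mul, kill_L, if_neg hrx, one_mul, ← mul_sub]
        exact Ideal.mul_mem_mul (L_mem_N x φ) (ih z hz)
      · intro z _
        simp
      · intro y y' _ _ hy hy' z hz
        rw [add_mul, map_add, add_sub_add_comm]
        exact add_mem (hy z hz) (hy' z hz)
      · intro c y _ hy z hz
        have h := hy (c * z) (Ideal.mul_mem_left _ _ hz)
        have h' : c • y * z = y * (c * z) := by rw [smul_eq_mul]; ring
        rw [h']
        exact h
    · rw [map_add, add_sub_add_comm]
      exact add_mem hy hz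

lemma K_le_sup_prod (B : Finset (Fin m)) : X.K w A B ≤ X.IA w A ⊔ ∏ i ∈ B, X.N i := by
  suffices h : ∀ f ∈ X.K w A B, ∃ g ∈ ∏ i ∈ B, X.N i, f - g ∈ X.IA w A by
    intro f hf
    obtain ⟨g, hg, hfg⟩ := h f hf
    rw [← sub_add_cancel f g]
    exact add_mem (Ideal.mem_sup_left hfg) (Ideal.mem_sup_right hg)
  induction B using Finset.induction_on with
  | empty => exact fun f _ => ⟨f, by simp, by simp⟩
  | insert r B hr ih =>
    intro f hf
    rw [K_insert] at hf
    obtain ⟨g, hg, hfg⟩ := ih f hf.1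
    refine ⟨g - X.kill r g, ?_, ?_⟩
    · rw [Finset.prod_insert hr]
      exact sub_kill_mem_mul hr g hg
    · rw [show f - (g - X.kill r g) = f - g + X.kill r f - X.kill r (f - g) by rw [map_sub]; ring]
      refine sub_mem (add_mem hfg ?_) ?_
      · exact kill_mem_IA (fun j hj hjr => Finset.mem_erase.mpr ⟨hjr, hj⟩) hf.2
      · exact kill_mem_IA (fun j hj _ => hj) hfg

lemma prod_N_le_of_card_eq_five (hw : X.GoodW w) (hB : B.card = 5) :
    ∏ i ∈ B, X.N i ≤ X.IA w A := by
  obtain ⟨n, B', hn, rfl, hB'⟩ := Finset.card_eq_succ.mp hB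
  obtain ⟨l, B'', hl, rfl, hB''⟩ := Finset.card_eq_succ.mp hB'
  obtain ⟨i, j, k, hij, hik, hjk, rfl⟩ := Finset.card_eq_three.mp hB''
  simp only [Finset.mem_insert, Finset.mem_singleton, not_or] at hn hl
  obtain ⟨F, hF⟩ := hw.quad i j k l hij hik hjk hl.1 hl.2.1 hl.2.2
  rw [Finset.prod_insert (by simp [hn]), Finset.prod_insert (by simp [hl]),
    Finset.prod_insert (by simp [hij, hik]), Finset.prod_pair hjk]
  simp only [N, Ideal.span_mul_span']
  rw [Ideal.span_le]
  rintro _ ⟨_, ⟨φ₅, rfl⟩, _, ⟨_, ⟨φ₄, rfl⟩, _, ⟨_, ⟨φ₁, rfl⟩, _, ⟨_, ⟨φ₂, rfl⟩, _, ⟨φ₃, rfl⟩,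
    rfl⟩, rfl⟩, rfl⟩, rfl⟩
  have h := F.rel5 hw (J := X.IA w A) I_le_IA (fun x φ hφ => L_mem_IA hφ) hl.1 hl.2.1 hl.2.2 hF
    hn.2.1 hn.2.2.1 hn.2.2.2 hn.1 φ₁ φ₂ φ₃ φ₄ φ₅
  rw [SetLike.mem_coe]
  convert h using 1
  ring

lemma IA_eq_K (hw : X.GoodW w) (hB : B.card = 5) : X.IA w A = X.K w A B :=
  le_antisymm IA_le_K ((K_le_sup_prod B).trans (sup_le le_rfl (prod_N_le_of_card_eq_five hw hB)))

end CameraData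

namespace CameraData

variable {m : ℕ} (X : CameraData m) (w : Fin m → Vec4)

/-- Points whose columns lie on the pencil spanned by two functionals, with the columns in `S`
moreover annihilating the auxiliary vectors. -/
def IsPt (S : Finset (Fin m)) (g : LineRing m →ₐ[ℂ] ℂ) : Prop :=
  ∃ u v : Vec4 →ₗ[ℂ] ℂ, (∀ i, ∃ s : ℂ, ∀ φ, g (X.L i φ) = s * (u (X.c i) * v φ - v (X.c i) * u φ)) ∧
    ∀ i ∈ S, g (X.L i (w i)) = 0

/-- The ideal of the points `IsPt`. -/
def vanish (S : Finset (Fin m)) : Ideal (LineRing m) :=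
  ⨅ g : LineRing m →ₐ[ℂ] ℂ, ⨅ _ : X.IsPt w S g, RingHom.ker g

variable {X w} {A B S : Finset (Fin m)}

lemma mem_vanish {f : LineRing m} : f ∈ X.vanish w S ↔ ∀ g, X.IsPt w S g → g f = 0 := by
  simp [vanish, Submodule.mem_iInf]

lemma c_ne_zero (i : Fin m) : X.c i ≠ 0 := (X.isCenter i).1

lemma isPt_of_span {g : LineRing m →ₐ[ℂ] ℂ} (u v : Vec4 →ₗ[ℂ] ℂ)
    (h : ∀ i, (∀ φ, g (X.L i φ) = 0) ∨ ((u (X.c i) ≠ 0 ∨ v (X.c i) ≠ 0) ∧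
      ∃ x y : ℂ, ∀ φ, g (X.L i φ) = x * u φ + y * v φ))
    (hw : ∀ i ∈ S, g (X.L i (w i)) = 0) : X.IsPt w S g := by
  refine ⟨u, v, fun i => ?_, hw⟩
  rcases h i with h0 | ⟨hc, x, y, hxy⟩
  · exact ⟨0, fun φ => by rw [h0, zero_mul]⟩
  · have h1 := hxy (X.c i)
    rw [X.L_c, map_zero] at h1
    rcases hc with hc | hc
    · refine ⟨y / u (X.c i), fun φ => ?_⟩
      rw [hxy]
      field_simp
      linear_combination -u φ * h1
    · refine ⟨-x / v (X.c i), fun φ => ?_⟩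
      rw [hxy]
      field_simp
      linear_combination -v φ * h1

lemma mem_P_of_points {K : Fin m → Submodule ℂ Vec4} (hK : ∀ j, X.c j ∈ K j) {G f : LineRing m}
    (hG : G ∉ X.P K) (h : ∀ g : LineRing m →ₐ[ℂ] ℂ, (∀ j, ∀ φ ∈ K j, g (X.L j φ) = 0) → g G ≠ 0 →
      g f = 0) : f ∈ X.P K := by
  obtain ⟨F, hF, hL⟩ := exists_ker_eq_P hK
  rw [← hF, RingHom.mem_ker] at hG ⊢
  have h1 : F f * F G = 0 := by
    apply MvPolynomial.funext
    intro x
    rw [map_mul, map_zero]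
    by_cases hx : eval x (F G) = 0
    · rw [hx, mul_zero]
    · have h2 := h ((aeval x).comp F) (fun j φ hφ => by
        rw [AlgHom.comp_apply, (hL j φ).mpr hφ, map_zero]) hx
      rw [AlgHom.comp_apply] at h2
      rw [show eval x (F f) = 0 from h2, zero_mul]
  exact (mul_eq_zero.mp h1).resolve_right hG

lemma exists_eq_smul {f β : Vec4 →ₗ[ℂ] ℂ} (h : ∀ φ, β φ = 0 → f φ = 0) :
    ∃ t : ℂ, ∀ φ, f φ = t * β φ := by
  by_cases hβ : ∃ q, β q ≠ 0
  · obtain ⟨q, hq⟩ := hβ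
    refine ⟨f q / β q, fun φ => ?_⟩
    have h1 := h (φ - (β φ / β q) • q) (by simp [hq])
    rw [map_sub, map_smul, smul_eq_mul, sub_eq_zero] at h1
    rw [h1]
    ring
  · push Not at hβ
    exact ⟨0, fun φ => by rw [h φ (hβ φ), zero_mul]⟩

/-- The points where every column in `B` is proportional to a fixed functional. -/
lemma le_P_ker (u v : Vec4 →ₗ[ℂ] ℂ) (β : Fin m → Vec4 →ₗ[ℂ] ℂ)
    (hβ : ∀ i ∈ B, (u (X.c i) ≠ 0 ∨ v (X.c i) ≠ 0) ∧ ∃ x y : ℂ, ∀ φ, β i φ = x * u φ + y * v φ)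
    (h𝓛 : ∀ i ∈ B, ∀ φ ∈ X.𝓛 w i, β i φ = 0) :
    X.I ⊔ X.vanish w S ≤ X.P (onCols B fun i => LinearMap.ker (β i)) := by
  have hK : ∀ i, X.c i ∈ onCols B (fun i => LinearMap.ker (β i)) i :=
    c_mem_onCols fun i hi => LinearMap.mem_ker.mpr (h𝓛 i hi _ (c_mem_𝓛 i))
  have key : ∀ g : LineRing m →ₐ[ℂ] ℂ,
      (∀ j, ∀ φ ∈ onCols B (fun i => LinearMap.ker (β i)) j, g (X.L j φ) = 0) → X.IsPt w S g := by
    intro g hg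
    refine isPt_of_span u v (fun i => ?_) fun i _ => hg i _ (mem_onCols.mpr fun hi =>
      LinearMap.mem_ker.mpr (h𝓛 i hi _ (w_mem_𝓛 i)))
    by_cases hi : i ∈ B
    · obtain ⟨h1, x, y, hxy⟩ := hβ i hi
      obtain ⟨t, ht⟩ := exists_eq_smul (f := g.toLinearMap.comp (X.L i)) (β := β i)
        fun φ hφ => hg i φ (mem_onCols.mpr fun _ => hφ)
      refine Or.inr ⟨h1, t * x, t * y, fun φ => ?_⟩
      have := ht φ
      rw [hxy] at this
      rw [show g (X.L i φ) = _ from this]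
      ring
    · exact Or.inl fun φ => hg i φ (mem_onCols.mpr fun h => absurd h hi)
  have hone : (1 : LineRing m) ∉ X.P (onCols B fun i => LinearMap.ker (β i)) :=
    (Ideal.ne_top_iff_one _).mp (P_isPrime hK).ne_top
  refine sup_le (fun f hf => mem_P_of_points hK hone fun g hg _ => ?_)
    fun f hf => mem_P_of_points hK hone fun g hg _ => mem_vanish.mp hf g (key g hg)
  obtain ⟨u, v, huv, -⟩ := key g hg
  choose s hs using huv
  exact I_le_ker g u v (fun j => ⟨-(s j * v (X.c j)), s j * u (X.c j), fun φ => by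
    rw [hs]; ring⟩) hf

lemma c_notMem_𝓛 (hw : X.GoodW w) {i j : Fin m} (hij : i ≠ j) : X.c i ∉ X.𝓛 w j := fun h =>
  c_ne_zero i ((Submodule.disjoint_def.mp (hw.pair i j hij)) _ (c_mem_𝓛 i) h)

lemma L_mem_P𝓛_iff {j : Fin m} {φ : Vec4} :
    X.L j φ ∈ X.P (onCols B (X.𝓛 w)) ↔ (j ∈ B → φ ∈ X.𝓛 w j) := by
  rw [L_mem_P_iff (c_mem_onCols fun j _ => c_mem_𝓛 j), mem_onCols]

lemma P𝓛_isPrime (B : Finset (Fin m)) : (X.P (onCols B (X.𝓛 w))).IsPrime :=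
  P_isPrime (c_mem_onCols fun j _ => c_mem_𝓛 j)

lemma le_P_pair (hw : X.GoodW w) {i j : Fin m} (hij : i ≠ j) :
    X.I ⊔ X.vanish w S ≤ X.P (onCols {i, j} (X.𝓛 w)) := by
  have hP := P𝓛_isPrime (X := X) (w := w) {i, j}
  have hG : X.L j (X.c i) * X.L i (X.c j) ∉ X.P (onCols {i, j} (X.𝓛 w)) := by
    intro h
    rcases hP.mem_or_mem h with h | h <;> rw [L_mem_P𝓛_iff] at h
    · exact c_notMem_𝓛 hw hij (h (by simp))
    · exact c_notMem_𝓛 hw hij.symm (h (by simp))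
  have hK : ∀ x, X.c x ∈ onCols {i, j} (X.𝓛 w) x := c_mem_onCols fun j _ => c_mem_𝓛 j
  have key : ∀ g : LineRing m →ₐ[ℂ] ℂ,
      (∀ x, ∀ φ ∈ onCols {i, j} (X.𝓛 w) x, g (X.L x φ) = 0) →
      g (X.L j (X.c i) * X.L i (X.c j)) ≠ 0 → X.IsPt w S g := by
    intro g hg hG
    rw [map_mul, mul_ne_zero_iff] at hG
    refine isPt_of_span (g.toLinearMap.comp (X.L i)) (g.toLinearMap.comp (X.L j)) (fun x => ?_)
      fun x _ => hg x _ (mem_onCols.mpr fun _ => w_mem_𝓛 x)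
    by_cases hxi : x = i
    · subst hxi
      exact Or.inr ⟨Or.inr hG.1, 1, 0, fun φ => by simp⟩
    by_cases hxj : x = j
    · subst hxj
      exact Or.inr ⟨Or.inl hG.2, 0, 1, fun φ => by simp⟩
    · exact Or.inl fun φ => hg x φ (mem_onCols.mpr fun h => by simp [hxi, hxj] at h)
  refine sup_le (fun f hf => mem_P_of_points hK hG fun g hg hg' => ?_)
    fun f hf => mem_P_of_points hK hG fun g hg hg' => mem_vanish.mp hf g (key g hg hg')
  obtain ⟨u, v, huv, -⟩ := key g hg hg'
  choose s hs using huv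
  exact I_le_ker g u v (fun j => ⟨-(s j * v (X.c j)), s j * u (X.c j), fun φ => by
    rw [hs]; ring⟩) hf

lemma le_P_of_card_le_two (hw : X.GoodW w) (hm : 2 ≤ m) (hA : A.card ≤ 2) :
    X.I ⊔ X.vanish w S ≤ X.P (onCols A (X.𝓛 w)) := by
  obtain ⟨A', hAA', hA'⟩ := Finset.exists_superset_card_eq hA (by simpa using hm)
  obtain ⟨i, j, hij, rfl⟩ := Finset.card_eq_two.mp hA'
  exact (le_P_pair hw hij).trans (P_mono fun x φ hφ => mem_onCols.mpr fun hx =>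
    mem_onCols.mp hφ (hAA' hx))

lemma IA_eq_P (hw : X.GoodW w) (hm : 2 ≤ m) (hA : A.card ≤ 2) :
    X.IA w A = X.P (onCols A (X.𝓛 w)) :=
  le_antisymm (sup_le (le_sup_left.trans (le_P_of_card_le_two (S := ∅) hw hm hA)) le_rfl) P_le_IA

lemma good_IA_of_card_le_two (hw : X.GoodW w) (hm : 2 ≤ m) (hA : A.card ≤ 2) :
    Good (X.vanish w S) (2 * A.card) (X.IA w A) := by
  rw [IA_eq_P hw hm hA]
  exact ⟨Coord.depthGE_P𝓛 A, le_sup_right.trans (le_P_of_card_le_two hw hm hA)⟩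

namespace Coord

lemma L_mem_Q_iff {e : X.Coord w B} {j : Fin m} (hj : j ∈ B) {φ : Vec4} :
    X.L j φ ∈ e.Q ↔ φ ∈ X.𝓛 w j := by
  refine ⟨fun h => ?_, fun h => P_le_Q (L_mem_P (mem_onCols.mpr fun _ => h))⟩
  obtain ⟨σ, hσ⟩ := e.exists_isParam
  rw [← hσ.ker_eq_Q, RingHom.mem_ker, hσ, if_pos hj, mul_eq_zero] at h
  have h := h.resolve_right (X_ne_zero _)
  rw [e.mem_𝓛 j hj]
  have h1 := congrArg (aeval (R := ℂ) (Sum.elim ![(1 : ℂ), 0] fun _ => 0)) h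
  have h2 := congrArg (aeval (R := ℂ) (Sum.elim ![(0 : ℂ), 1] fun _ => 0)) h
  simp at h1 h2
  exact ⟨h1, h2⟩

lemma br_notMem_P (e : X.Coord w B) {i j : Fin m} (hij : i ≠ j) (hi : i ∈ B) (hj : j ∈ B) :
    e.br i j ∉ X.P (onCols B (X.𝓛 w)) := by
  obtain ⟨F, hF⟩ := X.exists_lift (B := ℂ) (fun x => if x = i then e.α i else
    if x = j then e.β j else 0) (fun x => by
      split_ifs with h1 h2
      · subst h1; exact α_c hi
      · subst h2; exact β_c hj
      · rfl)
  intro h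
  have h1 : X.P (onCols B (X.𝓛 w)) ≤ RingHom.ker F := by
    refine P_le_iff.mpr fun x φ hφ => ?_
    rw [RingHom.mem_ker, hF]
    split_ifs with h1 h2
    · subst h1; exact ((e.mem_𝓛 _ hi φ).mp (mem_onCols.mp hφ hi)).1
    · subst h2; exact ((e.mem_𝓛 _ hj φ).mp (mem_onCols.mp hφ hj)).2
    · rfl
  have h2 := RingHom.mem_ker.mp (h1 h)
  rw [br, map_sub, map_mul, map_mul, Coord.a, Coord.a, Coord.b, Coord.b, hF, hF, hF, hF] at h2
  simp [hij.symm, e.αp i hi, e.αq i hi, e.βq j hj, e.βp j hj] at h2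

end Coord

namespace Frame

variable {i j k : Fin m} (F : X.Frame w {i, j, k} i j k)

lemma le_Q (hw : X.GoodW w) : X.I ⊔ X.vanish w S ≤ F.coord.Q := by
  obtain ⟨σ, hσ⟩ := F.coord.exists_isParam
  have hQ := F.coord.Q_isPrime
  have hij := F.hij
  have hik := F.hik
  have hjk := F.hjk
  have hi : ∀ φ, σ (X.L i φ) = (F.e.coord 0 φ • MvPolynomial.X (Sum.inl 0) +
      F.e.coord 1 φ • MvPolynomial.X (Sum.inl 1)) * MvPolynomial.X (Sum.inr i) := by
    intro φ
    rw [hσ, if_pos (by simp)]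
    simp [coord]
  have hj : ∀ φ, σ (X.L j φ) = (F.e.coord 2 φ • MvPolynomial.X (Sum.inl 0) +
      F.e.coord 3 φ • MvPolynomial.X (Sum.inl 1)) * MvPolynomial.X (Sum.inr j) := by
    intro φ
    rw [hσ, if_pos (by simp)]
    simp [coord, hij.symm]
  have hk : ∀ φ, σ (X.L k φ) = ((F.e.coord 0 φ + F.e.coord 2 φ) • MvPolynomial.X (Sum.inl 0) +
      (F.e.coord 1 φ + F.e.coord 3 φ) • MvPolynomial.X (Sum.inl 1)) *
        MvPolynomial.X (Sum.inr k) := by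
    intro φ
    rw [hσ, if_pos (by simp)]
    simp [coord, hik.symm, hjk.symm]
  have ho : ∀ x, x ≠ i → x ≠ j → x ≠ k → ∀ φ, σ (X.L x φ) = 0 := by
    intro x h1 h2 h3 φ
    rw [hσ, if_neg (by simp [h1, h2, h3])]
  have hG : X.L j (X.c i) * X.L i (X.c j) * X.L i (X.c k) ∉ F.coord.Q := by
    intro h
    rcases hQ.mem_or_mem h with h | h
    · rcases hQ.mem_or_mem h with h | h <;> rw [Coord.L_mem_Q_iff (by simp)] at h
      · exact c_notMem_𝓛 hw hij h
      · exact c_notMem_𝓛 hw hij.symm h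
    · rw [Coord.L_mem_Q_iff (by simp)] at h
      exact c_notMem_𝓛 hw hik.symm h
  refine sup_le ?_ fun f hf => ?_
  · rw [← hσ.ker_eq_Q]
    refine I_le_ker σ (fun φ => F.e.coord 0 φ • MvPolynomial.X (Sum.inl 0) +
      F.e.coord 1 φ • MvPolynomial.X (Sum.inl 1)) (fun φ => F.e.coord 2 φ •
      MvPolynomial.X (Sum.inl 0) + F.e.coord 3 φ • MvPolynomial.X (Sum.inl 1)) fun x => ?_
    by_cases hxi : x = i
    · subst hxi
      exact ⟨MvPolynomial.X (Sum.inr x), 0, fun φ => by rw [hi]; ring⟩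
    by_cases hxj : x = j
    · subst hxj
      exact ⟨0, MvPolynomial.X (Sum.inr x), fun φ => by rw [hj]; ring⟩
    by_cases hxk : x = k
    · subst hxk
      exact ⟨MvPolynomial.X (Sum.inr x), MvPolynomial.X (Sum.inr x), fun φ => by
        rw [hk, add_smul, add_smul]; ring⟩
    · exact ⟨0, 0, fun φ => by rw [ho x hxi hxj hxk]; ring⟩
  · rw [← hσ.ker_eq_Q, RingHom.mem_ker] at hG ⊢
    refine (mul_eq_zero.mp (?_ : σ f * σ _ = 0)).resolve_right hG
    apply MvPolynomial.funext
    intro x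
    rw [map_mul, map_zero]
    by_cases hx : eval x (σ (X.L j (X.c i) * X.L i (X.c j) * X.L i (X.c k))) = 0
    · rw [hx, mul_zero]
    have hpt : X.IsPt w S ((aeval x).comp σ) := by
      rw [← ne_eq] at hx
      simp only [map_mul, map_add, smul_eval, eval_X, mul_ne_zero_iff, hi, hj] at hx
      refine isPt_of_span (x (Sum.inl 0) • F.e.coord 0 + x (Sum.inl 1) • F.e.coord 1)
        (x (Sum.inl 0) • F.e.coord 2 + x (Sum.inl 1) • F.e.coord 3) (fun y => ?_) fun y _ => ?_
      · by_cases hyi : y = i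
        · subst hyi
          refine Or.inr ⟨Or.inr ?_, x (Sum.inr y), 0, fun φ => ?_⟩
          · simpa [mul_comm] using hx.1.1.1
          · rw [AlgHom.comp_apply, hi]
            simp
            ring
        by_cases hyj : y = j
        · subst hyj
          refine Or.inr ⟨Or.inl ?_, 0, x (Sum.inr y), fun φ => ?_⟩
          · simpa [mul_comm] using hx.1.2.1
          · rw [AlgHom.comp_apply, hj]
            simp
            ring
        by_cases hyk : y = k
        · subst hyk
          refine Or.inr ⟨Or.inl ?_, x (Sum.inr y), x (Sum.inr y), fun φ => ?_⟩
          · simpa [mul_comm] using hx.2.1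
          · rw [AlgHom.comp_apply, hk]
            simp
            ring
        · exact Or.inl fun φ => by rw [AlgHom.comp_apply, ho y hyi hyj hyk, map_zero]
      · have : X.L y (w y) ∈ F.coord.Q :=
          Coord.P_le_Q (L_mem_P (mem_onCols.mpr fun _ => w_mem_𝓛 y))
        rw [← hσ.ker_eq_Q, RingHom.mem_ker] at this
        rw [AlgHom.comp_apply, this, map_zero]
    have := mem_vanish.mp hf _ hpt
    rw [AlgHom.comp_apply] at this
    rw [show eval x (σ f) = 0 from this, zero_mul]

end Frame

end CameraData

namespace CameraData

variable {m : ℕ} {X : CameraData m} {w : Fin m → Vec4} {A B S : Finset (Fin m)}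

lemma good_of_br {e : X.Coord w A} {x y z : Fin m} (hxy : x ≠ y) (hA : A = {x, y, z})
    {V J : Ideal (LineRing m)} (hJ : X.IA w A ≤ J) (hJP : J ≤ X.P (onCols {x, y} (X.𝓛 w)))
    (hz : ∀ φ, X.L z φ * e.br x y ∈ J) (hV : V ≤ X.P (onCols {x, y} (X.𝓛 w)))
    (h : Good V 4 (J ⊔ Ideal.span {e.br x y})) : Good V 4 J := by
  have hP := P𝓛_isPrime (X := X) (w := w) {x, y}
  have hsub : ({x, y} : Finset (Fin m)) ⊆ A := by
    rw [hA]
    intro t ht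
    simp only [Finset.mem_insert, Finset.mem_singleton] at ht ⊢
    tauto
  refine Good.of_colon_prime hJP ((e.restrict hsub).br_notMem_P hxy (by simp) (by simp)) ?_
    ⟨by simpa [Finset.card_pair hxy] using Coord.depthGE_P𝓛 (X := X) (w := w) {x, y}, hV⟩ h
  suffices h : X.P (onCols {x, y} (X.𝓛 w)) ≤ J.colon {e.br x y} by
    intro p hp
    have := h hp
    rwa [Submodule.mem_colon_singleton] at this
  refine P_le_iff.mpr fun t φ hφ => ?_
  rw [Submodule.mem_colon_singleton, smul_eq_mul]
  by_cases ht : t ∈ ({x, y} : Finset (Fin m))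
  · exact Ideal.mul_mem_right _ _ (hJ (L_mem_IA (mem_onCols.mp hφ ht)))
  by_cases htz : t = z
  · rw [htz]
    exact hz φ
  · refine Ideal.mul_mem_right _ _ (hJ (L_mem_IA_of_notMem ?_ φ))
    rw [hA]
    simp only [Finset.mem_insert, Finset.mem_singleton] at ht ⊢
    tauto

lemma br_mem_P_of_notMem {e : X.Coord w A} {x y : Fin m} (h : x ∉ B ∨ y ∉ B) :
    e.br x y ∈ X.P (onCols B (X.𝓛 w)) := by
  rcases h with h | h
  · exact sub_mem (Ideal.mul_mem_right _ _ (L_mem_P (mem_onCols.mpr fun h' => absurd h' h)))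
      (Ideal.mul_mem_right _ _ (L_mem_P (mem_onCols.mpr fun h' => absurd h' h)))
  · exact sub_mem (Ideal.mul_mem_left _ _ (L_mem_P (mem_onCols.mpr fun h' => absurd h' h)))
      (Ideal.mul_mem_left _ _ (L_mem_P (mem_onCols.mpr fun h' => absurd h' h)))

namespace Frame

variable {i j k l : Fin m}

lemma good_Q (hw : X.GoodW w) (F : X.Frame w {i, j, k} i j k) :
    Good (X.vanish w S) 4 F.coord.Q := by
  refine ⟨?_, le_sup_right.trans (F.le_Q hw)⟩
  have h := F.coord.depthGE_Q (by simp)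
  rwa [Finset.card_eq_three.mpr ⟨i, j, k, F.hij, F.hik, F.hjk, rfl⟩] at h

lemma good_IA_three (hw : X.GoodW w) (hm : 2 ≤ m) (F : X.Frame w {i, j, k} i j k) :
    Good (X.vanish w S) 4 (X.IA w {i, j, k}) := by
  have hij := F.hij
  have hik := F.hik
  have hjk := F.hjk
  have hrel := F.rel3 (J := X.IA w {i, j, k}) I_le_IA (fun x φ hφ => L_mem_IA hφ)
    (by simp) (by simp) (by simp)
  have hle : ∀ x y, x ∈ ({i, j, k} : Finset (Fin m)) → y ∈ ({i, j, k} : Finset (Fin m)) →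
      X.IA w {i, j, k} ≤ X.P (onCols {x, y} (X.𝓛 w)) := fun x y hx hy =>
    (IA_mono (by intro t ht; rw [Finset.mem_insert, Finset.mem_singleton] at ht
                 rcases ht with rfl | rfl <;> assumption)).trans
      (IA_eq_P hw hm Finset.card_le_two).le
  have hV : ∀ x y, X.vanish w S ≤ X.P (onCols {x, y} (X.𝓛 w)) := fun x y =>
    le_sup_right.trans (le_P_of_card_le_two hw hm Finset.card_le_two)
  refine good_of_br (e := F.coord) hij rfl le_rfl (hle i j (by simp) (by simp))
    (fun φ => (hrel φ).1) (hV _ _) ?_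
  refine good_of_br (e := F.coord) (z := j) hik (by ext; simp; tauto) le_sup_left
    (sup_le (hle i k (by simp) (by simp)) ((Ideal.span_singleton_le_iff_mem _).mpr
      (br_mem_P_of_notMem (Or.inr (by simp [hij.symm, hjk])))))
    (fun φ => Ideal.mem_sup_left (hrel φ).2.1) (hV _ _) ?_
  refine good_of_br (e := F.coord) (z := i) hjk (by ext; simp; tauto)
    (le_sup_left.trans le_sup_left)
    (sup_le (sup_le (hle j k (by simp) (by simp)) ((Ideal.span_singleton_le_iff_mem _).mpr
      (br_mem_P_of_notMem (Or.inl (by simp [hij, hik])))))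
      ((Ideal.span_singleton_le_iff_mem _).mpr (br_mem_P_of_notMem (Or.inl (by simp [hij, hik])))))
    (fun φ => Ideal.mem_sup_left (Ideal.mem_sup_left (hrel φ).2.2)) (hV _ _) ?_
  have hEq : X.IA w {i, j, k} ⊔ Ideal.span {F.coord.br i j} ⊔ Ideal.span {F.coord.br i k} ⊔
      Ideal.span {F.coord.br j k} = F.coord.Q := by
    apply le_antisymm
    · refine sup_le (sup_le (sup_le (sup_le (le_sup_left.trans (F.le_Q (S := ∅) hw))
        Coord.P_le_Q) ?_) ?_) ?_ <;> rw [Ideal.span_singleton_le_iff_mem] <;>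
        exact Coord.br_mem_Q (by simp) (by simp)
    · refine Coord.Q_le (P_le_IA.trans (le_sup_left.trans (le_sup_left.trans le_sup_left))) ?_
      have h1 : F.coord.br i j ∈ X.IA w {i, j, k} ⊔ Ideal.span {F.coord.br i j} ⊔
          Ideal.span {F.coord.br i k} ⊔ Ideal.span {F.coord.br j k} :=
        Ideal.mem_sup_left (Ideal.mem_sup_left (Ideal.mem_sup_right
          (Ideal.mem_span_singleton_self _)))
      have h2 : F.coord.br i k ∈ X.IA w {i, j, k} ⊔ Ideal.span {F.coord.br i j} ⊔
          Ideal.span {F.coord.br i k} ⊔ Ideal.span {F.coord.br j k} :=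
        Ideal.mem_sup_left (Ideal.mem_sup_right (Ideal.mem_span_singleton_self _))
      have h3 : F.coord.br j k ∈ X.IA w {i, j, k} ⊔ Ideal.span {F.coord.br i j} ⊔
          Ideal.span {F.coord.br i k} ⊔ Ideal.span {F.coord.br j k} :=
        Ideal.mem_sup_right (Ideal.mem_span_singleton_self _)
      have hs : ∀ x y (J : Ideal (LineRing m)), F.coord.br x y ∈ J → F.coord.br y x ∈ J :=
        fun x y J h => by
          rw [show F.coord.br y x = -F.coord.br x y by rw [Coord.br, Coord.br]; ring]
          exact neg_mem h
      have h0 : ∀ x, F.coord.br x x = 0 := fun x => by rw [Coord.br]; ring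
      intro x hx y hy
      simp only [Finset.mem_insert, Finset.mem_singleton] at hx hy
      rcases hx with rfl | rfl | rfl <;> rcases hy with rfl | rfl | rfl
      · rw [h0]; exact zero_mem _
      · exact h1
      · exact h2
      · exact hs _ _ _ h1
      · rw [h0]; exact zero_mem _
      · exact h3
      · exact hs _ _ _ h2
      · exact hs _ _ _ h3
      · rw [h0]; exact zero_mem _
  rw [hEq]
  exact F.good_Q hw

lemma card_four (F : X.Frame w {i, j, k, l} i j k) (hli : l ≠ i) (hlj : l ≠ j) (hlk : l ≠ k) :
    ({i, j, k, l} : Finset (Fin m)).card = 4 := by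
  rw [Finset.card_insert_of_notMem, Finset.card_insert_of_notMem, Finset.card_pair] <;>
    simp [F.hij, F.hik, F.hjk, hli.symm, hlj.symm, hlk.symm]

lemma coord_c (hw : X.GoodW w) (F : X.Frame w {i, j, k, l} i j k) (hli : l ≠ i) (hlj : l ≠ j)
    (hlk : l ≠ k) {x : Fin m} (hx : x ∈ ({i, j, k, l} : Finset (Fin m))) :
    (F.e.coord 1 (X.c x) ≠ 0 ∨ F.e.coord 3 (X.c x) ≠ 0) ∧
    (F.e.coord 0 (X.c x) ≠ 0 ∨ F.e.coord 2 (X.c x) ≠ 0) := by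
  have hcard : (({i, j, k, l} : Finset (Fin m)).erase x).card = 3 := by
    rw [Finset.card_erase_of_mem hx, F.card_four hli hlj hlk]
  have hsum := F.e.sum_repr (X.c x)
  rw [Fin.sum_univ_four] at hsum
  simp only [← Module.Basis.coord_apply] at hsum
  constructor <;> by_contra! h
  · refine hw.center _ (F.finrank_span_e (show (0 : Fin 4) ≠ 2 by decide)) x ?_ _ hcard (by simp)
      fun y hy => (F.meets (Finset.mem_of_mem_erase hy)).1
    rw [Submodule.mem_span_pair]
    exact ⟨F.e.coord 0 (X.c x), F.e.coord 2 (X.c x), by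
      simpa only [h.1, h.2, zero_smul, add_zero] using hsum⟩
  · refine hw.center _ (F.finrank_span_e (show (1 : Fin 4) ≠ 3 by decide)) x ?_ _ hcard (by simp)
      fun y hy => (F.meets (Finset.mem_of_mem_erase hy)).2
    rw [Submodule.mem_span_pair]
    exact ⟨F.e.coord 1 (X.c x), F.e.coord 3 (X.c x), by
      simpa only [h.1, h.2, zero_smul, add_zero, zero_add] using hsum⟩

lemma le_M (hw : X.GoodW w) (F : X.Frame w {i, j, k, l} i j k) (hli : l ≠ i) (hlj : l ≠ j)
    (hlk : l ≠ k) : X.I ⊔ X.vanish w S ≤ F.coord.M ∧ X.I ⊔ X.vanish w S ≤ F.coord.swap.M := by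
  constructor
  · refine le_P_ker (F.e.coord 1) (F.e.coord 3) F.coord.β (fun x hx =>
      ⟨(F.coord_c hw hli hlj hlk hx).1, ?_⟩) fun x hx φ hφ => ((F.coord.mem_𝓛 x hx φ).mp hφ).2
    by_cases hxi : x = i
    · exact ⟨1, 0, fun φ => by simp [coord, hxi]⟩
    by_cases hxj : x = j
    · exact ⟨0, 1, fun φ => by simp [coord, hxj, F.hij.symm]⟩
    by_cases hxk : x = k
    · exact ⟨1, 1, fun φ => by simp [coord, hxk, F.hik.symm, F.hjk.symm]⟩
    · exact ⟨1, F.n2, fun φ => by simp [coord, hxi, hxj, hxk]⟩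
  · refine le_P_ker (F.e.coord 0) (F.e.coord 2) F.coord.α (fun x hx =>
      ⟨(F.coord_c hw hli hlj hlk hx).2, ?_⟩) fun x hx φ hφ => ((F.coord.mem_𝓛 x hx φ).mp hφ).1
    by_cases hxi : x = i
    · exact ⟨1, 0, fun φ => by simp [coord, hxi]⟩
    by_cases hxj : x = j
    · exact ⟨0, 1, fun φ => by simp [coord, hxj, F.hij.symm]⟩
    by_cases hxk : x = k
    · exact ⟨1, 1, fun φ => by simp [coord, hxk, F.hik.symm, F.hjk.symm]⟩
    · exact ⟨1, F.n1, fun φ => by simp [coord, hxi, hxj, hxk]⟩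

/-- The frame of the first three columns. -/
def three (F : X.Frame w {i, j, k, l} i j k) : X.Frame w {i, j, k} i j k :=
  { F with other := fun x hx h1 h2 h3 => by simp [h1, h2, h3] at hx }

end Frame

end CameraData

namespace CameraData

variable {m : ℕ} {X : CameraData m} {w : Fin m → Vec4} {A B S : Finset (Fin m)}

/-- Six congruences between the monomials of degree three. -/
lemma Frame.rel_monomials {i j k : Fin m} (F : X.Frame w B i j k) {J : Ideal (LineRing m)}
    (hI : X.I ≤ J) (hP : ∀ x, ∀ φ ∈ X.𝓛 w x, X.L x φ ∈ J) (hi : i ∈ B) (hj : j ∈ B)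
    (hk : k ∈ B) :
    F.coord.a i * F.coord.br j k ∈ J ∧ F.coord.b i * F.coord.br j k ∈ J ∧
    F.coord.a j * F.coord.br i k ∈ J ∧ F.coord.b j * F.coord.br i k ∈ J ∧
    F.coord.a k * F.coord.br i j ∈ J ∧ F.coord.b k * F.coord.br i j ∈ J :=
  ⟨(F.rel3 hI hP hi hj hk _).2.2, (F.rel3 hI hP hi hj hk _).2.2, (F.rel3 hI hP hi hj hk _).2.1,
    (F.rel3 hI hP hi hj hk _).2.1, (F.rel3 hI hP hi hj hk _).1, (F.rel3 hI hP hi hj hk _).1⟩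

lemma N_mul_mem {r : Fin m} {e : X.Coord w B} (hr : r ∈ B) {J J' : Ideal (LineRing m)}
    (hP : ∀ x, ∀ φ ∈ X.𝓛 w x, X.L x φ ∈ J) {g : LineRing m} (hJ : J ≤ J')
    (ha : e.a r * g ∈ J') (hb : e.b r * g ∈ J') (φ : Vec4) : X.L r φ * g ∈ J' := by
  have h : X.L r φ - (C (e.α r φ) * e.a r + C (e.β r φ) * e.b r) ∈ J' := by
    have := hJ (hP r _ (e.decomp hr φ))
    rwa [map_sub, map_sub, map_smul, map_smul, smul_eq_C_mul, smul_eq_C_mul, sub_sub] at this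
  have h1 := J'.add_mem (J'.mul_mem_right g h) (J'.add_mem (J'.mul_mem_left (C (e.α r φ)) ha)
    (J'.mul_mem_left (C (e.β r φ)) hb))
  convert h1 using 1
  ring

lemma mem_of_M_le_colon {e : X.Coord w B} {J : Ideal (LineRing m)} {x : LineRing m}
    (h1 : X.P (onCols B (X.𝓛 w)) ≤ J) (h2 : ∀ j ∈ B, e.a j * x ∈ J) : ∀ p ∈ e.M, p * x ∈ J := by
  suffices h : e.M ≤ J.colon {x} by
    intro p hp
    have := h hp
    rwa [Submodule.mem_colon_singleton] at this
  refine Coord.M_le (fun p hp => ?_) fun j hj => ?_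
  · rw [Submodule.mem_colon_singleton]
    exact Ideal.mul_mem_right _ _ (h1 hp)
  · rw [Submodule.mem_colon_singleton]
    exact h2 j hj

namespace Frame

variable {i j k l : Fin m}

lemma K_le_monomials (F : X.Frame w {i, j, k, l} i j k) :
    X.K w {i, j, k, l} {i, j, k} = X.IA w {i, j, k, l} ⊔
      Ideal.span {F.coord.a i * F.coord.a j * F.coord.b k,
        F.coord.a i * F.coord.b j * F.coord.b k} ⊔
      Ideal.span {F.coord.a i * F.coord.a j * F.coord.a k} ⊔
      Ideal.span {F.coord.b i * F.coord.b j * F.coord.b k} := by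
  have hP : ∀ x, ∀ φ ∈ X.𝓛 w x, X.L x φ ∈ X.IA w {i, j, k, l} := fun x φ hφ => L_mem_IA hφ
  have hi : i ∈ ({i, j, k, l} : Finset (Fin m)) := by simp
  have hj : j ∈ ({i, j, k, l} : Finset (Fin m)) := by simp
  have hk : k ∈ ({i, j, k, l} : Finset (Fin m)) := by simp
  apply le_antisymm
  · refine (K_le_sup_prod _).trans (sup_le (le_sup_left.trans (le_sup_left.trans le_sup_left)) ?_)
    generalize hJ : X.IA w {i, j, k, l} ⊔
      Ideal.span {F.coord.a i * F.coord.a j * F.coord.b k,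
        F.coord.a i * F.coord.b j * F.coord.b k} ⊔
      Ideal.span {F.coord.a i * F.coord.a j * F.coord.a k} ⊔
      Ideal.span {F.coord.b i * F.coord.b j * F.coord.b k} = J
    have hIA : X.IA w {i, j, k, l} ≤ J := by
      rw [← hJ]
      exact le_sup_left.trans (le_sup_left.trans le_sup_left)
    have y1 : F.coord.a i * F.coord.a j * F.coord.b k ∈ J := by
      rw [← hJ]
      exact Ideal.mem_sup_left (Ideal.mem_sup_left (Ideal.mem_sup_right
        (Ideal.subset_span (by simp))))
    have y2 : F.coord.a i * F.coord.b j * F.coord.b k ∈ J := by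
      rw [← hJ]
      exact Ideal.mem_sup_left (Ideal.mem_sup_left (Ideal.mem_sup_right
        (Ideal.subset_span (by simp))))
    have x1 : F.coord.a i * F.coord.a j * F.coord.a k ∈ J := by
      rw [← hJ]
      exact Ideal.mem_sup_left (Ideal.mem_sup_right (Ideal.subset_span (by simp)))
    have x2 : F.coord.b i * F.coord.b j * F.coord.b k ∈ J := by
      rw [← hJ]
      exact Ideal.mem_sup_right (Ideal.subset_span (by simp))
    obtain ⟨r1, r2, r3, r4, r5, r6⟩ := F.rel_monomials (I_le_IA.trans hIA)
      (fun x φ hφ => hIA (hP x φ hφ)) hi hj hk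
    rw [Finset.prod_insert (by simp [F.hij, F.hik]), Finset.prod_pair F.hjk]
    simp only [N, Ideal.span_mul_span']
    rw [Ideal.span_le]
    rintro _ ⟨_, ⟨φ₁, rfl⟩, _, ⟨_, ⟨φ₂, rfl⟩, _, ⟨φ₃, rfl⟩, rfl⟩, rfl⟩
    rw [SetLike.mem_coe]
    refine N_mul_mem (e := F.coord) hi hP hIA ?_ ?_ φ₁ <;> rw [mul_left_comm] <;>
      refine N_mul_mem (e := F.coord) hj hP hIA ?_ ?_ φ₂ <;> rw [← mul_assoc, mul_comm] <;>
      refine N_mul_mem (e := F.coord) hk hP hIA ?_ ?_ φ₃ <;> rw [Coord.br] at *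
    · convert x1 using 1; ring
    · convert y1 using 1; ring
    · convert J.sub_mem y1 r1 using 1; ring
    · convert y2 using 1; ring
    · convert J.sub_mem y1 r3 using 1; ring
    · convert J.sub_mem y2 r6 using 1; ring
    · convert J.sub_mem y2 r4 using 1; ring
    · convert x2 using 1; ring
  · have hmem : ∀ f : LineRing m, (∀ r ∈ ({i, j, k} : Finset (Fin m)), ∃ φ g, f = g * X.L r φ) →
        f ∈ X.K w {i, j, k, l} {i, j, k} := fun f hf => mem_K.mpr fun r hr => by
      obtain ⟨φ, g, rfl⟩ := hf r hr
      exact Ideal.mul_mem_left _ _ (L_mem_IA_of_notMem (Finset.notMem_erase r _) φ)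
    have hmem' : ∀ φ ψ χ, X.L i φ * X.L j ψ * X.L k χ ∈ X.K w {i, j, k, l} {i, j, k} := by
      intro φ ψ χ
      refine hmem _ fun r hr => ?_
      simp only [Finset.mem_insert, Finset.mem_singleton] at hr
      rcases hr with rfl | rfl | rfl
      · exact ⟨φ, X.L j ψ * X.L k χ, by ring⟩
      · exact ⟨ψ, X.L i φ * X.L k χ, by ring⟩
      · exact ⟨χ, X.L i φ * X.L j ψ, by ring⟩
    refine sup_le (sup_le (sup_le IA_le_K ?_) ?_) ?_ <;> rw [Ideal.span_le]
    · rintro _ (rfl | rfl) <;> exact hmem' _ _ _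
    · rintro _ rfl
      exact hmem' _ _ _
    · rintro _ rfl
      exact hmem' _ _ _

end Frame

end CameraData

namespace CameraData

variable {m : ℕ} {X : CameraData m} {w : Fin m → Vec4} {A B S : Finset (Fin m)}

namespace Frame

variable {i j k l : Fin m}

lemma three_Q_syzygy (F : X.Frame w {i, j, k, l} i j k) (f g : LineRing m) :
    f * (F.coord.a i * F.coord.a j * F.coord.b k) + g * (F.coord.a i * F.coord.b j * F.coord.b k) ∈
      F.three.coord.Q ↔ f * F.coord.a k + g * F.coord.b k ∈ F.three.coord.Q := by
  obtain ⟨σ, hσ⟩ := F.three.coord.exists_isParam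
  have hi : i ∈ ({i, j, k} : Finset (Fin m)) := by simp
  have hj : j ∈ ({i, j, k} : Finset (Fin m)) := by simp
  have hk : k ∈ ({i, j, k} : Finset (Fin m)) := by simp
  have a1 : σ (F.coord.a i) = _ := hσ.a hi
  have a2 : σ (F.coord.a j) = _ := hσ.a hj
  have a3 : σ (F.coord.a k) = _ := hσ.a hk
  have b2 : σ (F.coord.b j) = _ := hσ.b hj
  have b3 : σ (F.coord.b k) = _ := hσ.b hk
  rw [← hσ.ker_eq_Q, RingHom.mem_ker, RingHom.mem_ker]
  simp only [map_add, map_mul, a1, a2, a3, b2, b3]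
  constructor
  · intro h
    have h1 : (σ f * (MvPolynomial.X (Sum.inl 0) * MvPolynomial.X (Sum.inr k)) +
        σ g * (MvPolynomial.X (Sum.inl 1) * MvPolynomial.X (Sum.inr k))) *
        (MvPolynomial.X (Sum.inl 0) * MvPolynomial.X (Sum.inl 1) * MvPolynomial.X (Sum.inr i) *
          MvPolynomial.X (Sum.inr j)) = 0 := by
      rw [← h]; ring
    refine (mul_eq_zero.mp h1).resolve_right ?_
    simp
  · intro h
    have h1 : (σ f * (MvPolynomial.X (Sum.inl 0) * MvPolynomial.X (Sum.inr k)) +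
        σ g * (MvPolynomial.X (Sum.inl 1) * MvPolynomial.X (Sum.inr k))) *
        (MvPolynomial.X (Sum.inl 0) * MvPolynomial.X (Sum.inl 1) * MvPolynomial.X (Sum.inr i) *
          MvPolynomial.X (Sum.inr j)) = 0 := by
      rw [h, zero_mul]
    rw [← h1]; ring

lemma three_Q_mul_mem (F : X.Frame w {i, j, k, l} i j k) (hli : l ≠ i) (hlj : l ≠ j)
    (hlk : l ≠ k) (hn : F.n1 ≠ F.n2) {f : LineRing m} (hf : f ∈ F.three.coord.Q) :
    f * (F.coord.a i * F.coord.a j * F.coord.b k) ∈ X.IA w {i, j, k, l} := by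
  have hP : ∀ x, ∀ φ ∈ X.𝓛 w x, X.L x φ ∈ X.IA w {i, j, k, l} := fun x φ hφ => L_mem_IA hφ
  have hi : i ∈ ({i, j, k, l} : Finset (Fin m)) := by simp
  have hj : j ∈ ({i, j, k, l} : Finset (Fin m)) := by simp
  have hk : k ∈ ({i, j, k, l} : Finset (Fin m)) := by simp
  obtain ⟨r1, r2, r3, r4, r5, r6⟩ := F.rel_monomials I_le_IA hP hi hj hk
  obtain ⟨hm4, -, -⟩ := F.rel4 I_le_IA hP (by simp) hli hlj hlk hn
  suffices h : F.three.coord.Q ≤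
      (X.IA w {i, j, k, l}).colon {F.coord.a i * F.coord.a j * F.coord.b k} by
    have := h hf
    rwa [Submodule.mem_colon_singleton] at this
  refine Coord.Q_le (P_le_iff.mpr fun x φ hφ => ?_) fun x hx y hy => ?_ <;>
    rw [Submodule.mem_colon_singleton, smul_eq_mul]
  · by_cases hx : x ∈ ({i, j, k} : Finset (Fin m))
    · exact Ideal.mul_mem_right _ _ (hP _ _ (mem_onCols.mp hφ hx))
    by_cases hxl : x = l
    · subst hxl
      exact (hm4 φ).1
    · refine Ideal.mul_mem_right _ _ (L_mem_IA_of_notMem ?_ φ)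
      simp only [Finset.mem_insert, Finset.mem_singleton] at hx ⊢
      tauto
  · have hs : ∀ x y z, F.coord.br x y * z ∈ X.IA w {i, j, k, l} →
        F.coord.br y x * z ∈ X.IA w {i, j, k, l} := fun x y z h => by
      rw [show F.coord.br y x * z = -(F.coord.br x y * z) by rw [Coord.br, Coord.br]; ring]
      exact neg_mem h
    have h0 : ∀ x, F.coord.br x x = 0 := fun x => by rw [Coord.br]; ring
    change F.coord.br x y * _ ∈ _
    have h1 : F.coord.br i j * (F.coord.a i * F.coord.a j * F.coord.b k) ∈
        X.IA w {i, j, k, l} := by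
      convert Ideal.mul_mem_left _ (F.coord.a i * F.coord.a j) r6 using 1
      ring
    have h2 : F.coord.br i k * (F.coord.a i * F.coord.a j * F.coord.b k) ∈
        X.IA w {i, j, k, l} := by
      convert Ideal.mul_mem_left _ (F.coord.a i * F.coord.b k) r3 using 1
      ring
    have h3 : F.coord.br j k * (F.coord.a i * F.coord.a j * F.coord.b k) ∈
        X.IA w {i, j, k, l} := by
      convert Ideal.mul_mem_left _ (F.coord.a j * F.coord.b k) r1 using 1
      ring
    simp only [Finset.mem_insert, Finset.mem_singleton] at hx hy
    rcases hx with rfl | rfl | rfl <;> rcases hy with rfl | rfl | rfl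
    · rw [h0, zero_mul]; exact zero_mem _
    · exact h1
    · exact h2
    · exact hs _ _ _ h1
    · rw [h0, zero_mul]; exact zero_mem _
    · exact h3
    · exact hs _ _ _ h2
    · exact hs _ _ _ h3
    · rw [h0, zero_mul]; exact zero_mem _

lemma exists_correction (F : X.Frame w {i, j, k, l} i j k) (hli : l ≠ i) (hlj : l ≠ j)
    (hlk : l ≠ k) (hn : F.n1 ≠ F.n2) {g : LineRing m} (hg : g ∈ F.three.coord.M) :
    ∃ h, g * (F.coord.a i * F.coord.b j * F.coord.b k) -
      h * (F.coord.a i * F.coord.a j * F.coord.b k) ∈ X.IA w {i, j, k, l} ∧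
      h * F.coord.a k - g * F.coord.b k ∈ F.three.coord.Q := by
  have hP : ∀ x, ∀ φ ∈ X.𝓛 w x, X.L x φ ∈ X.IA w {i, j, k, l} := fun x φ hφ => L_mem_IA hφ
  have hi : i ∈ ({i, j, k, l} : Finset (Fin m)) := by simp
  have hj : j ∈ ({i, j, k, l} : Finset (Fin m)) := by simp
  have hk : k ∈ ({i, j, k, l} : Finset (Fin m)) := by simp
  obtain ⟨r1, r2, r3, r4, r5, r6⟩ := F.rel_monomials I_le_IA hP hi hj hk
  obtain ⟨hm4, -, -⟩ := F.rel4 I_le_IA hP (by simp) hli hlj hlk hn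
  let T : Ideal (LineRing m) :=
    { carrier := {g | ∃ h, g * (F.coord.a i * F.coord.b j * F.coord.b k) -
        h * (F.coord.a i * F.coord.a j * F.coord.b k) ∈ X.IA w {i, j, k, l} ∧
        h * F.coord.a k - g * F.coord.b k ∈ F.three.coord.Q}
      zero_mem' := ⟨0, by simp, by simp⟩
      add_mem' := by
        rintro g g' ⟨h, h1, h2⟩ ⟨h', h1', h2'⟩
        refine ⟨h + h', ?_, ?_⟩
        · convert Ideal.add_mem _ h1 h1' using 1; ring
        · convert Ideal.add_mem _ h2 h2' using 1; ring
      smul_mem' := by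
        rintro c g ⟨h, h1, h2⟩
        refine ⟨c * h, ?_, ?_⟩
        · convert Ideal.mul_mem_left _ c h1 using 1; rw [smul_eq_mul]; ring
        · convert Ideal.mul_mem_left _ c h2 using 1; rw [smul_eq_mul]; ring }
  suffices h : F.three.coord.M ≤ T from h hg
  refine Coord.M_le (P_le_iff.mpr fun x φ hφ => ⟨0, ?_, ?_⟩) fun x hx => ?_
  · rw [zero_mul, sub_zero]
    by_cases hx : x ∈ ({i, j, k} : Finset (Fin m))
    · exact Ideal.mul_mem_right _ _ (hP _ _ (mem_onCols.mp hφ hx))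
    by_cases hxl : x = l
    · subst hxl
      exact (hm4 φ).2.2.2.1
    · refine Ideal.mul_mem_right _ _ (L_mem_IA_of_notMem ?_ φ)
      simp only [Finset.mem_insert, Finset.mem_singleton] at hx ⊢
      tauto
  · rw [zero_mul, zero_sub, neg_mem_iff]
    exact Ideal.mul_mem_right _ _ (Coord.P_le_Q (L_mem_P hφ))
  · refine ⟨F.coord.b x, ?_, ?_⟩
    · change F.coord.a x * _ - _ ∈ _
      simp only [Coord.br] at r1 r2 r3 r4 r5 r6
      simp only [Finset.mem_insert, Finset.mem_singleton] at hx
      rcases hx with rfl | rfl | rfl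
      · convert Ideal.sub_mem _ (Ideal.mul_mem_left _ (F.coord.a x) r4)
          (Ideal.mul_mem_left _ (F.coord.a x) r2) using 1
        ring
      · convert zero_mem (X.IA w {i, x, k, l}) using 1
        ring
      · convert neg_mem (Ideal.mul_mem_left _ (F.coord.b x) r1) using 1
        ring
    · have h := (F.three.coord).br_mem_Q hx (show k ∈ ({i, j, k} : Finset (Fin m)) by simp)
      convert neg_mem h using 1
      change _ - F.coord.a x * _ = -(F.coord.a x * F.coord.b k - F.coord.b x * F.coord.a k)
      ring

lemma good_IA_four (hw : X.GoodW w) (F : X.Frame w {i, j, k, l} i j k) (hli : l ≠ i)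
    (hlj : l ≠ j) (hlk : l ≠ k) (hn : F.n1 ≠ F.n2)
    (hA : ∀ A' ⊂ ({i, j, k, l} : Finset (Fin m)),
      Good (X.vanish w S) (min 4 (2 * A'.card)) (X.IA w A')) :
    Good (X.vanish w S) 4 (X.IA w {i, j, k, l}) := by
  have hP : ∀ x, ∀ φ ∈ X.𝓛 w x, X.L x φ ∈ X.IA w {i, j, k, l} := fun x φ hφ => L_mem_IA hφ
  have hi : i ∈ ({i, j, k, l} : Finset (Fin m)) := by simp
  have hj : j ∈ ({i, j, k, l} : Finset (Fin m)) := by simp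
  have hk : k ∈ ({i, j, k, l} : Finset (Fin m)) := by simp
  have hsub : ({i, j, k} : Finset (Fin m)) ⊆ {i, j, k, l} := by
    intro t ht
    simp only [Finset.mem_insert, Finset.mem_singleton] at ht ⊢
    tauto
  have hM := F.le_M (S := S) hw hli hlj hlk
  have hMp := Coord.M_isPrime (e := F.coord)
  have hMp' := Coord.M_isPrime (e := F.coord.swap)
  have hIM : X.IA w {i, j, k, l} ≤ F.coord.M :=
    sup_le (le_sup_left.trans hM.1) Coord.P_le_M
  have hIM' : X.IA w {i, j, k, l} ≤ F.coord.swap.M :=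
    sup_le (le_sup_left.trans hM.2) Coord.P_le_M
  have ha : ∀ x, F.coord.a x ∈ F.coord.M := Coord.a_mem_M
  have hb : ∀ x, F.coord.b x ∈ F.coord.swap.M := Coord.a_mem_M (e := F.coord.swap)
  have hcard := F.card_four hli hlj hlk
  have hc3 : ({i, j, k} : Finset (Fin m)).card = 3 :=
    Finset.card_eq_three.mpr ⟨i, j, k, F.hij, F.hik, F.hjk, rfl⟩
  obtain ⟨r1, r2, r3, r4, r5, r6⟩ := F.rel_monomials I_le_IA hP hi hj hk
  obtain ⟨hm4, hal, hbl⟩ := F.rel4 I_le_IA hP (by simp) hli hlj hlk hn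
  have hK := good_K (B := {i, j, k}) _ hA (by simp) hsub
  rw [hcard, hc3, F.K_le_monomials] at hK
  have hy1 : F.coord.a i * F.coord.a j * F.coord.b k ∈ Ideal.span
      {F.coord.a i * F.coord.a j * F.coord.b k, F.coord.a i * F.coord.b j * F.coord.b k} :=
    Ideal.subset_span (by simp)
  have hy2 : F.coord.a i * F.coord.b j * F.coord.b k ∈ Ideal.span
      {F.coord.a i * F.coord.a j * F.coord.b k, F.coord.a i * F.coord.b j * F.coord.b k} :=
    Ideal.subset_span (by simp)
  have hQJ : X.IA w {i, j, k, l} ≤ F.three.coord.Q :=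
    sup_le (le_sup_left.trans (F.three.le_Q (S := ∅) hw))
      ((P_mono fun x φ hφ => mem_onCols.mpr fun hx => mem_onCols.mp hφ (hsub hx)).trans
        Coord.P_le_Q)
  have hk3 : k ∈ ({i, j, k} : Finset (Fin m)) := by simp
  refine Good.of_same_syzygies (n := 3) (Q := F.three.coord.Q) (a := F.coord.a k)
    (b := F.coord.b k) hQJ (fun f g hfg => ?_) F.three_Q_syzygy (F.three.good_Q hw) ?_ ?_
  · have hQ := F.three.coord.Q_isPrime
    have hM3 := Coord.M_isPrime (e := F.three.coord)
    have h1 := (F.three_Q_syzygy f g).mp hfg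
    have hg : g ∈ F.three.coord.M := by
      have h2 := Coord.Q_le_M h1
      have h3 : f * F.coord.a k ∈ F.three.coord.M :=
        Ideal.mul_mem_left _ _ (Coord.a_mem_M (e := F.three.coord) k)
      exact (hM3.mem_or_mem ((Ideal.add_mem_iff_right _ h3).mp h2)).resolve_right
        (Coord.b_notMem_M (e := F.three.coord) hk3)
    obtain ⟨h, hh1, hh2⟩ := F.exists_correction hli hlj hlk hn hg
    have h3 : (f + h) * F.coord.a k ∈ F.three.coord.Q := by
      convert Ideal.add_mem _ h1 hh2 using 1; ring
    have h4 := F.three_Q_mul_mem hli hlj hlk hn ((hQ.mem_or_mem h3).resolve_right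
      (Coord.a_notMem_Q (e := F.three.coord) hk3))
    convert Ideal.add_mem _ hh1 h4 using 1; ring
  · have h := Coord.depthGE_Q (e := F.three.coord.restrict (Finset.erase_subset k _))
      ⟨i, Finset.mem_erase.mpr ⟨F.hik, by simp⟩⟩
    rw [← Coord.Q_sup_eq k, Finset.card_erase_of_mem hk3, hc3, sup_assoc, ← Ideal.span_union,
      Set.singleton_union] at h
    exact h
  refine Good.of_colon_prime (P := F.coord.swap.M)
    (x := F.coord.a i * F.coord.a j * F.coord.a k) (sup_le hIM' ?_) ?_ ?_
    ⟨by have h := Coord.depthGE_M (e := F.coord.swap); rwa [hcard] at h, le_sup_right.trans hM.2⟩ ?_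
  · rw [Ideal.span_le]
    rintro _ (rfl | rfl)
    · exact Ideal.mul_mem_left _ _ (hb k)
    · exact Ideal.mul_mem_left _ _ (hb k)
  · intro h
    have hx : ∀ x ∈ ({i, j, k, l} : Finset (Fin m)), F.coord.a x ∉ F.coord.swap.M :=
      fun x hx => Coord.b_notMem_M (e := F.coord.swap) hx
    rcases hMp'.mem_or_mem h with h | h
    · exact (hMp'.mem_or_mem h).elim (hx i hi) (hx j hj)
    · exact hx k hk h
  · refine mem_of_M_le_colon (e := F.coord.swap) (P_le_IA.trans le_sup_left) fun x hx => ?_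
    change F.coord.b x * _ ∈ _
    simp only [Finset.mem_insert, Finset.mem_singleton] at hx
    simp only [Coord.br] at r1 r2 r3 r4 r5 r6
    generalize hJ : X.IA w {i, j, k, l} ⊔ _ = J at *
    have hJ1 : X.IA w {i, j, k, l} ≤ J := hJ ▸ le_sup_left
    have hJ2 : F.coord.a i * F.coord.a j * F.coord.b k ∈ J := hJ ▸ Ideal.mem_sup_right hy1
    rcases hx with rfl | rfl | rfl | rfl
    · convert J.mul_mem_left (F.coord.a x) (J.sub_mem hJ2 (hJ1 r3)) using 1; ring
    · convert J.mul_mem_left (F.coord.a x) (J.sub_mem hJ2 (hJ1 r1)) using 1; ring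
    · convert J.mul_mem_left (F.coord.a x) hJ2 using 1; ring
    · exact hJ1 hbl
  refine Good.of_colon_prime (P := F.coord.M)
    (x := F.coord.b i * F.coord.b j * F.coord.b k) (sup_le (sup_le hIM ?_) ?_) ?_ ?_
    ⟨by have h := Coord.depthGE_M (e := F.coord); rwa [hcard] at h, le_sup_right.trans hM.1⟩ hK
  · rw [Ideal.span_le]
    rintro _ (rfl | rfl) <;>
      exact Ideal.mul_mem_right _ _ (Ideal.mul_mem_right _ _ (ha i))
  · rw [Ideal.span_singleton_le_iff_mem]
    exact Ideal.mul_mem_right _ _ (Ideal.mul_mem_right _ _ (ha i))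
  · intro h
    have hx : ∀ x ∈ ({i, j, k, l} : Finset (Fin m)), F.coord.b x ∉ F.coord.M :=
      fun x hx => Coord.b_notMem_M hx
    rcases hMp.mem_or_mem h with h | h
    · exact (hMp.mem_or_mem h).elim (hx i hi) (hx j hj)
    · exact hx k hk h
  · refine mem_of_M_le_colon (e := F.coord) (P_le_IA.trans (le_sup_left.trans le_sup_left))
      fun x hx => ?_
    simp only [Finset.mem_insert, Finset.mem_singleton] at hx
    simp only [Coord.br] at r1 r2 r3 r4 r5 r6
    generalize hJ : X.IA w {i, j, k, l} ⊔ _ ⊔ _ = J at *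
    have hJ1 : X.IA w {i, j, k, l} ≤ J := hJ ▸ le_sup_left.trans le_sup_left
    have hJ2 : F.coord.a i * F.coord.b j * F.coord.b k ∈ J :=
      hJ ▸ Ideal.mem_sup_left (Ideal.mem_sup_right hy2)
    rcases hx with rfl | rfl | rfl | rfl
    · convert J.mul_mem_left (F.coord.b x) hJ2 using 1; ring
    · convert J.mul_mem_left (F.coord.b x) (J.add_mem (J.sub_mem hJ2 (hJ1 r4)) (hJ1 r2)) using 1
      ring
    · convert J.mul_mem_left (F.coord.b x) (J.sub_mem hJ2 (hJ1 r4)) using 1; ring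
    · exact hJ1 hal

end Frame

/-- The depth estimate for all the ideals `IA`. -/
theorem good_IA (hw : X.GoodW w) (hm : 2 ≤ m) (A : Finset (Fin m)) :
    Good (X.vanish w S) (min 4 (2 * A.card)) (X.IA w A) := by
  induction A using Finset.strongInduction with
  | H A ih =>
    rcases Nat.lt_or_ge A.card 3 with h2 | h3
    · exact (good_IA_of_card_le_two hw hm (by omega)).mono (by omega)
    rcases Nat.lt_or_ge A.card 5 with h4 | h5
    · rcases Nat.lt_or_ge A.card 4 with h3' | h4'
      · obtain ⟨i, j, k, hij, hik, hjk, rfl⟩ := Finset.card_eq_three.mp (by omega : A.card = 3)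
        obtain ⟨F⟩ := hw.triple i j k hij hik hjk
        exact (F.good_IA_three hw hm).mono (by omega)
      · obtain ⟨l, A', hl, rfl, hA'⟩ := Finset.card_eq_succ.mp (by omega : A.card = 3 + 1)
        obtain ⟨i, j, k, hij, hik, hjk, rfl⟩ := Finset.card_eq_three.mp hA'
        simp only [Finset.mem_insert, Finset.mem_singleton, not_or] at hl
        obtain ⟨F, hF⟩ := hw.quad i j k l hij hik hjk hl.1 hl.2.1 hl.2.2
        have hset : insert l {i, j, k} = ({i, j, k, l} : Finset (Fin m)) := by
          ext; simp; tauto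
        rw [hset] at ih ⊢
        exact (F.good_IA_four hw hl.1 hl.2.1 hl.2.2 hF ih).mono (by omega)
    · obtain ⟨B, hBA, hB⟩ := Finset.exists_subset_card_eq h5
      rw [IA_eq_K hw hB]
      exact (good_K A ih (Finset.card_pos.mp (by omega)) hBA).mono (by omega)

end CameraData

namespace CameraData

variable {m : ℕ} {X : CameraData m} {w : Fin m → Vec4} {S T : Finset (Fin m)}
  {u v : Vec4 →ₗ[ℂ] ℂ} {i j k l : Fin m}

variable (X w) in
/-- The determinant of a pair of functionals on the plane `𝓛 j`. -/
def pen (u v : Vec4 →ₗ[ℂ] ℂ) (j : Fin m) : ℂ := u (X.c j) * v (w j) - v (X.c j) * u (w j)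

lemma wedge_eq_zero_of_pen (h : X.pen w u v j = 0) {φ ψ : Vec4} (hφ : φ ∈ X.𝓛 w j)
    (hψ : ψ ∈ X.𝓛 w j) : u φ * v ψ - v φ * u ψ = 0 := by
  obtain ⟨a, b, rfl⟩ := Submodule.mem_span_pair.mp hφ
  obtain ⟨a', b', rfl⟩ := Submodule.mem_span_pair.mp hψ
  simp only [map_add, map_smul, smul_eq_mul]
  rw [pen] at h
  linear_combination (a * b' - b * a') * h

lemma exists_combination (h : X.pen w u v j = 0) :
    ∃ α β : ℂ, (α ≠ 0 ∨ β ≠ 0) ∧ ∀ φ ∈ X.𝓛 w j, α * u φ + β * v φ = 0 := by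
  have key : ∀ α β : ℂ, α * u (X.c j) + β * v (X.c j) = 0 → α * u (w j) + β * v (w j) = 0 →
      ∀ φ ∈ X.𝓛 w j, α * u φ + β * v φ = 0 := by
    intro α β h1 h2 φ hφ
    obtain ⟨a, b, rfl⟩ := Submodule.mem_span_pair.mp hφ
    simp only [map_add, map_smul, smul_eq_mul]
    linear_combination a * h1 + b * h2
  rw [pen] at h
  by_cases h1 : v (X.c j) ≠ 0 ∨ -u (X.c j) ≠ 0
  · exact ⟨_, _, h1, key _ _ (by ring) (by linear_combination -h)⟩
  · push Not at h1
    by_cases h2 : v (w j) ≠ 0 ∨ -u (w j) ≠ 0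
    · exact ⟨_, _, h2, key _ _ (by linear_combination h) (by ring)⟩
    · push Not at h2
      exact ⟨1, 0, Or.inl one_ne_zero, key _ _ (by linear_combination -h1.2)
        (by linear_combination -h2.2)⟩

lemma exists_mem_ker (h : X.pen w u v j = 0) :
    ∃ a b : ℂ, (a ≠ 0 ∨ b ≠ 0) ∧ u (a • X.c j + b • w j) = 0 ∧ v (a • X.c j + b • w j) = 0 := by
  simp only [map_add, map_smul, smul_eq_mul]
  rw [pen] at h
  by_cases h1 : u (w j) ≠ 0 ∨ -u (X.c j) ≠ 0
  · exact ⟨_, _, h1, by ring, by linear_combination -h⟩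
  · push Not at h1
    by_cases h2 : v (w j) ≠ 0 ∨ -v (X.c j) ≠ 0
    · exact ⟨_, _, h2, by linear_combination h, by ring⟩
    · push Not at h2
      exact ⟨1, 0, Or.inl one_ne_zero, by linear_combination -h1.2, by linear_combination -h2.2⟩

lemma linearIndependent_c_w (hw : X.GoodW w) (j : Fin m) :
    LinearIndependent ℂ ![X.c j, w j] := by
  rw [linearIndependent_iff_card_eq_finrank_span, Set.finrank, Matrix.range_cons, Matrix.range_cons,
    Matrix.range_empty, Set.union_empty, Set.singleton_union, ← 𝓛, hw.finrank, Fintype.card_fin]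

lemma meets_of_pen (hw : X.GoodW w) (h : X.pen w u v j = 0) :
    X.Meets w (LinearMap.ker u ⊓ LinearMap.ker v) j := by
  obtain ⟨a, b, hab, h1, h2⟩ := exists_mem_ker h
  refine ⟨_, ⟨h1, h2⟩, Submodule.mem_span_pair.mpr ⟨a, b, rfl⟩, fun h0 => ?_⟩
  obtain ⟨rfl, rfl⟩ := LinearIndependent.pair_iff.mp (linearIndependent_c_w hw j) a b h0
  simp at hab

lemma finrank_ker_inf_ker {φ ψ : Vec4} (h : u φ * v ψ - v φ * u ψ ≠ 0) :
    Module.finrank ℂ (LinearMap.ker u ⊓ LinearMap.ker v : Submodule ℂ Vec4) = 2 := by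
  have hs : Function.Surjective (u.prod v) := by
    rintro ⟨x, y⟩
    refine ⟨((x * v ψ - y * u ψ) / (u φ * v ψ - v φ * u ψ)) • φ +
      ((u φ * y - v φ * x) / (u φ * v ψ - v φ * u ψ)) • ψ, ?_⟩
    ext
    · change u _ = x
      simp only [map_add, map_smul, smul_eq_mul]
      rw [div_mul_eq_mul_div, div_mul_eq_mul_div, ← add_div, div_eq_iff h]
      ring
    · change v _ = y
      simp only [map_add, map_smul, smul_eq_mul]
      rw [div_mul_eq_mul_div, div_mul_eq_mul_div, ← add_div, div_eq_iff h]
      ring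
  have h1 := LinearMap.finrank_range_add_finrank_ker (u.prod v)
  rw [LinearMap.range_eq_top.mpr hs, LinearMap.ker_prod, finrank_top] at h1
  simp at h1
  omega

lemma exists_pen_ne_zero {u' v' : Vec4 →ₗ[ℂ] ℂ} (h : X.pen w u' v' j ≠ 0) (u v : Vec4 →ₗ[ℂ] ℂ) :
    ∃ t : ℂ, X.pen w (u + t • u') (v + t • v') j ≠ 0 := by
  by_contra! h0
  have h1 := h0 0
  have h2 := h0 1
  have h3 := h0 (-1)
  simp only [pen, LinearMap.add_apply, LinearMap.smul_apply, smul_eq_mul] at h h1 h2 h3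
  exact h (by linear_combination (h2 + h3 - 2 * h1) / 2)

variable (X w) in
/-- The pencil `⟨u, v⟩` can be deformed along a line of pencils satisfying the same incidence
conditions at `T` but not the one at `j`. -/
def Moves (u v : Vec4 →ₗ[ℂ] ℂ) (T : Finset (Fin m)) (j : Fin m) : Prop :=
  ∃ (u₀ v₀ u₁ v₁ : Vec4 →ₗ[ℂ] ℂ) (κ : ℂ),
    (∀ φ ψ, u φ * v ψ - v φ * u ψ = κ * (u₀ φ * v₀ ψ - v₀ φ * u₀ ψ)) ∧
    (∀ i ∈ T, ∀ t : ℂ, X.pen w (u₀ + t • u₁) (v₀ + t • v₁) i = 0) ∧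
    ∃ t : ℂ, X.pen w (u₀ + t • u₁) (v₀ + t • v₁) j ≠ 0

lemma Moves.change {u' v' : Vec4 →ₗ[ℂ] ℂ} {κ : ℂ}
    (h : ∀ φ ψ, u φ * v ψ - v φ * u ψ = κ * (u' φ * v' ψ - v' φ * u' ψ))
    (hm : X.Moves w u' v' T j) : X.Moves w u v T j := by
  obtain ⟨u₀, v₀, u₁, v₁, κ', h1, h2, h3⟩ := hm
  exact ⟨u₀, v₀, u₁, v₁, κ * κ', fun φ ψ => by rw [h, h1, mul_assoc], h2, h3⟩

/-- Any pencil meeting `𝓛 i` has a basis whose first vector vanishes on `𝓛 i`. -/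
lemma exists_change (h : X.pen w u v i = 0) : ∃ (u' v' : Vec4 →ₗ[ℂ] ℂ) (κ : ℂ),
    (∀ φ ψ, u φ * v ψ - v φ * u ψ = κ * (u' φ * v' ψ - v' φ * u' ψ)) ∧ ∀ φ ∈ X.𝓛 w i, u' φ = 0 := by
  obtain ⟨α, β, hαβ, h1⟩ := exists_combination h
  rcases hαβ with h0 | h0
  · refine ⟨α • u + β • v, v, 1 / α, fun φ ψ => ?_, h1⟩
    simp only [LinearMap.add_apply, LinearMap.smul_apply, smul_eq_mul]
    field_simp
    ring
  · refine ⟨α • u + β • v, u, -1 / β, fun φ ψ => ?_, h1⟩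
    simp only [LinearMap.add_apply, LinearMap.smul_apply, smul_eq_mul]
    field_simp
    ring

lemma exists_functional {K : Submodule ℂ Vec4} {x : Vec4} (hx : x ∉ K) :
    ∃ f : Vec4 →ₗ[ℂ] ℂ, (∀ y ∈ K, f y = 0) ∧ f x ≠ 0 := by
  obtain ⟨f, h1, h2⟩ := Submodule.exists_le_ker_of_notMem hx
  exact ⟨f, fun y hy => h2 hy, h1⟩

lemma w_notMem_span_c (hw : X.GoodW w) (j : Fin m) : w j ∉ Submodule.span ℂ {X.c j} := by
  intro h
  obtain ⟨a, ha⟩ := Submodule.mem_span_singleton.mp h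
  have := LinearIndependent.pair_iff.mp (linearIndependent_c_w hw j) a (-1) (by simp [ha])
  simp at this

lemma pen_eq_zero_of_left (h : ∀ φ ∈ X.𝓛 w j, u φ = 0) : X.pen w u v j = 0 := by
  rw [pen, h _ (c_mem_𝓛 j), h _ (w_mem_𝓛 j)]; ring

lemma pen_eq_zero_of_right (h : ∀ φ ∈ X.𝓛 w j, v φ = 0) : X.pen w u v j = 0 := by
  rw [pen, h _ (c_mem_𝓛 j), h _ (w_mem_𝓛 j)]; ring

lemma moves_empty (hw : X.GoodW w) (u v : Vec4 →ₗ[ℂ] ℂ) : X.Moves w u v ∅ j := by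
  obtain ⟨v', h1, h2⟩ := exists_functional (w_notMem_span_c hw j)
  obtain ⟨u', -, h3⟩ := exists_functional (K := ⊥) (x := X.c j) (by simpa using c_ne_zero j)
  refine ⟨u, v, u', v', 1, by simp, by simp, exists_pen_ne_zero ?_ u v⟩
  rw [pen, h1 _ (Submodule.mem_span_singleton_self _)]
  simpa using ⟨h3, h2⟩

lemma moves_singleton (hw : X.GoodW w) (hij : i ≠ j) (h : X.pen w u v i = 0) :
    X.Moves w u v {i} j := by
  obtain ⟨u, v, κ, hκ, hu⟩ := exists_change h
  refine Moves.change hκ ?_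
  obtain ⟨v', h1, h2⟩ := exists_functional (w_notMem_span_c hw j)
  obtain ⟨u', h4, h3⟩ := exists_functional (c_notMem_𝓛 hw hij.symm)
  refine ⟨u, v, u', v', 1, by simp, ?_, exists_pen_ne_zero ?_ u v⟩
  · intro x hx t
    obtain rfl := Finset.mem_singleton.mp hx
    exact pen_eq_zero_of_left fun φ hφ => by simp [hu φ hφ, h4 φ hφ]
  · rw [pen, h1 _ (Submodule.mem_span_singleton_self _)]
    simpa using ⟨h3, h2⟩

/-- A pencil meeting two disjoint planes has a basis vanishing on each of them. -/
lemma exists_change_pair (hw : X.GoodW w) (hij : i ≠ j) (hi : X.pen w u v i = 0)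
    (hj : X.pen w u v j = 0) (hind : ∃ φ ψ, u φ * v ψ - v φ * u ψ ≠ 0) :
    ∃ (u' v' : Vec4 →ₗ[ℂ] ℂ) (κ : ℂ), κ ≠ 0 ∧
    (∀ φ ψ, u φ * v ψ - v φ * u ψ = κ * (u' φ * v' ψ - v' φ * u' ψ)) ∧
      (∀ φ ∈ X.𝓛 w i, u' φ = 0) ∧ ∀ φ ∈ X.𝓛 w j, v' φ = 0 := by
  obtain ⟨u', v', κ, hκ, hu⟩ := exists_change hi
  obtain ⟨φ₀, ψ₀, h0⟩ := hind
  rw [hκ] at h0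
  have hκ0 : κ ≠ 0 := left_ne_zero_of_mul h0
  have hj' : X.pen w u' v' j = 0 := by
    rw [pen, hκ] at hj
    exact (mul_eq_zero.mp hj).resolve_left hκ0
  obtain ⟨α, β, hαβ, h1⟩ := exists_combination hj'
  have hβ : β ≠ 0 := by
    rintro rfl
    have hα : α ≠ 0 := by simpa using hαβ
    have h2 : ∀ φ ∈ X.𝓛 w j, u' φ = 0 := fun φ hφ => by simpa [hα] using h1 φ hφ
    have h3 : X.𝓛 w i ⊔ X.𝓛 w j ≤ LinearMap.ker u' := sup_le hu h2
    have h4 : X.𝓛 w i ⊔ X.𝓛 w j = ⊤ := by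
      apply Submodule.eq_top_of_finrank_eq
      have := Submodule.finrank_sup_add_finrank_inf_eq (X.𝓛 w i) (X.𝓛 w j)
      rw [(hw.pair i j hij).eq_bot, hw.finrank, hw.finrank, finrank_bot] at this
      simpa using this
    rw [h4] at h3
    exact h0 (by rw [show u' φ₀ = 0 from h3 trivial, show u' ψ₀ = 0 from h3 trivial]; ring)
  refine ⟨u', α • u' + β • v', κ / β, div_ne_zero hκ0 hβ, fun φ ψ => ?_, hu, h1⟩
  rw [hκ]
  simp only [LinearMap.add_apply, LinearMap.smul_apply, smul_eq_mul]
  field_simp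
  ring

lemma Frame.eq_of_vanish_i (F : X.Frame w T i j k) (hu : ∀ φ ∈ X.𝓛 w i, u φ = 0) :
    u = u (F.e 0) • F.e.coord 0 + u (F.e 1) • F.e.coord 1 := by
  refine F.e.ext fun r => ?_
  fin_cases r
  · simp
  · simp
  · simpa using hu (F.e 2) ((F.hi _).mpr (by simp))
  · simpa using hu (F.e 3) ((F.hi _).mpr (by simp))

lemma Frame.eq_of_vanish_j (F : X.Frame w T i j k) (hu : ∀ φ ∈ X.𝓛 w j, u φ = 0) :
    u = u (F.e 2) • F.e.coord 2 + u (F.e 3) • F.e.coord 3 := by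
  refine F.e.ext fun r => ?_
  fin_cases r
  · simpa using hu (F.e 0) ((F.hj _).mpr (by simp))
  · simpa using hu (F.e 1) ((F.hj _).mpr (by simp))
  · simp
  · simp

lemma moves_pair (hw : X.GoodW w) (hij : i ≠ j) (hik : i ≠ k) (hjk : j ≠ k)
    (hi : X.pen w u v i = 0) (hj : X.pen w u v j = 0)
    (hind : ∃ φ ψ, u φ * v ψ - v φ * u ψ ≠ 0) : X.Moves w u v {i, j} k := by
  obtain ⟨u, v, κ, -, hκ, hu, hv⟩ := exists_change_pair hw hij hi hj hind
  refine Moves.change hκ ?_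
  obtain ⟨F⟩ := hw.triple i j k hij hik hjk
  refine ⟨u, v, F.e.coord 0, F.e.coord 3, 1, by simp, ?_, exists_pen_ne_zero ?_ u v⟩
  · intro x hx t
    rcases Finset.mem_insert.mp hx with rfl | hx
    · exact pen_eq_zero_of_left fun φ hφ => by
        rw [LinearMap.add_apply, LinearMap.smul_apply, hu φ hφ, ((F.hi φ).mp hφ).1]; simp
    · obtain rfl := Finset.mem_singleton.mp hx
      exact pen_eq_zero_of_right fun φ hφ => by
        rw [LinearMap.add_apply, LinearMap.smul_apply, hv φ hφ, ((F.hj φ).mp hφ).2]; simp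
  · intro h
    have := wedge_eq_zero_of_pen h (φ := F.e 0 - F.e 2) (ψ := F.e 1 - F.e 3)
      ((F.hk _).mpr (by simp)) ((F.hk _).mpr (by simp))
    simp at this

lemma moves_triple (hw : X.GoodW w) (hij : i ≠ j) (hik : i ≠ k) (hjk : j ≠ k)
    (hli : l ≠ i) (hlj : l ≠ j) (hlk : l ≠ k)
    (hi : X.pen w u v i = 0) (hj : X.pen w u v j = 0) (hk : X.pen w u v k = 0)
    (hind : ∃ φ ψ, u φ * v ψ - v φ * u ψ ≠ 0) : X.Moves w u v {i, j, k} l := by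
  obtain ⟨u', v', κ, hκ0, hκ, hu, hv⟩ := exists_change_pair hw hij hi hj hind
  refine Moves.change hκ ?_
  obtain ⟨φ₀, ψ₀, h0⟩ := hind
  rw [hκ] at h0
  rw [pen, hκ] at hk
  have hk' : X.pen w u' v' k = 0 := (mul_eq_zero.mp hk).resolve_left hκ0
  obtain ⟨F, hF⟩ := hw.quad i j k l hij hik hjk hli hlj hlk
  obtain ⟨a, b, rfl⟩ : ∃ a b : ℂ, u' = a • F.e.coord 0 + b • F.e.coord 1 :=
    ⟨_, _, F.eq_of_vanish_i hu⟩
  obtain ⟨p, q, rfl⟩ : ∃ p q : ℂ, v' = p • F.e.coord 2 + q • F.e.coord 3 :=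
    ⟨_, _, F.eq_of_vanish_j hv⟩
  have hk1 := wedge_eq_zero_of_pen hk' (φ := F.e 0 - F.e 2) (ψ := F.e 1 - F.e 3)
    ((F.hk _).mpr (by simp)) ((F.hk _).mpr (by simp))
  simp at hk1
  obtain ⟨c, hc, rfl, rfl⟩ : ∃ c : ℂ, c ≠ 0 ∧ p = c * a ∧ q = c * b := by
    have hab : a ≠ 0 ∨ b ≠ 0 := by
      by_contra! h
      simp [h.1, h.2] at h0
    rcases hab with ha | hb
    · have h1 : p = p / a * a := by field_simp
      have h2 : q = p / a * b := by field_simp; linear_combination -hk1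
      refine ⟨p / a, fun h => ?_, h1, h2⟩
      rw [h, zero_mul] at h1 h2
      simp [h1, h2] at h0
    · have h2 : q = q / b * b := by field_simp
      have h1 : p = q / b * a := by field_simp; linear_combination hk1
      refine ⟨q / b, fun h => ?_, h1, h2⟩
      rw [h, zero_mul] at h1 h2
      simp [h1, h2] at h0
  refine ⟨_, _, F.e.coord 0 + F.e.coord 1, c • F.e.coord 2 + c • F.e.coord 3, 1,
    fun φ ψ => (one_mul _).symm, ?_, exists_pen_ne_zero ?_ _ _⟩
  · intro x hx t
    simp only [Finset.mem_insert, Finset.mem_singleton] at hx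
    rcases hx with rfl | rfl | rfl
    · refine pen_eq_zero_of_left fun φ hφ => ?_
      have := (F.hi φ).mp hφ
      simp only [LinearMap.add_apply, LinearMap.smul_apply, this.1, this.2]; simp
    · refine pen_eq_zero_of_right fun φ hφ => ?_
      have := (F.hj φ).mp hφ
      simp only [LinearMap.add_apply, LinearMap.smul_apply, this.1, this.2]; simp
    · have h1 := (F.hk _).mp (c_mem_𝓛 (X := X) (w := w) x)
      have h2 := (F.hk _).mp (w_mem_𝓛 (X := X) (w := w) x)
      simp only [pen, LinearMap.add_apply, LinearMap.smul_apply, eq_neg_of_add_eq_zero_right h1.1,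
        eq_neg_of_add_eq_zero_right h1.2, eq_neg_of_add_eq_zero_right h2.1,
        eq_neg_of_add_eq_zero_right h2.2, smul_eq_mul]
      ring
  · intro h
    have := wedge_eq_zero_of_pen h (φ := F.n1 • F.e 0 - F.e 2) (ψ := F.n2 • F.e 1 - F.e 3)
      ((F.other l (by simp) hli hlj hlk _).mpr (by simp))
      ((F.other l (by simp) hli hlj hlk _).mpr (by simp))
    simp at this
    exact (mul_ne_zero hc (sub_ne_zero.mpr hF)) (by linear_combination -this)

lemma moves (hw : X.GoodW w) (hT : ∀ i ∈ T, X.pen w u v i = 0) (hj : j ∉ T)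
    (hind : ∃ φ ψ, u φ * v ψ - v φ * u ψ ≠ 0) : X.Moves w u v T j := by
  by_cases h0 : X.pen w u v j = 0
  swap
  · exact ⟨u, v, 0, 0, 1, by simp, by simpa using hT, 0, by simpa using h0⟩
  have hne : ∀ i ∈ T, i ≠ j := fun i hi h => hj (h ▸ hi)
  rcases Nat.lt_or_ge T.card 4 with h4 | h4
  · rcases (by omega : T.card = 0 ∨ T.card = 1 ∨ T.card = 2 ∨ T.card = 3) with h | h | h | h
    · obtain rfl := Finset.card_eq_zero.mp h
      exact moves_empty hw u v
    · obtain ⟨a, rfl⟩ := Finset.card_eq_one.mp h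
      exact moves_singleton hw (hne a (by simp)) (hT a (by simp))
    · obtain ⟨a, b, hab, rfl⟩ := Finset.card_eq_two.mp h
      exact moves_pair hw hab (hne a (by simp)) (hne b (by simp)) (hT a (by simp)) (hT b (by simp))
        hind
    · obtain ⟨a, b, c, hab, hac, hbc, rfl⟩ := Finset.card_eq_three.mp h
      exact moves_triple hw hab hac hbc (hne a (by simp)).symm (hne b (by simp)).symm
        (hne c (by simp)).symm (hT a (by simp)) (hT b (by simp)) (hT c (by simp)) hind
  · exfalso
    obtain ⟨T', hT', hc⟩ := Finset.exists_subset_card_eq h4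
    obtain ⟨φ, ψ, hφ⟩ := hind
    refine hw.quint _ (finrank_ker_inf_ker hφ) (insert j T')
      (by rw [Finset.card_insert_of_notMem fun h => hj (hT' h), hc]) fun x hx => ?_
    rcases Finset.mem_insert.mp hx with rfl | hx
    · exact meets_of_pen hw h0
    · exact meets_of_pen hw (hT x (hT' hx))

end CameraData

namespace CameraData

variable {m : ℕ} {X : CameraData m} {w : Fin m → Vec4} {S T : Finset (Fin m)}
  {u v : Vec4 →ₗ[ℂ] ℂ} {i j k l : Fin m}

/-- A point with an independent presentation, whose condition at `S` only involves `T`. -/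
lemma apply_eq_zero_of_moves {g : LineRing m →ₐ[ℂ] ℂ} {s : Fin m → ℂ}
    (hg : ∀ i φ, g (X.L i φ) = s i * (u (X.c i) * v φ - v (X.c i) * u φ))
    (hT : ∀ i ∈ S, i ∉ T → s i = 0) (hj : j ∉ S) (hm : X.Moves w u v T j) {f : LineRing m}
    (hf : f * X.L j (w j) ∈ X.vanish w S) : g f = 0 := by
  obtain ⟨u₀, v₀, u₁, v₁, κ, hκ, hT', t₀, ht₀⟩ := hm
  let U : Vec4 →ₗ[ℂ] Polynomial ℂ :=
    (Algebra.linearMap ℂ (Polynomial ℂ)).comp u₀ +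
      (LinearMap.mulLeft ℂ Polynomial.X).comp ((Algebra.linearMap ℂ (Polynomial ℂ)).comp u₁)
  let V : Vec4 →ₗ[ℂ] Polynomial ℂ :=
    (Algebra.linearMap ℂ (Polynomial ℂ)).comp v₀ +
      (LinearMap.mulLeft ℂ Polynomial.X).comp ((Algebra.linearMap ℂ (Polynomial ℂ)).comp v₁)
  let q : Fin m → Polynomial ℂ := fun i =>
    Polynomial.C (κ * s i) + if i = j then Polynomial.X else 0
  obtain ⟨G, hG⟩ := X.exists_lift (B := Polynomial ℂ)
    (fun i => q i • (U (X.c i) • V - V (X.c i) • U)) (fun i => by simp; right; ring)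
  have hU : ∀ φ t, (U φ).eval t = (u₀ + t • u₁) φ := fun φ t => by simp [U]; ring
  have hV : ∀ φ t, (V φ).eval t = (v₀ + t • v₁) φ := fun φ t => by simp [V]; ring
  let ev : ℂ → Polynomial ℂ →ₐ[ℂ] ℂ := fun t => Polynomial.aeval t
  have hev : ∀ t p, ev t p = p.eval t := fun t p => by simp [ev, Polynomial.aeval_def]
  have hGt : ∀ t i φ, ((ev t).comp G) (X.L i φ) = (q i).eval t *
      ((u₀ + t • u₁) (X.c i) * (v₀ + t • v₁) φ - (v₀ + t • v₁) (X.c i) * (u₀ + t • u₁) φ) := by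
    intro t i φ
    rw [AlgHom.comp_apply, hG, hev]
    simp only [LinearMap.smul_apply, LinearMap.sub_apply, smul_eq_mul, Polynomial.eval_mul,
      Polynomial.eval_sub, hU, hV]
  have h1 : G f * G (X.L j (w j)) = 0 := by
    rw [← map_mul]
    refine Polynomial.funext fun t => ?_
    rw [Polynomial.eval_zero, ← hev, ← AlgHom.comp_apply]
    refine mem_vanish.mp hf _ ⟨u₀ + t • u₁, v₀ + t • v₁, fun i => ⟨_, hGt t i⟩, fun i hi => ?_⟩
    rw [hGt]
    by_cases hiT : i ∈ T
    · exact mul_eq_zero_of_right _ (hT' i hiT t)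
    · have : i ≠ j := fun h => hj (h ▸ hi)
      simp [q, this, hT i hi hiT]
  have h2 : G (X.L j (w j)) ≠ 0 := by
    rw [hG]
    simp only [LinearMap.smul_apply, LinearMap.sub_apply, smul_eq_mul]
    refine mul_ne_zero ?_ fun h => ht₀ ?_
    · simp only [q, if_true, add_comm]
      exact Polynomial.X_add_C_ne_zero _
    · have := congr_arg (Polynomial.eval t₀) h
      rwa [Polynomial.eval_sub, Polynomial.eval_mul, Polynomial.eval_mul, hU, hU, hV, hV,
        Polynomial.eval_zero] at this
  have h3 : G f = 0 := (mul_eq_zero.mp h1).resolve_right h2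
  have h4 : g = (ev 0).comp G := hom_ext (X := X) fun i φ => by
    rw [hGt, hg, hκ]
    simp only [q, zero_smul, add_zero, Polynomial.eval_add, Polynomial.eval_C]
    split_ifs
    · simp; ring
    · simp; ring
  rw [h4, AlgHom.comp_apply, h3, map_zero]

/-- The form `λ_j` is a nonzerodivisor modulo `vanish S` for `j ∉ S`. -/
lemma mem_vanish_of_mul_mem (hw : X.GoodW w) (hj : j ∉ S) {f : LineRing m}
    (hf : f * X.L j (w j) ∈ X.vanish w S) : f ∈ X.vanish w S := by
  refine mem_vanish.mpr fun g hg => ?_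
  obtain ⟨u, v, hs, hS⟩ := hg
  choose s hs using hs
  by_cases hind : ∃ φ ψ, u φ * v ψ - v φ * u ψ ≠ 0
  · classical
    refine apply_eq_zero_of_moves (T := S.filter fun i => s i ≠ 0) hs (fun i hi hi' => ?_) hj
      (moves hw (fun i hi => ?_) (by simp [hj]) hind) hf
    · by_contra h
      exact hi' (Finset.mem_filter.mpr ⟨hi, h⟩)
    · obtain ⟨hi, h0⟩ := Finset.mem_filter.mp hi
      have := hS i hi
      rw [hs] at this
      exact (mul_eq_zero.mp this).resolve_left h0
  · push Not at hind
    exact apply_eq_zero_of_moves (s := 0) (u := 0) (v := 0) (T := ∅)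
      (fun i φ => by rw [hs, hind]; simp) (by simp) hj (moves_empty hw 0 0) hf

variable (X w) in
/-- The ideal `I` together with the linear forms `λ_j`, `j ∈ S`. -/
def sect (S : Finset (Fin m)) : Ideal (LineRing m) :=
  X.I ⊔ Ideal.span ((fun j => X.L j (w j)) '' S)

lemma sect_insert : X.sect w (insert j S) = X.sect w S ⊔ Ideal.span {X.L j (w j)} := by
  rw [sect, sect, Finset.coe_insert, Set.image_insert_eq, Set.insert_eq, Ideal.span_union, sup_assoc,
    sup_comm (Ideal.span {_})]

lemma sect_le_vanish : X.sect w S ≤ X.vanish w S := by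
  refine le_iInf fun g => le_iInf fun hg => sup_le ?_ ?_
  · obtain ⟨u, v, hs, -⟩ := hg
    choose s hs using hs
    exact I_le_ker g u v fun j => ⟨-(s j * v (X.c j)), s j * u (X.c j), fun φ => by rw [hs]; ring⟩
  · rw [Ideal.span_le]
    rintro _ ⟨j, hj, rfl⟩
    exact hg.choose_spec.choose_spec.2 j hj

lemma vanish_mono (h : S ⊆ T) : X.vanish w S ≤ X.vanish w T := fun _ hf =>
  mem_vanish.mpr fun g ⟨u, v, h1, h2⟩ => mem_vanish.mp hf g ⟨u, v, h1, fun i hi => h2 i (h hi)⟩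

lemma homog_sect : Homog (X.sect w S) := by
  refine Homog.sup X.homog_I (homog_span ?_)
  rintro _ ⟨j, -, rfl⟩
  exact ⟨1, X.isHomogeneous_L j _⟩

lemma IA_univ_eq_sect : X.IA w Finset.univ = X.sect w Finset.univ := by
  refine le_antisymm (sup_le le_sup_left ?_) (sup_le le_sup_left ?_)
  · rw [P_le_iff]
    intro j φ hφ
    obtain ⟨a, b, rfl⟩ := Submodule.mem_span_pair.mp (mem_onCols.mp hφ (Finset.mem_univ j))
    rw [map_add, map_smul, map_smul, L_c, smul_zero, zero_add, smul_eq_C_mul]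
    exact Ideal.mul_mem_left _ _ (Ideal.mem_sup_right (Ideal.subset_span ⟨j, by simp, rfl⟩))
  · rw [Ideal.span_le]
    rintro _ ⟨j, -, rfl⟩
    exact Ideal.mem_sup_right (L_mem_P (mem_onCols.mpr fun _ => w_mem_𝓛 j))

lemma vanish_eq_sect (hw : X.GoodW w) (hm : 2 ≤ m) (S : Finset (Fin m)) :
    X.vanish w S = X.sect w S := by
  refine le_antisymm ?_ sect_le_vanish
  induction h : Sᶜ.card generalizing S with
  | zero =>
    obtain rfl : S = Finset.univ := by simpa using h
    rw [← IA_univ_eq_sect]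
    exact (good_IA hw hm Finset.univ).2
  | succ n ih =>
    obtain ⟨j, hj⟩ : Sᶜ.Nonempty := Finset.card_pos.mp (by omega)
    have hj' : j ∉ S := by simpa using hj
    refine homog_sect.le_of_le_sup_span sect_le_vanish (X.isHomogeneous_L j (w j)) ?_
      fun f hf => mem_vanish_of_mul_mem hw hj' hf
    rw [← sect_insert]
    refine (vanish_mono (Finset.subset_insert j S)).trans (ih _ ?_)
    rw [Finset.compl_insert, Finset.card_erase_of_mem hj, h, Nat.add_sub_cancel]

lemma depthGE_sect (hw : X.GoodW w) (hm : 2 ≤ m) (S : Finset (Fin m)) :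
    DepthGE (𝔪 m) (LineRing m ⧸ X.sect w S) (4 + Sᶜ.card) := by
  induction h : Sᶜ.card generalizing S with
  | zero =>
    obtain rfl : S = Finset.univ := by simpa using h
    rw [← IA_univ_eq_sect]
    have := (good_IA (S := ∅) hw hm Finset.univ).1
    exact this.mono (by simp; omega)
  | succ n ih =>
    obtain ⟨j, hj⟩ : Sᶜ.Nonempty := Finset.card_pos.mp (by omega)
    have hj' : j ∉ S := by simpa using hj
    refine DepthGE.of_nonZeroDivisor (X.L_mem_𝔪 j (w j)) (fun f hf => ?_)
      (by rw [← sect_insert]; exact ih _ (by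
        rw [Finset.compl_insert, Finset.card_erase_of_mem hj, h, Nat.add_sub_cancel]))
    rw [← vanish_eq_sect hw hm] at hf ⊢
    exact mem_vanish_of_mul_mem hw hj' hf

lemma depthGE_I (hw : X.GoodW w) (hm : 2 ≤ m) :
    DepthGE (𝔪 m) (LineRing m ⧸ X.I) (4 + m) := by
  have := depthGE_sect hw hm ∅
  rwa [sect, Finset.coe_empty, Set.image_empty, Ideal.span_empty, sup_bot_eq, Finset.compl_empty,
    Finset.card_univ, Fintype.card_fin] at this

end CameraData

namespace CameraData

variable {m : ℕ} {X : CameraData m} {w : Fin m → Vec4} {B : Finset (Fin m)}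
  {u v : Vec4 →ₗ[ℂ] ℂ} {i j k l : Fin m}

lemma mem_iff_of_finrank_eq_two {K : Submodule ℂ Vec4} (hK : Module.finrank ℂ K = 2) {x y φ ψ : Vec4}
    (hx : x ∈ K) (hy : y ∈ K) (hxy : LinearIndependent ℂ ![x, y]) (hux : u x = 0) (huy : u y = 0)
    (hvx : v x = 0) (hvy : v y = 0) (h : u φ * v ψ - v φ * u ψ ≠ 0) (z : Vec4) :
    z ∈ K ↔ u z = 0 ∧ v z = 0 := by
  have hs : Module.finrank ℂ (Submodule.span ℂ (Set.range ![x, y])) = 2 := by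
    simpa using finrank_span_eq_card hxy
  have h1 : Submodule.span ℂ (Set.range ![x, y]) = K := by
    refine Submodule.eq_of_le_of_finrank_eq ?_ (hs.trans hK.symm)
    rw [Submodule.span_le, Matrix.range_cons, Matrix.range_cons, Matrix.range_empty]
    rintro _ (rfl | rfl | ⟨⟨⟩⟩) <;> assumption
  have h2 : Submodule.span ℂ (Set.range ![x, y]) = LinearMap.ker u ⊓ LinearMap.ker v := by
    refine Submodule.eq_of_le_of_finrank_eq ?_ (hs.trans (finrank_ker_inf_ker h).symm)
    rw [Submodule.span_le, Matrix.range_cons, Matrix.range_cons, Matrix.range_empty]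
    rintro _ (rfl | rfl | ⟨⟨⟩⟩)
    · exact ⟨hux, hvx⟩
    · exact ⟨huy, hvy⟩
  rw [← h1, h2]
  rfl

/-- A frame from two transversals. -/
lemma exists_frame (hij : i ≠ j) (hik : i ≠ k) (hjk : j ≠ k)
    (hi : Module.finrank ℂ (X.𝓛 w i) = 2) (hj : Module.finrank ℂ (X.𝓛 w j) = 2)
    (hk : Module.finrank ℂ (X.𝓛 w k) = 2) (hd : Disjoint (X.𝓛 w i) (X.𝓛 w j)) {x y : Fin 2 → Vec4}
    (hx : ∀ r, x r ∈ X.𝓛 w j) (hy : ∀ r, y r ∈ X.𝓛 w i) (hz : ∀ r, x r - y r ∈ X.𝓛 w k)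
    (hxi : LinearIndependent ℂ x) (hyi : LinearIndependent ℂ y) (n : Fin 2 → ℂ)
    (ho : ∀ l ∈ B, l ≠ i → l ≠ j → l ≠ k →
      Module.finrank ℂ (X.𝓛 w l) = 2 ∧ ∀ r, n r • x r - y r ∈ X.𝓛 w l) :
    ∃ F : X.Frame w B i j k, F.n1 = n 0 ∧ F.n2 = n 1 := by
  have hli : LinearIndependent ℂ ![x 0, x 1, y 0, y 1] := by
    rw [Fintype.linearIndependent_iff] at hxi hyi ⊢
    intro g hg
    simp only [Fin.sum_univ_four, Fin.sum_univ_two] at hg hxi hyi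
    simp only [Matrix.cons_val_zero, Matrix.cons_val_one, Matrix.cons_val] at hg
    have h1 : g 0 • x 0 + g 1 • x 1 = 0 := by
      refine Submodule.disjoint_def.mp hd _ ?_ (add_mem (Submodule.smul_mem _ _ (hx 0))
        (Submodule.smul_mem _ _ (hx 1)))
      rw [show g 0 • x 0 + g 1 • x 1 = -(g 2 • y 0 + g 3 • y 1) by
        rw [eq_neg_iff_add_eq_zero, ← hg]; abel]
      exact neg_mem (add_mem (Submodule.smul_mem _ _ (hy 0)) (Submodule.smul_mem _ _ (hy 1)))
    have h2 : g 2 • y 0 + g 3 • y 1 = 0 := by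
      rw [h1, zero_add] at hg
      exact hg
    have h3 := hxi ![g 0, g 1] (by simpa using h1)
    have h4 := hyi ![g 2, g 3] (by simpa using h2)
    intro r
    fin_cases r
    · exact h3 0
    · exact h3 1
    · exact h4 0
    · exact h4 1
  let e := basisOfLinearIndependentOfCardEqFinrank hli (by simp)
  have he : ∀ r, e r = ![x 0, x 1, y 0, y 1] r := fun r => by
    simp [e]
  have e0 : x 0 = e 0 := (he 0).symm
  have e1 : x 1 = e 1 := (he 1).symm
  have e2 : y 0 = e 2 := (he 2).symm
  have e3 : y 1 = e 3 := (he 3).symm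
  have key : ∀ (K : Submodule ℂ Vec4) (p q : ℂ), Module.finrank ℂ K = 2 → p • x 0 - y 0 ∈ K →
      q • x 1 - y 1 ∈ K → ∀ φ, φ ∈ K ↔
        e.coord 0 φ + p * e.coord 2 φ = 0 ∧ e.coord 1 φ + q * e.coord 3 φ = 0 := by
    intro K p q hK h0 h1 φ
    rw [e0, e2] at h0
    rw [e1, e3] at h1
    refine mem_iff_of_finrank_eq_two (u := e.coord 0 + p • e.coord 2) (v := e.coord 1 + q • e.coord 3)
      hK h0 h1 ?_ ?_ ?_ ?_ ?_ (φ := e 0) (ψ := e 1) ?_ φ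
    · refine LinearIndependent.pair_iff.mpr fun s t h => ⟨?_, ?_⟩
      · simpa using congr_arg (e.coord 2) h
      · simpa using congr_arg (e.coord 3) h
    all_goals simp
  refine ⟨⟨e, n 0, n 1, hij, hik, hjk, fun φ => ?_, fun φ => ?_, fun φ => ?_, ?_⟩, rfl, rfl⟩
  · refine mem_iff_of_finrank_eq_two hi (hy 0) (hy 1) ?_ ?_ ?_ ?_ ?_ (φ := e 0) (ψ := e 1) ?_ φ
    · convert hyi using 1; ext r : 1; fin_cases r <;> rfl
    all_goals simp [e2, e3]
  · refine mem_iff_of_finrank_eq_two hj (hx 0) (hx 1) ?_ ?_ ?_ ?_ ?_ (φ := e 2) (ψ := e 3) ?_ φ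
    · convert hxi using 1; ext r : 1; fin_cases r <;> rfl
    all_goals simp [e0, e1]
  · simpa using key _ 1 1 hk (by simpa using hz 0) (by simpa using hz 1) φ
  · intro l hl hli hlj hlk φ
    obtain ⟨h1, h2⟩ := ho l hl hli hlj hlk
    exact key _ _ _ h1 (h2 0) (h2 1) φ

lemma exists_add_of_disjoint (hi : Module.finrank ℂ (X.𝓛 w i) = 2)
    (hj : Module.finrank ℂ (X.𝓛 w j) = 2) (hd : Disjoint (X.𝓛 w i) (X.𝓛 w j)) (z : Vec4) :
    ∃ x ∈ X.𝓛 w j, ∃ y ∈ X.𝓛 w i, z = x - y := by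
  have h4 : X.𝓛 w j ⊔ X.𝓛 w i = ⊤ := by
    apply Submodule.eq_top_of_finrank_eq
    have := Submodule.finrank_sup_add_finrank_inf_eq (X.𝓛 w j) (X.𝓛 w i)
    rw [hd.symm.eq_bot, hi, hj, finrank_bot] at this
    simpa using this
  obtain ⟨x, hx, y, hy, h⟩ := Submodule.mem_sup.mp (h4 ▸ Submodule.mem_top : z ∈ X.𝓛 w j ⊔ X.𝓛 w i)
  exact ⟨x, hx, -y, neg_mem hy, by rw [sub_neg_eq_add, h]⟩

/-- If `x r - y r` are independent elements of `𝓛 k` then so are the `x r`. -/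
lemma linearIndependent_left (hd : Disjoint (X.𝓛 w i) (X.𝓛 w k)) {x y : Fin 2 → Vec4}
    (hy : ∀ r, y r ∈ X.𝓛 w i) (hz : ∀ r, x r - y r ∈ X.𝓛 w k)
    (h : LinearIndependent ℂ fun r => x r - y r) : LinearIndependent ℂ x := by
  rw [Fintype.linearIndependent_iff] at h ⊢
  intro g hg
  refine h g ?_
  refine Submodule.disjoint_def.mp hd _ ?_ (sum_mem fun r _ => Submodule.smul_mem _ _ (hz r))
  simp only [smul_sub, Finset.sum_sub_distrib, hg, zero_sub]
  exact neg_mem (sum_mem fun r _ => Submodule.smul_mem _ _ (hy r))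

lemma linearIndependent_right (hd : Disjoint (X.𝓛 w j) (X.𝓛 w k)) {x y : Fin 2 → Vec4}
    (hx : ∀ r, x r ∈ X.𝓛 w j) (hz : ∀ r, x r - y r ∈ X.𝓛 w k)
    (h : LinearIndependent ℂ fun r => x r - y r) : LinearIndependent ℂ y := by
  refine linearIndependent_left (X := X) (w := w) (y := x) hd hx
    (fun r => by rw [← neg_sub]; exact neg_mem (hz r)) ?_
  rw [show (fun r => y r - x r) = -fun r => x r - y r by ext; simp]
  exact h.neg

lemma exists_frame_triple (hij : i ≠ j) (hik : i ≠ k) (hjk : j ≠ k)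
    (hf : ∀ x ∈ ({i, j, k} : Finset (Fin m)), Module.finrank ℂ (X.𝓛 w x) = 2)
    (h1 : Disjoint (X.𝓛 w i) (X.𝓛 w j)) (h2 : Disjoint (X.𝓛 w i) (X.𝓛 w k))
    (h3 : Disjoint (X.𝓛 w j) (X.𝓛 w k)) : Nonempty (X.Frame w {i, j, k} i j k) := by
  have hi := hf i (by simp)
  have hj := hf j (by simp)
  have hk := hf k (by simp)
  choose x hx y hy hz using exists_add_of_disjoint hi hj h1
  have hz' : ∀ r : Fin 2, x (![X.c k, w k] r) - y (![X.c k, w k] r) ∈ X.𝓛 w k := by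
    intro r
    rw [← hz]
    fin_cases r
    · exact c_mem_𝓛 k
    · exact w_mem_𝓛 k
  have hli : LinearIndependent ℂ fun r : Fin 2 => x (![X.c k, w k] r) - y (![X.c k, w k] r) := by
    simp only [← hz]
    change LinearIndependent ℂ ![X.c k, w k]
    rw [linearIndependent_iff_card_eq_finrank_span, Set.finrank, Matrix.range_cons,
      Matrix.range_cons, Matrix.range_empty, Set.union_empty, Set.singleton_union, ← 𝓛, hk,
      Fintype.card_fin]
  obtain ⟨F, -⟩ := exists_frame (B := {i, j, k}) hij hik hjk hi hj hk h1
    (fun r => hx (![X.c k, w k] r)) (fun r => hy (![X.c k, w k] r)) hz'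
    (linearIndependent_left h2 (fun r => hy _) hz' hli)
    (linearIndependent_right h3 (fun r => hx _) hz' hli) 0
    (fun l hl h1 h2 h3 => by simp only [Finset.mem_insert, Finset.mem_singleton] at hl; tauto)
  exact ⟨F⟩

variable (X w) in
/-- Four planes have two distinct transversals; this is expressed by two eigenvectors of the
correspondence between the first two planes defined by the last two. -/
def TwoTransversals (i j k l : Fin m) : Prop :=
  ∃ (n : Fin 2 → ℂ) (x y : Fin 2 → Vec4), n 0 ≠ n 1 ∧ (∀ r, x r ≠ 0) ∧ (∀ r, x r ∈ X.𝓛 w j) ∧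
    (∀ r, y r ∈ X.𝓛 w i) ∧ (∀ r, x r - y r ∈ X.𝓛 w k) ∧ ∀ r, n r • x r - y r ∈ X.𝓛 w l

namespace TwoTransversals

lemma swap_ik (h : X.TwoTransversals w i j k l) : X.TwoTransversals w k j i l := by
  obtain ⟨n, x, y, hn, h0, hx, hy, hk, hl⟩ := h
  refine ⟨1 - n, x, x - y, by simpa using hn, h0, hx, hk, fun r => by simpa using hy r, fun r => ?_⟩
  convert neg_mem (hl r) using 1
  simp only [Pi.sub_apply, Pi.one_apply, sub_smul, one_smul]
  abel

lemma n_ne_zero {n : ℂ} {x y : Vec4} (hil : Disjoint (X.𝓛 w i) (X.𝓛 w l))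
    (hjk : Disjoint (X.𝓛 w j) (X.𝓛 w k)) (h0 : x ≠ 0) (hx : x ∈ X.𝓛 w j) (hy : y ∈ X.𝓛 w i)
    (hk : x - y ∈ X.𝓛 w k) (hl : n • x - y ∈ X.𝓛 w l) : n ≠ 0 := by
  rintro rfl
  rw [zero_smul, zero_sub, neg_mem_iff] at hl
  rw [Submodule.disjoint_def.mp hil y hy hl, sub_zero] at hk
  exact h0 (Submodule.disjoint_def.mp hjk x hx hk)

lemma swap_kl (hil : Disjoint (X.𝓛 w i) (X.𝓛 w l)) (hjk : Disjoint (X.𝓛 w j) (X.𝓛 w k))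
    (h : X.TwoTransversals w i j k l) : X.TwoTransversals w i j l k := by
  obtain ⟨n, x, y, hn, h0, hx, hy, hk, hl⟩ := h
  have hn0 : ∀ r, n r ≠ 0 := fun r => n_ne_zero hil hjk (h0 r) (hx r) (hy r) (hk r) (hl r)
  exact ⟨fun r => (n r)⁻¹, fun r => n r • x r, y, fun h => hn (inv_injective h),
    fun r => smul_ne_zero (hn0 r) (h0 r), fun r => Submodule.smul_mem _ _ (hx r), hy, hl,
    fun r => by simpa [smul_smul, inv_mul_cancel₀ (hn0 r)] using hk r⟩

lemma swap_ij (hil : Disjoint (X.𝓛 w i) (X.𝓛 w l)) (hjk : Disjoint (X.𝓛 w j) (X.𝓛 w k))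
    (h : X.TwoTransversals w i j k l) : X.TwoTransversals w j i k l := by
  obtain ⟨n, x, y, hn, h0, hx, hy, hk, hl⟩ := h
  have hn0 : ∀ r, n r ≠ 0 := fun r => n_ne_zero hil hjk (h0 r) (hx r) (hy r) (hk r) (hl r)
  refine ⟨fun r => (n r)⁻¹, y, x, fun h => hn (inv_injective h), fun r hr => ?_, hy, hx,
    fun r => by rw [← neg_sub]; exact neg_mem (hk r), fun r => ?_⟩
  · have := hk r
    rw [hr, sub_zero] at this
    exact h0 r (Submodule.disjoint_def.mp hjk _ (hx r) this)
  · convert Submodule.smul_mem _ (-(n r)⁻¹) (hl r) using 1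
    rw [smul_sub, smul_smul, neg_mul, inv_mul_cancel₀ (hn0 r)]
    simp only [neg_smul, one_smul]
    abel

lemma exists_frame (hij : i ≠ j) (hik : i ≠ k) (hjk : j ≠ k)
    (hf : ∀ x ∈ ({i, j, k, l} : Finset (Fin m)), Module.finrank ℂ (X.𝓛 w x) = 2)
    (h1 : Disjoint (X.𝓛 w i) (X.𝓛 w j)) (h2 : Disjoint (X.𝓛 w i) (X.𝓛 w k))
    (h3 : Disjoint (X.𝓛 w j) (X.𝓛 w k)) (h4 : Disjoint (X.𝓛 w j) (X.𝓛 w l))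
    (h : X.TwoTransversals w i j k l) : ∃ F : X.Frame w {i, j, k, l} i j k, F.n1 ≠ F.n2 := by
  obtain ⟨n, x, y, hn, h0, hx, hy, hk, hl⟩ := h
  have hli : LinearIndependent ℂ fun r => x r - y r := by
    have hz : x 0 - y 0 ≠ 0 := fun h => h0 0 (Submodule.disjoint_def.mp h1 _
      (by rw [sub_eq_zero.mp h]; exact hy 0) (hx 0))
    rw [show (fun r => x r - y r) = ![x 0 - y 0, x 1 - y 1] by ext r : 1; fin_cases r <;> rfl,
      LinearIndependent.pair_iff' hz]
    intro a ha
    have hxa : a • x 0 - x 1 = a • y 0 - y 1 := by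
      rw [sub_eq_sub_iff_add_eq_add]
      rw [smul_sub, sub_eq_sub_iff_add_eq_add] at ha
      rw [ha, add_comm]
    have hx1 : a • x 0 - x 1 = 0 := Submodule.disjoint_def.mp h1 _
      (by rw [hxa]; exact sub_mem (Submodule.smul_mem _ _ (hy 0)) (hy 1))
      (sub_mem (Submodule.smul_mem _ _ (hx 0)) (hx 1))
    have hy1 : a • y 0 - y 1 = 0 := hxa ▸ hx1
    have h5 : (n 0 - n 1) • x 1 ∈ X.𝓛 w l := by
      convert sub_mem (Submodule.smul_mem _ a (hl 0)) (hl 1) using 1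
      rw [← sub_eq_zero.mp hx1, ← sub_eq_zero.mp hy1]
      module
    exact h0 1 (Submodule.disjoint_def.mp h4 _ (hx 1)
      ((Submodule.smul_mem_iff _ (sub_ne_zero.mpr hn)).mp h5))
  obtain ⟨F, hF1, hF2⟩ := CameraData.exists_frame (B := {i, j, k, l}) hij hik hjk (hf i (by simp))
    (hf j (by simp)) (hf k (by simp)) h1 hx hy hk (linearIndependent_left h2 hy hk hli)
    (linearIndependent_right h3 hx hk hli) n (fun x hx h1 h2 h3 => by
      simp only [Finset.mem_insert, Finset.mem_singleton] at hx
      obtain rfl : x = l := by tauto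
      exact ⟨hf _ (by simp), hl⟩)
  exact ⟨F, by rwa [hF1, hF2]⟩

end TwoTransversals

end CameraData

namespace CameraData

variable {m : ℕ} {X : CameraData m} {w : Fin m → Vec4} {B : Finset (Fin m)}
  {u v : Vec4 →ₗ[ℂ] ℂ} {i j k l : Fin m}

lemma Frame.span_le_of_transversal (F : X.Frame w {i, j, k, l} i j k) (hli : l ≠ i) (hlj : l ≠ j)
    (hlk : l ≠ k) (hF : F.n1 ≠ F.n2) (hd : Disjoint (X.𝓛 w i) (X.𝓛 w j))
    (hik : Disjoint (X.𝓛 w i) (X.𝓛 w k)) (hjk : Disjoint (X.𝓛 w j) (X.𝓛 w k))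
    {N : Submodule ℂ Vec4} (hN : Module.finrank ℂ N = 2)
    (h : ∀ x ∈ ({i, j, k, l} : Finset (Fin m)), X.Meets w N x) :
    N ≤ Submodule.span ℂ {F.e 0, F.e 2} ∨ N ≤ Submodule.span ℂ {F.e 1, F.e 3} := by
  obtain ⟨y, hyN, hy, hy0⟩ := h i (by simp)
  obtain ⟨x, hxN, hx, hx0⟩ := h j (by simp)
  obtain ⟨z, hzN, hz, hz0⟩ := h k (by simp)
  obtain ⟨t, htN, ht, ht0⟩ := h l (by simp)
  have hli' : LinearIndependent ℂ ![x, y] := by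
    rw [LinearIndependent.pair_iff' hx0]
    intro a ha
    exact hy0 (Submodule.disjoint_def.mp hd y hy (ha ▸ Submodule.smul_mem _ _ hx))
  have hNs : N = Submodule.span ℂ {x, y} := by
    refine (Submodule.eq_of_le_of_finrank_eq (Submodule.span_le.mpr ?_) ?_).symm
    · rintro _ (rfl | rfl) <;> assumption
    · have h2 := finrank_span_eq_card hli'
      rw [Matrix.range_cons, Matrix.range_cons, Matrix.range_empty, Set.union_empty,
        Set.singleton_union] at h2
      rw [hN, h2, Fintype.card_fin]
  obtain ⟨a, b, rfl⟩ := Submodule.mem_span_pair.mp (hNs ▸ hzN)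
  obtain ⟨c, d, rfl⟩ := Submodule.mem_span_pair.mp (hNs ▸ htN)
  have hb : b ≠ 0 := by
    rintro rfl
    rw [zero_smul, add_zero] at hz hz0
    exact hz0 (Submodule.disjoint_def.mp hjk _ (Submodule.smul_mem _ _ hx) hz)
  have ha : a ≠ 0 := by
    rintro rfl
    rw [zero_smul, zero_add] at hz hz0
    exact hz0 (Submodule.disjoint_def.mp hik _ (Submodule.smul_mem _ _ hy) hz)
  have hy' := (F.hi y).mp hy
  have hx' := (F.hj x).mp hx
  have hz' := (F.hk _).mp hz
  have ht' := (F.other l (by simp) hli hlj hlk _).mp ht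
  simp only [map_add, map_smul, smul_eq_mul, hy'.1, hy'.2, hx'.1, hx'.2, mul_zero, add_zero,
    zero_add] at hz' ht'
  have hxs := F.e.sum_repr x
  have hys := F.e.sum_repr y
  simp only [Fin.sum_univ_four, ← Module.Basis.coord_apply, hy'.1, hy'.2, hx'.1, hx'.2, zero_smul,
    add_zero, zero_add] at hxs hys
  have hcases : F.e.coord 0 x = 0 ∨ F.e.coord 1 x = 0 := by
    by_contra! h0
    have e1 : F.e.coord 0 x * (b * c - F.n1 * (a * d)) = 0 := by
      linear_combination b * ht'.1 - F.n1 * d * hz'.1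
    have e2 : F.e.coord 1 x * (b * c - F.n2 * (a * d)) = 0 := by
      linear_combination b * ht'.2 - F.n2 * d * hz'.2
    have e1' := (mul_eq_zero.mp e1).resolve_left h0.1
    have e2' := (mul_eq_zero.mp e2).resolve_left h0.2
    have hd0 : d = 0 := by
      have : (F.n1 - F.n2) * (a * d) = 0 := by linear_combination e2' - e1'
      simpa [sub_ne_zero.mpr hF, ha] using this
    have hc0 : c = 0 := by simpa [hd0, hb] using e1'
    simp [hd0, hc0] at ht0
  rw [hNs]
  rcases hcases with h0 | h1
  · right
    have h2 : F.e.coord 2 y = 0 := by simpa [h0, hb] using hz'.1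
    rw [h0, zero_smul, zero_add] at hxs
    rw [h2, zero_smul, zero_add] at hys
    rw [Submodule.span_le]
    rintro _ (rfl | rfl)
    · rw [← hxs]; exact Submodule.smul_mem _ _ (Submodule.subset_span (by simp))
    · rw [← hys]; exact Submodule.smul_mem _ _ (Submodule.subset_span (by simp))
  · left
    have h2 : F.e.coord 3 y = 0 := by simpa [h1, hb] using hz'.2
    rw [h1, zero_smul, add_zero] at hxs
    rw [h2, zero_smul, add_zero] at hys
    rw [Submodule.span_le]
    rintro _ (rfl | rfl)
    · rw [← hxs]; exact Submodule.smul_mem _ _ (Submodule.subset_span (by simp))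
    · rw [← hys]; exact Submodule.smul_mem _ _ (Submodule.subset_span (by simp))

/-- The discriminant of the pencil of transversals, as a function of the last plane
`⟨c, z⟩`. -/
def Frame.disc (F : X.Frame w B i j k) (c z : Vec4) : ℂ :=
  (F.e.coord 0 c * F.e.coord 3 z - F.e.coord 1 c * F.e.coord 2 z +
    (F.e.coord 2 c * F.e.coord 1 z - F.e.coord 3 c * F.e.coord 0 z)) ^ 2 -
  4 * (F.e.coord 0 c * F.e.coord 1 z - F.e.coord 1 c * F.e.coord 0 z) *
    (F.e.coord 2 c * F.e.coord 3 z - F.e.coord 3 c * F.e.coord 2 z)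

lemma exists_two_roots {a b c : ℂ} (ha : a ≠ 0) (h : b ^ 2 - 4 * c * a ≠ 0) :
    ∃ n : Fin 2 → ℂ, n 0 ≠ n 1 ∧ ∀ r, c + b * n r + a * n r ^ 2 = 0 := by
  obtain ⟨s, hs⟩ := IsAlgClosed.exists_pow_nat_eq (b ^ 2 - 4 * c * a) (n := 2) two_pos
  have hs0 : s ≠ 0 := by
    rintro rfl
    exact h (by rw [← hs]; ring)
  refine ⟨![(-b + s) / (2 * a), (-b - s) / (2 * a)], ?_, fun r => ?_⟩
  · simp only [Matrix.cons_val_zero, Matrix.cons_val_one, ne_eq]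
    rw [div_left_inj' (mul_ne_zero two_ne_zero ha)]
    intro h
    exact hs0 (by linear_combination h / 2)
  · fin_cases r
    · simp only [Fin.zero_eta, Matrix.cons_val_zero]
      field_simp
      linear_combination hs
    · change c + b * ((-b - s) / (2 * a)) + a * ((-b - s) / (2 * a)) ^ 2 = 0
      field_simp
      linear_combination hs

/-- Nonvanishing of the discriminant gives two transversals; `w'` agrees with `w` at `i, j, k`. -/
lemma Frame.twoTransversals (F : X.Frame w {i, j, k} i j k) {w' : Fin m → Vec4}
    (hi : X.𝓛 w' i = X.𝓛 w i) (hj : X.𝓛 w' j = X.𝓛 w j) (hk : X.𝓛 w' k = X.𝓛 w k)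
    (hf : Module.finrank ℂ (X.𝓛 w' l) = 2) (hlj : Disjoint (X.𝓛 w' l) (X.𝓛 w' j))
    (hd : F.disc (X.c l) (w' l) ≠ 0) : X.TwoTransversals w' i j k l := by
  have hlin : ∀ a b : ℂ, a • X.c l + b • w' l = 0 → a = 0 ∧ b = 0 := by
    refine LinearIndependent.pair_iff.mp ?_
    rw [linearIndependent_iff_card_eq_finrank_span, Set.finrank, Matrix.range_cons,
      Matrix.range_cons, Matrix.range_empty, Set.union_empty, Set.singleton_union, ← 𝓛, hf,
      Fintype.card_fin]
  have ha : X.pen w' (F.e.coord 2) (F.e.coord 3) l ≠ 0 := by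
    intro h
    obtain ⟨a, b, hab, h2, h3⟩ := exists_mem_ker h
    have h4 := Submodule.disjoint_def.mp hlj _ (Submodule.mem_span_pair.mpr ⟨a, b, rfl⟩)
      (hj ▸ (F.hj _).mpr ⟨h2, h3⟩)
    obtain ⟨rfl, rfl⟩ := hlin a b h4
    simp at hab
  obtain ⟨n, hn, hroot⟩ := exists_two_roots ha hd
  have hex : ∀ r, ∃ z ∈ X.𝓛 w' l, z ≠ 0 ∧ F.e.coord 0 z + n r * F.e.coord 2 z = 0 ∧
      F.e.coord 1 z + n r * F.e.coord 3 z = 0 := by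
    intro r
    have hp : X.pen w' (F.e.coord 0 + n r • F.e.coord 2) (F.e.coord 1 + n r • F.e.coord 3) l = 0 := by
      have := hroot r
      simp only [pen, LinearMap.add_apply, LinearMap.smul_apply, smul_eq_mul] at this ⊢
      linear_combination this
    obtain ⟨a, b, hab, h2, h3⟩ := exists_mem_ker hp
    refine ⟨_, Submodule.mem_span_pair.mpr ⟨a, b, rfl⟩, fun h0 => ?_, h2, h3⟩
    obtain ⟨rfl, rfl⟩ := hlin a b h0
    simp at hab
  choose z hz hz0 h0 h1 using hex
  refine ⟨n, fun r => F.e.coord 2 (z r) • F.e 0 + F.e.coord 3 (z r) • F.e 1,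
    fun r => F.e.coord 2 (z r) • F.e 2 + F.e.coord 3 (z r) • F.e 3, hn, fun r hr => ?_, fun r => ?_,
    fun r => ?_, fun r => ?_, fun r => ?_⟩
  · have e2 := congr_arg (F.e.coord 0) hr
    have e3 := congr_arg (F.e.coord 1) hr
    simp only [map_add, map_smul, Module.Basis.coord_apply, Module.Basis.repr_self] at e2 e3
    simp at e2 e3
    refine hz0 r (F.e.ext_elem fun s => ?_)
    have h0r := h0 r
    have h1r := h1 r
    simp only [Module.Basis.coord_apply] at h0r h1r
    rw [e2] at h0r
    rw [e3] at h1r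
    fin_cases s
    · simpa using h0r
    · simpa using h1r
    · simpa using e2
    · simpa using e3
  · rw [hj, F.hj]; simp
  · rw [hi, F.hi]; simp
  · rw [hk, F.hk]; simp
  · have := F.e.sum_repr (z r)
    simp only [Fin.sum_univ_four, ← Module.Basis.coord_apply, eq_neg_of_add_eq_zero_left (h0 r),
      eq_neg_of_add_eq_zero_left (h1 r)] at this
    convert neg_mem (hz r) using 1
    rw [← this]
    module

end CameraData

namespace CameraData

/-- The filter of nonempty Zariski open subsets of `ℂ⁴`. -/
def generic : Filter Vec4 where
  sets := {U | ∃ P : MvPolynomial (Fin 4) ℂ, P ≠ 0 ∧ ∀ z, eval z P ≠ 0 → z ∈ U}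
  univ_sets := ⟨1, one_ne_zero, fun _ _ => trivial⟩
  sets_of_superset := fun ⟨P, hP, h⟩ hUV => ⟨P, hP, fun z hz => hUV (h z hz)⟩
  inter_sets := fun ⟨P, hP, h⟩ ⟨Q, hQ, h'⟩ => ⟨P * Q, mul_ne_zero hP hQ, fun z hz => by
    rw [map_mul] at hz
    exact ⟨h z (left_ne_zero_of_mul hz), h' z (right_ne_zero_of_mul hz)⟩⟩

instance : generic.NeBot := by
  refine ⟨fun h => ?_⟩
  obtain ⟨P, hP, hz⟩ : ∅ ∈ generic := by rw [h]; trivial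
  exact hP (MvPolynomial.funext fun z => by
    rw [map_zero]
    by_contra hne
    exact hz z hne)

/-- A linear form as a polynomial. -/
def toPoly (f : Vec4 →ₗ[ℂ] ℂ) : MvPolynomial (Fin 4) ℂ := ∑ i, C (f fun j => if i = j then 1 else 0) * X i

lemma eval_toPoly (f : Vec4 →ₗ[ℂ] ℂ) (z : Vec4) : eval z (toPoly f) = f z := by
  rw [LinearMap.pi_apply_eq_sum_univ f z]
  simp [toPoly, mul_comm]

lemma eventually_eval_ne_zero (P : MvPolynomial (Fin 4) ℂ) {z : Vec4} (h : eval z P ≠ 0) :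
    ∀ᶠ z in generic, eval z P ≠ 0 :=
  ⟨P, fun h0 => h (by rw [h0, map_zero]), fun _ hz => hz⟩

lemma eventually_notMem {K : Submodule ℂ Vec4} (h : Module.finrank ℂ K < 4) :
    ∀ᶠ z in generic, z ∉ K := by
  have hK : K ≠ ⊤ := by
    rintro rfl
    simp at h
  obtain ⟨x, hx⟩ : ∃ x, x ∉ K := by
    by_contra! h
    exact hK (Submodule.eq_top_iff'.mpr h)
  obtain ⟨f, hf, hfx⟩ := exists_functional hx
  refine (eventually_eval_ne_zero (toPoly f) (z := x) (by rwa [eval_toPoly])).mono fun z hz hzK => ?_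
  rw [eval_toPoly, hf z hzK] at hz
  exact hz rfl

variable {m : ℕ} {X : CameraData m} {w : Fin m → Vec4} {B : Finset (Fin m)} {i j k l : Fin m}

lemma Frame.eventually_disc (F : X.Frame w B i j k) {c : Vec4}
    (hc : F.e.coord 0 c * F.e.coord 3 c - F.e.coord 1 c * F.e.coord 2 c ≠ 0) :
    ∀ᶠ z in generic, F.disc c z ≠ 0 := by
  have key := eventually_eval_ne_zero
    ((C (F.e.coord 0 c) * toPoly (F.e.coord 3) - C (F.e.coord 1 c) * toPoly (F.e.coord 2) +
    (C (F.e.coord 2 c) * toPoly (F.e.coord 1) - C (F.e.coord 3 c) * toPoly (F.e.coord 0))) ^ 2 -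
    C 4 * (C (F.e.coord 0 c) * toPoly (F.e.coord 1) - C (F.e.coord 1 c) * toPoly (F.e.coord 0)) *
    (C (F.e.coord 2 c) * toPoly (F.e.coord 3) - C (F.e.coord 3 c) * toPoly (F.e.coord 2)))
    (z := F.e.coord 2 c • F.e 2 + F.e.coord 3 c • F.e 3)
  simp only [map_sub, map_add, map_mul, map_pow, eval_C, eval_toPoly] at key
  refine key ?_
  simp only [map_smul, Module.Basis.coord_apply, Module.Basis.repr_self] at hc ⊢
  simp only [Finsupp.single_apply, smul_eq_mul, mul_ite, mul_one, mul_zero]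
  simp only [Fin.reduceEq, if_true, if_false]
  convert pow_ne_zero 2 hc using 1
  ring

lemma finrank_sup_lt (K : Submodule ℂ Vec4) (hK : Module.finrank ℂ K ≤ 2) (x : Vec4) :
    Module.finrank ℂ ↥(K ⊔ Submodule.span ℂ {x}) < 4 := by
  have := Submodule.finrank_add_le_finrank_add_finrank K (Submodule.span ℂ {x})
  have h1 := finrank_span_le_card (R := ℂ) ({x} : Set Vec4)
  rw [Set.toFinset_singleton, Finset.card_singleton] at h1
  omega

end CameraData

namespace CameraData

variable {m : ℕ} {X : CameraData m} {w : Fin m → Vec4} {B A : Finset (Fin m)} {i j k l : Fin m}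
  {z : Vec4}

variable (X) in
/-- The centers are pairwise distinct and no four of them are collinear. -/
structure General : Prop where
  pair : ∀ i j, i ≠ j → X.c i ∉ Submodule.span ℂ {X.c j}
  four : ∀ N : Submodule ℂ Vec4, Module.finrank ℂ N = 2 → ∀ s : Finset (Fin m), s.card = 4 →
    ¬ ∀ j ∈ s, X.c j ∈ N

variable (X) in
/-- The genericity conditions on the vectors `w a` for `a ∈ A`. -/
structure GoodOn (A : Finset (Fin m)) (w : Fin m → Vec4) : Prop where
  indep : ∀ a ∈ A, ∀ n n', w a ∉ Submodule.span ℂ {X.c n, X.c n'} ⊔ Submodule.span ℂ {X.c a}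
  pair : ∀ a ∈ A, ∀ b ∈ A, a ≠ b → Disjoint (X.𝓛 w a) (X.𝓛 w b)
  quad : ∀ i ∈ A, ∀ j ∈ A, ∀ k ∈ A, ∀ l ∈ A, i ≠ j → i ≠ k → j ≠ k → l ≠ i → l ≠ j → l ≠ k →
    X.TwoTransversals w i j k l
  center : ∀ N : Submodule ℂ Vec4, Module.finrank ℂ N = 2 → ∀ n, X.c n ∈ N →
    ∀ s ⊆ A, s.card = 3 → n ∉ s → ¬ ∀ j ∈ s, X.Meets w N j
  quint : ∀ N : Submodule ℂ Vec4, Module.finrank ℂ N = 2 →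
    ∀ s ⊆ A, s.card = 5 → ¬ ∀ j ∈ s, X.Meets w N j

lemma 𝓛_update_of_ne (h : j ≠ l) : X.𝓛 (Function.update w l z) j = X.𝓛 w j := by
  rw [𝓛, 𝓛, Function.update_of_ne h]

lemma 𝓛_update_self : X.𝓛 (Function.update w l z) l = Submodule.span ℂ {X.c l, z} := by
  rw [𝓛, Function.update_self]

lemma meets_update {N : Submodule ℂ Vec4} (h : j ≠ l) :
    X.Meets (Function.update w l z) N j ↔ X.Meets w N j := by
  rw [Meets, Meets, 𝓛_update_of_ne h]

/-- If `⟨c, z⟩` meets `N` and `z` is general then `c ∈ N`. -/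
lemma c_mem_of_meets_update {N : Submodule ℂ Vec4} (h : X.Meets (Function.update w l z) N l)
    (hz : z ∉ N ⊔ Submodule.span ℂ {X.c l}) : X.c l ∈ N := by
  obtain ⟨x, hxN, hx, hx0⟩ := h
  rw [𝓛_update_self] at hx
  obtain ⟨a, b, rfl⟩ := Submodule.mem_span_pair.mp hx
  have hb : b = 0 := by
    by_contra hb
    refine hz ((Submodule.smul_mem_iff _ hb).mp ?_)
    rw [← add_sub_cancel_left (a • X.c l) (b • z)]
    exact sub_mem (Submodule.mem_sup_left hxN) (Submodule.mem_sup_right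
      (Submodule.smul_mem _ _ (Submodule.mem_span_singleton_self _)))
  subst hb
  rw [zero_smul, add_zero] at hxN hx0
  exact (Submodule.smul_mem_iff _ (left_ne_zero_of_smul hx0)).mp hxN

namespace GoodOn

lemma w_notMem_span_c (h : X.GoodOn A w) (hi : i ∈ A) : w i ∉ Submodule.span ℂ {X.c i} := fun hw =>
  h.indep i hi i i (Submodule.mem_sup_right hw)

lemma finrank (h : X.GoodOn A w) (hi : i ∈ A) : Module.finrank ℂ (X.𝓛 w i) = 2 := by
  rw [𝓛, Set.pair_comm, Submodule.span_insert, sup_comm, finrank_sup_span_singleton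
    (h.w_notMem_span_c hi), finrank_span_singleton (c_ne_zero i)]

/-- If a line through `c n` and `c n'` meets `𝓛 a` then it passes through `c a`. -/
lemma c_mem_of_meets (h : X.GoodOn A w) {a n n' : Fin m} (ha : a ∈ A) {N : Submodule ℂ Vec4}
    (hN : N = Submodule.span ℂ {X.c n, X.c n'}) (hm : X.Meets w N a) : X.c a ∈ N := by
  obtain ⟨x, hxN, hx, hx0⟩ := hm
  obtain ⟨s, t, rfl⟩ := Submodule.mem_span_pair.mp hx
  have ht : t = 0 := by
    by_contra ht
    refine h.indep a ha n n' ((Submodule.smul_mem_iff _ ht).mp ?_)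
    rw [← add_sub_cancel_left (s • X.c a) (t • w a), ← hN]
    exact sub_mem (Submodule.mem_sup_left hxN) (Submodule.mem_sup_right
      (Submodule.smul_mem _ _ (Submodule.mem_span_singleton_self _)))
  subst ht
  rw [zero_smul, add_zero] at hxN hx0
  exact (Submodule.smul_mem_iff _ (left_ne_zero_of_smul hx0)).mp hxN

lemma c_notMem_𝓛 (hX : X.General) (h : X.GoodOn A w) {a n : Fin m} (ha : a ∈ A) (hn : n ≠ a) :
    X.c n ∉ X.𝓛 w a := by
  intro hc
  refine hX.pair a n hn.symm ?_
  have := h.c_mem_of_meets (n := n) (n' := n) ha rfl ⟨X.c n, Submodule.subset_span (by simp), hc,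
    c_ne_zero n⟩
  simpa using this

/-- A line through `c n` and meeting `𝓛 a`, `𝓛 b` is unique. -/
lemma eq_of_meets (hX : X.General) (h : X.GoodOn A w) {a b n : Fin m} (ha : a ∈ A) (hb : b ∈ A)
    (hab : a ≠ b) (hna : n ≠ a) (hnb : n ≠ b) {N : Submodule ℂ Vec4} (hN : Module.finrank ℂ N = 2)
    (hn : X.c n ∈ N) (hma : X.Meets w N a) (hmb : X.Meets w N b) :
    N = (X.𝓛 w a ⊔ Submodule.span ℂ {X.c n}) ⊓ (X.𝓛 w b ⊔ Submodule.span ℂ {X.c n}) := by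
  have key : ∀ x ∈ A, n ≠ x → X.Meets w N x → N ≤ X.𝓛 w x ⊔ Submodule.span ℂ {X.c n} := by
    rintro x hxA hnx ⟨y, hyN, hy, hy0⟩
    have hcy : X.c n ∉ Submodule.span ℂ {y} := fun hc => c_notMem_𝓛 hX h hxA hnx
      (Submodule.span_le.mpr (by simpa using hy) hc)
    have : Submodule.span ℂ {y} ⊔ Submodule.span ℂ {X.c n} = N := by
      refine Submodule.eq_of_le_of_finrank_eq ?_ ?_
      · rw [sup_le_iff, Submodule.span_singleton_le_iff_mem, Submodule.span_singleton_le_iff_mem]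
        exact ⟨hyN, hn⟩
      · rw [finrank_sup_span_singleton hcy, finrank_span_singleton hy0, hN]
    rw [← this]
    exact sup_le_sup_right ((Submodule.span_singleton_le_iff_mem _ _).mpr hy) _
  refine Submodule.eq_of_le_of_finrank_le (le_inf (key a ha hna hma) (key b hb hnb hmb)) ?_
  have h1 := Submodule.finrank_sup_add_finrank_inf_eq (X.𝓛 w a ⊔ Submodule.span ℂ {X.c n})
    (X.𝓛 w b ⊔ Submodule.span ℂ {X.c n})
  have h2 := Submodule.finrank_sup_add_finrank_inf_eq (X.𝓛 w a) (X.𝓛 w b)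
  rw [(h.pair a ha b hb hab).eq_bot, finrank_bot, h.finrank ha, h.finrank hb] at h2
  have h3 := Submodule.finrank_mono (sup_le_sup (le_sup_left : X.𝓛 w a ≤ X.𝓛 w a ⊔
    Submodule.span ℂ {X.c n}) (le_sup_left : X.𝓛 w b ≤ X.𝓛 w b ⊔ Submodule.span ℂ {X.c n}))
  rw [finrank_sup_span_singleton (c_notMem_𝓛 hX h ha hna),
    finrank_sup_span_singleton (c_notMem_𝓛 hX h hb hnb), h.finrank ha, h.finrank hb] at h1
  omega

lemma eventually_indep (l : Fin m) :
    ∀ᶠ z in generic, ∀ n n', z ∉ Submodule.span ℂ {X.c n, X.c n'} ⊔ Submodule.span ℂ {X.c l} := by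
  refine Filter.eventually_all.mpr fun n => Filter.eventually_all.mpr fun n' =>
    eventually_notMem (finrank_sup_lt _ ?_ _)
  have := finrank_span_le_card (R := ℂ) ({X.c n, X.c n'} : Set Vec4)
  refine this.trans ?_
  simpa using Finset.card_le_two (a := X.c n) (b := X.c n')

lemma eventually_pair (l : Fin m) (w : Fin m → Vec4) :
    ∀ᶠ z in generic, ∀ a, z ∉ X.𝓛 w a ⊔ Submodule.span ℂ {X.c l} :=
  Filter.eventually_all.mpr fun a => eventually_notMem (finrank_sup_lt _ (Coord.finrank_𝓛_le a) _)

lemma eventually_center (hX : X.General) (h : X.GoodOn A w) (l : Fin m) :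
    ∀ᶠ z in generic, ∀ n, ∀ a ∈ A, ∀ b ∈ A, a ≠ b → n ≠ a → n ≠ b → ∀ N : Submodule ℂ Vec4,
      Module.finrank ℂ N = 2 → X.c n ∈ N → X.Meets w N a → X.Meets w N b →
        z ∉ N ⊔ Submodule.span ℂ {X.c l} := by
  refine Filter.eventually_all.mpr fun n => (Filter.eventually_all_finset A).mpr fun a ha =>
    (Filter.eventually_all_finset A).mpr fun b hb => ?_
  by_cases hne : a ≠ b ∧ n ≠ a ∧ n ≠ b
  swap
  · exact Filter.Eventually.of_forall fun z h1 h2 h3 => absurd ⟨h1, h2, h3⟩ hne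
  obtain ⟨hab, hna, hnb⟩ := hne
  by_cases hN : ∃ N : Submodule ℂ Vec4,
    Module.finrank ℂ N = 2 ∧ X.c n ∈ N ∧ X.Meets w N a ∧ X.Meets w N b
  swap
  · exact Filter.Eventually.of_forall fun z _ _ _ N h1 h2 h3 h4 => absurd ⟨N, h1, h2, h3, h4⟩ hN
  obtain ⟨N, hN, hn, hma, hmb⟩ := hN
  refine (eventually_notMem (finrank_sup_lt N hN.le (X.c l))).mono
    fun z hz _ _ _ N' hN' hn' hma' hmb' => ?_
  rwa [eq_of_meets hX h ha hb hab hna hnb hN' hn' hma' hmb',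
    ← eq_of_meets hX h ha hb hab hna hnb hN hn hma hmb]

lemma eventually_quint (h : X.GoodOn A w) (l : Fin m) :
    ∀ᶠ z in generic, ∀ i ∈ A, ∀ j ∈ A, ∀ k ∈ A, ∀ x ∈ A, i ≠ j → i ≠ k → j ≠ k → x ≠ i → x ≠ j →
      x ≠ k → ∀ N : Submodule ℂ Vec4, Module.finrank ℂ N = 2 → X.Meets w N i → X.Meets w N j →
        X.Meets w N k → X.Meets w N x → z ∉ N ⊔ Submodule.span ℂ {X.c l} := by
  refine (Filter.eventually_all_finset A).mpr fun i hi =>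
    (Filter.eventually_all_finset A).mpr fun j hj =>
    (Filter.eventually_all_finset A).mpr fun k hk =>
    (Filter.eventually_all_finset A).mpr fun x hx => ?_
  by_cases hne : (i ≠ j ∧ i ≠ k ∧ j ≠ k) ∧ x ≠ i ∧ x ≠ j ∧ x ≠ k
  swap
  · exact Filter.Eventually.of_forall fun z h1 h2 h3 h4 h5 h6 =>
      absurd ⟨⟨h1, h2, h3⟩, h4, h5, h6⟩ hne
  obtain ⟨⟨hij, hik, hjk⟩, hxi, hxj, hxk⟩ := hne
  obtain ⟨F, hF⟩ := (h.quad i hi j hj k hk x hx hij hik hjk hxi hxj hxk).exists_frame hij hik hjk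
    (fun y hy => h.finrank (by
      simp only [Finset.mem_insert, Finset.mem_singleton] at hy
      rcases hy with rfl | rfl | rfl | rfl <;> assumption))
    (h.pair i hi j hj hij) (h.pair i hi k hk hik) (h.pair j hj k hk hjk)
    (h.pair j hj x hx hxj.symm)
  filter_upwards [eventually_notMem (finrank_sup_lt _ (F.finrank_span_e (r := 0) (s := 2)
    (by decide)).le (X.c l)), eventually_notMem (finrank_sup_lt _ (F.finrank_span_e (r := 1) (s := 3)
    (by decide)).le (X.c l))] with z h1 h2 _ _ _ _ _ _ N hN m1 m2 m3 m4 hz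
  rcases F.span_le_of_transversal hxi hxj hxk hF (h.pair i hi j hj hij) (h.pair i hi k hk hik)
    (h.pair j hj k hk hjk) hN (by simp [m1, m2, m3, m4]) with h3 | h3
  · exact h1 (sup_le_sup_right h3 _ hz)
  · exact h2 (sup_le_sup_right h3 _ hz)

lemma disc_aux (h : X.GoodOn A w) (hl : l ∉ A) (hi : i ∈ A) (hj : j ∈ A) (hk : k ∈ A)
    (F : X.Frame w {i, j, k} i j k) :
    F.e.coord 0 (X.c l) * F.e.coord 3 (X.c l) - F.e.coord 1 (X.c l) * F.e.coord 2 (X.c l) ≠ 0 := by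
  intro h0
  set c := F.e.coord
  have hc0 : X.c l ≠ 0 := c_ne_zero l
  have hsum := F.e.sum_repr (X.c l)
  simp only [Fin.sum_univ_four, ← Module.Basis.coord_apply] at hsum
  obtain ⟨r0, r1, s, t, hr, h00, h01, h02, h03⟩ : ∃ r0 r1 s t : ℂ, (r0 ≠ 0 ∨ r1 ≠ 0) ∧
      c 0 (X.c l) = s * r0 ∧ c 1 (X.c l) = s * r1 ∧ c 2 (X.c l) = t * r0 ∧
      c 3 (X.c l) = t * r1 := by
    by_cases hp : c 0 (X.c l) ≠ 0 ∨ c 1 (X.c l) ≠ 0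
    · rcases hp with hp | hp
      · refine ⟨_, _, 1, c 2 (X.c l) / c 0 (X.c l), Or.inl hp, (one_mul _).symm, (one_mul _).symm,
          ?_, ?_⟩
        · field_simp
        · field_simp
          linear_combination h0
      · refine ⟨_, _, 1, c 3 (X.c l) / c 1 (X.c l), Or.inr hp, (one_mul _).symm, (one_mul _).symm,
          ?_, ?_⟩
        · field_simp
          linear_combination -h0
        · field_simp
    · push Not at hp
      refine ⟨_, _, 0, 1, ?_, by rw [hp.1, zero_mul], by rw [hp.2, zero_mul], (one_mul _).symm,
        (one_mul _).symm⟩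
      by_contra! h2
      refine hc0 ?_
      rw [← hsum]
      change c 0 (X.c l) • _ + c 1 (X.c l) • _ + c 2 (X.c l) • _ + c 3 (X.c l) • _ = 0
      rw [hp.1, hp.2, h2.1, h2.2]
      simp
  set x := r0 • F.e 0 + r1 • F.e 1
  set y := r0 • F.e 2 + r1 • F.e 3
  have hxy : LinearIndependent ℂ ![x, y] := by
    refine LinearIndependent.pair_iff.mpr fun a b hab => ?_
    have e0 := congr_arg (c 0) hab
    have e1 := congr_arg (c 1) hab
    have e2 := congr_arg (c 2) hab
    have e3 := congr_arg (c 3) hab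
    simp [c, x, y] at e0 e1 e2 e3
    rcases hr with hr | hr
    · exact ⟨e0.resolve_right hr, e2.resolve_right hr⟩
    · exact ⟨e1.resolve_right hr, e3.resolve_right hr⟩
  have hx0 : x ≠ 0 := hxy.ne_zero 0
  have hy0 : y ≠ 0 := hxy.ne_zero 1
  have hN := finrank_span_eq_card hxy
  rw [Matrix.range_cons, Matrix.range_cons, Matrix.range_empty, Set.union_empty,
    Set.singleton_union, Fintype.card_fin] at hN
  have hcard : ({i, j, k} : Finset (Fin m)).card = 3 := Finset.card_eq_three.mpr
    ⟨i, j, k, F.hij, F.hik, F.hjk, rfl⟩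
  refine h.center _ hN l ?_ {i, j, k} (by simp [Finset.insert_subset_iff, hi, hj, hk]) hcard
    (by simp only [Finset.mem_insert, Finset.mem_singleton]
        rintro (rfl | rfl | rfl) <;> contradiction) ?_
  · refine Submodule.mem_span_pair.mpr ⟨s, t, ?_⟩
    rw [← hsum]
    change _ = c 0 (X.c l) • _ + c 1 (X.c l) • _ + c 2 (X.c l) • _ + c 3 (X.c l) • _
    rw [h00, h01, h02, h03]
    simp only [x, y]
    module
  · simp only [Finset.mem_insert, Finset.mem_singleton]
    rintro _ (rfl | rfl | rfl)
    · exact ⟨y, Submodule.subset_span (by simp), (F.hi _).mpr (by simp [y]), hy0⟩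
    · exact ⟨x, Submodule.subset_span (by simp), (F.hj _).mpr (by simp [x]), hx0⟩
    · refine ⟨x - y, sub_mem (Submodule.subset_span (by simp)) (Submodule.subset_span (by simp)),
        (F.hk _).mpr (by simp [x, y]), fun h => ?_⟩
      have := LinearIndependent.pair_iff.mp hxy 1 (-1) (by rw [one_smul, neg_one_smul, ← sub_eq_add_neg, h])
      simp at this

lemma eventually_quad (h : X.GoodOn A w) (hl : l ∉ A) :
    ∀ᶠ z in generic, ∀ i ∈ A, ∀ j ∈ A, ∀ k ∈ A, i ≠ j → i ≠ k → j ≠ k →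
      Module.finrank ℂ (X.𝓛 (Function.update w l z) l) = 2 →
      Disjoint (X.𝓛 (Function.update w l z) l) (X.𝓛 (Function.update w l z) j) →
      X.TwoTransversals (Function.update w l z) i j k l := by
  refine (Filter.eventually_all_finset A).mpr fun i hi =>
    (Filter.eventually_all_finset A).mpr fun j hj =>
    (Filter.eventually_all_finset A).mpr fun k hk => ?_
  by_cases hne : i ≠ j ∧ i ≠ k ∧ j ≠ k
  swap
  · exact Filter.Eventually.of_forall fun z h1 h2 h3 => absurd ⟨h1, h2, h3⟩ hne
  obtain ⟨hij, hik, hjk⟩ := hne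
  obtain ⟨F⟩ := exists_frame_triple hij hik hjk (X := X) (w := w) (fun y hy => h.finrank (by
      simp only [Finset.mem_insert, Finset.mem_singleton] at hy
      rcases hy with rfl | rfl | rfl <;> assumption))
    (h.pair i hi j hj hij) (h.pair i hi k hk hik) (h.pair j hj k hk hjk)
  have hne : ∀ x ∈ A, x ≠ l := fun x hx hxl => hl (hxl ▸ hx)
  refine (F.eventually_disc (disc_aux h hl hi hj hk F)).mono fun z hz _ _ _ hf hd => ?_
  exact F.twoTransversals (𝓛_update_of_ne (hne i hi)) (𝓛_update_of_ne (hne j hj))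
    (𝓛_update_of_ne (hne k hk)) hf hd (by rwa [Function.update_self])

end GoodOn

end CameraData

namespace CameraData

variable {m : ℕ} {X : CameraData m} {w : Fin m → Vec4} {B A : Finset (Fin m)} {i j k l : Fin m}
  {z : Vec4}

namespace GoodOn

lemma exists_update (hX : X.General) (h : X.GoodOn A w) (hl : l ∉ A) :
    ∃ z, X.GoodOn (insert l A) (Function.update w l z) := by
  obtain ⟨z, z1, z2, z3, z4, z5⟩ := ((eventually_indep (X := X) l).and
    ((eventually_pair (X := X) l w).and ((eventually_center hX h l).and ((eventually_quint h l).and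
      (eventually_quad h hl))))).exists
  have hne : ∀ x ∈ A, x ≠ l := fun x hx hxl => hl (hxl ▸ hx)
  have hind : ∀ a ∈ insert l A, ∀ n n', Function.update w l z a ∉
      Submodule.span ℂ {X.c n, X.c n'} ⊔ Submodule.span ℂ {X.c a} := by
    intro a ha
    rcases Finset.mem_insert.mp ha with rfl | ha
    · rw [Function.update_self]; exact z1
    · rw [Function.update_of_ne (hne a ha)]; exact h.indep a ha
  have hfl : Module.finrank ℂ (X.𝓛 (Function.update w l z) l) = 2 := by
    rw [𝓛, Set.pair_comm, Submodule.span_insert, sup_comm, finrank_sup_span_singleton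
      (fun hw => hind l (Finset.mem_insert_self _ _) l l (Submodule.mem_sup_right hw)),
      finrank_span_singleton (c_ne_zero l)]
  have hdl : ∀ a ∈ A, Disjoint (X.𝓛 (Function.update w l z) l) (X.𝓛 (Function.update w l z) a) := by
    intro a ha
    rw [Submodule.disjoint_def]
    intro x hx hxa
    by_contra hx0
    rw [𝓛_update_of_ne (hne a ha)] at hxa
    exact c_notMem_𝓛 hX h ha (hne a ha).symm (c_mem_of_meets_update ⟨x, hxa, hx, hx0⟩ (z2 a))
  have hpair : ∀ a ∈ insert l A, ∀ b ∈ insert l A, a ≠ b →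
      Disjoint (X.𝓛 (Function.update w l z) a) (X.𝓛 (Function.update w l z) b) := by
    intro a ha b hb hab
    rcases Finset.mem_insert.mp ha with rfl | ha' <;> rcases Finset.mem_insert.mp hb with rfl | hb'
    · exact absurd rfl hab
    · exact hdl b hb'
    · exact (hdl a ha').symm
    · rw [𝓛_update_of_ne (hne a ha'), 𝓛_update_of_ne (hne b hb')]
      exact h.pair a ha' b hb' hab
  have hlast : ∀ i ∈ A, ∀ j ∈ A, ∀ k ∈ A, i ≠ j → i ≠ k → j ≠ k →
      X.TwoTransversals (Function.update w l z) i j k l := fun i hi j hj k hk hij hik hjk =>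
    z5 i hi j hj k hk hij hik hjk hfl (hdl j hj)
  have hm : ∀ {N : Submodule ℂ Vec4} {x}, x ∈ A →
      (X.Meets (Function.update w l z) N x ↔ X.Meets w N x) := fun hx => meets_update (hne _ hx)
  have memA : ∀ {x}, x ∈ insert l A → x ≠ l → x ∈ A := fun hx hxl =>
    (Finset.mem_insert.mp hx).resolve_left hxl
  have hli := Finset.mem_insert_self l A
  have hthird : ∀ i ∈ A, ∀ j ∈ A, ∀ k ∈ A, i ≠ j → i ≠ k → j ≠ k →
      X.TwoTransversals (Function.update w l z) i j l k := fun i hi j hj k hk hij hik hjk =>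
    (hlast i hi j hj k hk hij hik hjk).swap_kl
      (hpair i (Finset.mem_insert_of_mem hi) l hli (hne i hi))
      (hpair j (Finset.mem_insert_of_mem hj) k (Finset.mem_insert_of_mem hk) hjk)
  have hfirst : ∀ i ∈ A, ∀ j ∈ A, ∀ k ∈ A, i ≠ j → i ≠ k → j ≠ k →
      X.TwoTransversals (Function.update w l z) l i j k := fun i hi j hj k hk hij hik hjk =>
    (hthird j hj i hi k hk hij.symm hjk hik).swap_ik
  refine ⟨z, hind, hpair, ?_, ?_, ?_⟩
  · intro i hi j hj k hk x hx hij hik hjk hxi hxj hxk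
    by_cases hil : i = l
    · subst hil
      exact hfirst j (memA hj hij.symm) k (memA hk hik.symm) x (memA hx hxi) hjk hxj.symm hxk.symm
    by_cases hjl : j = l
    · subst hjl
      exact (hfirst i (memA hi hil) k (memA hk hjk.symm) x (memA hx hxj) hik hxi.symm
        hxk.symm).swap_ij (hpair _ hj _ hx hxj.symm) (hpair _ hi _ hk hik)
    by_cases hkl : k = l
    · subst hkl
      exact hthird i (memA hi hil) j (memA hj hjl) x (memA hx hxk) hij hxi.symm hxj.symm
    by_cases hxl : x = l
    · subst hxl
      exact hlast i (memA hi hil) j (memA hj hjl) k (memA hk hkl) hij hik hjk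
    obtain ⟨n, p, q, h1, h2, h3, h4, h5, h6⟩ := h.quad i (memA hi hil) j (memA hj hjl) k
      (memA hk hkl) x (memA hx hxl) hij hik hjk hxi hxj hxk
    refine ⟨n, p, q, h1, h2, ?_, ?_, ?_, ?_⟩ <;> rw [𝓛_update_of_ne (by assumption)] <;> assumption
  · intro N hN n hn s hs hcard hns hall
    by_cases hls : l ∈ s
    · have hs' : s.erase l ⊆ A := Finset.subset_insert_iff.mp hs
      obtain ⟨a, b, hab, hse⟩ := Finset.card_eq_two.mp (by
        rw [Finset.card_erase_of_mem hls, hcard] : (s.erase l).card = 2)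
      have hae : a ∈ s.erase l := by simp [hse]
      have hbe : b ∈ s.erase l := by simp [hse]
      have has := Finset.mem_of_mem_erase hae
      have hbs := Finset.mem_of_mem_erase hbe
      have haA := hs' hae
      have hbA := hs' hbe
      have hna : n ≠ a := fun h => hns (h ▸ has)
      have hnb : n ≠ b := fun h => hns (h ▸ hbs)
      have hnl : n ≠ l := fun h => hns (h ▸ hls)
      have ma := (hm haA).mp (hall a has)
      have mb := (hm hbA).mp (hall b hbs)
      have hcl := c_mem_of_meets_update (hall l hls)
        (z3 n a haA b hbA hab hna hnb N hN hn ma mb)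
      have hNs : N = Submodule.span ℂ {X.c n, X.c l} := by
        refine (Submodule.eq_of_le_of_finrank_eq (Submodule.span_le.mpr ?_) ?_).symm
        · rintro _ (rfl | rfl) <;> assumption
        · rw [Submodule.span_insert, sup_comm, finrank_sup_span_singleton (hX.pair n l hnl),
            finrank_span_singleton (c_ne_zero l), hN]
      refine hX.four N hN {n, a, b, l} ?_ ?_
      · rw [Finset.card_insert_of_notMem, Finset.card_insert_of_notMem, Finset.card_pair (hne b hbA)]
        · simp [hab, hne a haA]
        · simp [hna, hnb, hnl]
      · simp only [Finset.mem_insert, Finset.mem_singleton]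
        rintro _ (rfl | rfl | rfl | rfl)
        · exact hn
        · exact h.c_mem_of_meets haA hNs ma
        · exact h.c_mem_of_meets hbA hNs mb
        · exact hcl
    · have hs' : s ⊆ A := fun x hx => memA (hs hx) fun hxl => hls (hxl ▸ hx)
      exact h.center N hN n hn s hs' hcard hns fun j hj => (hm (hs' hj)).mp (hall j hj)
  · intro N hN s hs hcard hall
    by_cases hls : l ∈ s
    · have hs' : s.erase l ⊆ A := Finset.subset_insert_iff.mp hs
      obtain ⟨x, t, hxt, hxs, ht⟩ := Finset.card_eq_succ.mp (by
        rw [Finset.card_erase_of_mem hls, hcard] : (s.erase l).card = 3 + 1)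
      obtain ⟨i, j, k, hij, hik, hjk, rfl⟩ := Finset.card_eq_three.mp ht
      simp only [Finset.mem_insert, Finset.mem_singleton, not_or] at hxt
      rw [← hxs] at hs'
      have memA' : ∀ y ∈ ({x, i, j, k} : Finset (Fin m)), y ∈ A ∧ X.Meets w N y := fun y hy =>
        ⟨hs' hy, (hm (hs' hy)).mp (hall y (Finset.mem_of_mem_erase (hxs ▸ hy)))⟩
      obtain ⟨hiA, mi⟩ := memA' i (by simp)
      obtain ⟨hjA, mj⟩ := memA' j (by simp)
      obtain ⟨hkA, mk⟩ := memA' k (by simp)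
      obtain ⟨hxA, mx⟩ := memA' x (by simp)
      have hcl := c_mem_of_meets_update (hall l hls) (z4 i hiA j hjA k hkA x hxA hij hik hjk hxt.1
        hxt.2.1 hxt.2.2 N hN mi mj mk mx)
      refine h.center N hN l hcl {i, j, k} (fun y hy => hs' (Finset.mem_insert_of_mem hy)) ht
        (fun hlm => hl (hs' (Finset.mem_insert_of_mem hlm))) ?_
      simp only [Finset.mem_insert, Finset.mem_singleton]
      rintro _ (rfl | rfl | rfl) <;> assumption
    · have hs' : s ⊆ A := fun x hx => memA (hs hx) fun hxl => hls (hxl ▸ hx)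
      exact h.quint N hN s hs' hcard fun j hj => (hm (hs' hj)).mp (hall j hj)

lemma goodW (h : X.GoodOn Finset.univ w) : X.GoodW w where
  finrank j := h.finrank (Finset.mem_univ j)
  pair i j hij := h.pair i (Finset.mem_univ _) j (Finset.mem_univ _) hij
  triple i j k hij hik hjk := exists_frame_triple hij hik hjk
    (fun x _ => h.finrank (Finset.mem_univ x)) (h.pair i (Finset.mem_univ _) j (Finset.mem_univ _) hij)
    (h.pair i (Finset.mem_univ _) k (Finset.mem_univ _) hik)
    (h.pair j (Finset.mem_univ _) k (Finset.mem_univ _) hjk)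
  quad i j k l hij hik hjk hli hlj hlk := (h.quad i (Finset.mem_univ _) j (Finset.mem_univ _) k
    (Finset.mem_univ _) l (Finset.mem_univ _) hij hik hjk hli hlj hlk).exists_frame hij hik hjk
    (fun x _ => h.finrank (Finset.mem_univ x)) (h.pair i (Finset.mem_univ _) j (Finset.mem_univ _) hij)
    (h.pair i (Finset.mem_univ _) k (Finset.mem_univ _) hik)
    (h.pair j (Finset.mem_univ _) k (Finset.mem_univ _) hjk)
    (h.pair j (Finset.mem_univ _) l (Finset.mem_univ _) hlj.symm)
  center N hN n hn s hs hns := h.center N hN n hn s (Finset.subset_univ _) hs hns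
  quint N hN s hs := h.quint N hN s (Finset.subset_univ _) hs

end GoodOn

lemma exists_goodOn (hX : X.General) (A : Finset (Fin m)) : ∃ w, X.GoodOn A w := by
  induction A using Finset.induction_on with
  | empty =>
    refine ⟨0, by simp, by simp, by simp, fun N hN n hn s hs hcard => ?_, fun N hN s hs hcard => ?_⟩ <;>
    · rw [Finset.subset_empty.mp hs] at hcard
      simp at hcard
  | insert l A hl ih =>
    obtain ⟨w, hw⟩ := ih
    obtain ⟨z, hz⟩ := hw.exists_update hX hl
    exact ⟨_, hz⟩

lemma exists_goodW (hX : X.General) : ∃ w, X.GoodW w := by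
  obtain ⟨w, hw⟩ := exists_goodOn hX Finset.univ
  exact ⟨w, hw.goodW⟩

end CameraData

namespace CameraData

section Jacobian

variable {σ K : Type} [Fintype σ] [Field K] [Algebra ℂ K] (h : MvPolynomial σ ℂ →ₐ[ℂ] K)

/-- The `h`-derivation determined by its values on the variables, as a function of these values. -/
def deriv (f : MvPolynomial σ ℂ) : (σ → K) →ₗ[K] K :=
  ∑ s, h (pderiv s f) • LinearMap.proj s

lemma deriv_apply (f : MvPolynomial σ ℂ) (D : σ → K) : deriv h f D = ∑ s, h (pderiv s f) * D s := by
  simp [deriv]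

lemma deriv_add (f g : MvPolynomial σ ℂ) : deriv h (f + g) = deriv h f + deriv h g := by
  ext; simp [deriv, add_mul, Finset.sum_add_distrib]

lemma deriv_mul (f g : MvPolynomial σ ℂ) : deriv h (f * g) = h f • deriv h g + h g • deriv h f := by
  refine LinearMap.ext fun D => ?_
  simp only [deriv_apply, LinearMap.add_apply, LinearMap.smul_apply, Derivation.leibniz,
    smul_eq_mul, map_add, map_mul, Finset.mul_sum, ← Finset.sum_add_distrib]
  exact Finset.sum_congr rfl fun s _ => by ring

lemma deriv_C (a : ℂ) : deriv h (C a) = 0 := by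
  simp [deriv]

lemma deriv_smul (a : ℂ) (f : MvPolynomial σ ℂ) :
    deriv h (a • f) = algebraMap ℂ K a • deriv h f := by
  rw [smul_eq_C_mul, deriv_mul, deriv_C, smul_zero, add_zero, ← algebraMap_eq, AlgHom.commutes]

lemma deriv_X [DecidableEq σ] (s : σ) (D : σ → K) : deriv h (X s) D = D s := by
  rw [deriv_apply, Finset.sum_eq_single s]
  · simp
  · intro b _ hb
    simp [pderiv_X_of_ne hb.symm]
  · simp

lemma deriv_sum {ι : Type*} (t : Finset ι) (f : ι → MvPolynomial σ ℂ) :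
    deriv h (∑ i ∈ t, f i) = ∑ i ∈ t, deriv h (f i) := by
  classical
  induction t using Finset.induction_on with
  | empty => simpa using deriv_C h 0
  | insert a t ha ih => rw [Finset.sum_insert ha, Finset.sum_insert ha, deriv_add, ih]

/-- The `h`-derivations vanishing on the kernel of `h`. -/
def tangent : Submodule K (σ → K) where
  carrier := {D | ∀ f, h f = 0 → deriv h f D = 0}
  add_mem' hD hD' f hf := by simp [hD f hf, hD' f hf]
  zero_mem' f _ := by simp
  smul_mem' a D hD f hf := by simp [hD f hf]

/-- The number of variables is at most the height of a prime plus the dimension of the tangent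
space at its generic point. -/
theorem card_le_height_add_finrank_tangent (p : Ideal (MvPolynomial σ ℂ)) [p.IsPrime]
    (hp : ∀ f, h f = 0 ↔ f ∈ p) :
    (Fintype.card σ : ℕ∞) ≤ p.height + Module.finrank K (tangent h) := by
  classical
  let S := Localization.AtPrime p
  have hreg : IsRegularLocalRing S := inferInstance
  have h1 := (isRegularLocalRing_iff S).mp hreg
  rw [IsLocalization.AtPrime.ringKrullDim_eq_height p S] at h1
  have hfg : (IsLocalRing.maximalIdeal S).FG := IsNoetherian.noetherian _
  obtain ⟨t, htc, ht⟩ := Submodule.FG.exists_span_set_encard_eq_spanFinrank hfg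
  have htfin : t.Finite := by
    rw [← Set.encard_ne_top_iff, htc]; exact ENat.natCast_ne_top _
  have key : ∀ x : S, ∃ f ∈ (if x ∈ IsLocalRing.maximalIdeal S then (p : Ideal _) else ⊤),
      ∃ u : S, IsUnit u ∧ u * x = algebraMap _ S f := by
    intro x
    obtain ⟨⟨f, s⟩, hf⟩ := IsLocalization.surj p.primeCompl x
    refine ⟨f, ?_, algebraMap (MvPolynomial σ ℂ) S s, IsLocalization.map_units S s, by rw [mul_comm]; exact hf⟩
    split_ifs with hx
    · rw [← IsLocalization.AtPrime.to_map_mem_maximal_iff S p, ← hf]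
      exact Ideal.mul_mem_right _ _ hx
    · trivial
  choose F hF u hu huF using key
  have := htfin.fintype
  let Φ : (σ → K) →ₗ[K] (t → K) := LinearMap.pi fun x => deriv h (F x)
  have hspan : Ideal.map (algebraMap _ S) (Ideal.span (F '' t)) = IsLocalRing.maximalIdeal S := by
    rw [Ideal.map_span, ← ht]
    apply le_antisymm
    · rw [Ideal.span_le]
      rintro _ ⟨_, ⟨x, hx, rfl⟩, rfl⟩
      rw [← huF]
      exact Ideal.mul_mem_left _ _ (Ideal.subset_span hx)
    · change Ideal.span t ≤ _
      rw [Ideal.span_le]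
      intro x hx
      have : algebraMap _ S (F x) ∈ Ideal.span (algebraMap _ S '' (F '' t)) :=
        Ideal.subset_span ⟨_, ⟨x, hx, rfl⟩, rfl⟩
      rw [← huF] at this
      exact (Ideal.unit_mul_mem_iff_mem _ (hu x)).mp this
  have hker : LinearMap.ker Φ ≤ tangent h := by
    intro D hD f hf
    have hf' : algebraMap _ S f ∈ IsLocalRing.maximalIdeal S :=
      (IsLocalization.AtPrime.to_map_mem_maximal_iff S p f).mpr ((hp f).mp hf)
    rw [← hspan, IsLocalization.algebraMap_mem_map_algebraMap_iff p.primeCompl] at hf'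
    obtain ⟨s, hs, hsf⟩ := hf'
    have hzero : ∀ g ∈ Ideal.span (F '' t), deriv h g D = 0 ∧ h g = 0 := by
      intro g hg
      induction hg using Submodule.span_induction with
      | mem g hg =>
        obtain ⟨x, hx, rfl⟩ := hg
        refine ⟨congrFun (LinearMap.mem_ker.mp hD) ⟨x, hx⟩, (hp _).mpr ?_⟩
        have := hF x
        rwa [if_pos] at this
        rw [← ht]
        exact Submodule.subset_span hx
      | zero => exact ⟨by simpa using congrArg (fun l => l D) (deriv_C h 0), map_zero h⟩
      | add g g' _ _ hg hg' => simp [deriv_add, hg, hg']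
      | smul a g _ hg => simp [deriv_mul, hg]
    have h2 := (hzero _ hsf).1
    rw [deriv_mul, LinearMap.add_apply, LinearMap.smul_apply, LinearMap.smul_apply, hf, zero_smul,
      add_zero, smul_eq_mul, mul_eq_zero] at h2
    exact h2.resolve_left fun h3 => hs ((hp s).mp h3)
  have h3 := LinearMap.finrank_range_add_finrank_ker Φ
  have h4 := Submodule.finrank_le (LinearMap.range Φ)
  have h5 := Submodule.finrank_mono hker
  rw [Module.finrank_fintype_fun_eq_card] at h3 h4
  have h6 : (Fintype.card t : ℕ∞) = p.height := by
    have : ((Fintype.card t : ℕ∞) : WithBot ℕ∞) = (p.height : WithBot ℕ∞) := by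
      rw [← h1, Set.coe_fintypeCard, htc]
      rfl
    exact_mod_cast this
  rw [← h6]
  norm_cast
  omega

end Jacobian

end CameraData

namespace CameraData

variable {m : ℕ} (X : CameraData m)

section Tangent

variable {K : Type} [Field K] [Algebra ℂ K] (h : LineRing m →ₐ[ℂ] K)

/-- The `j`-th column of `M(ℓ)` evaluated at a point. -/
def col (j : Fin m) : Fin 4 → K := fun r => h (MmatPoly X.cam r j)

/-- A center viewed over an extension field. -/
def cK (K : Type) [Field K] [Algebra ℂ K] (v : Vec4) : Fin 4 → K := fun r => algebraMap ℂ K (v r)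

lemma deriv_L (j : Fin m) (φ : Vec4) (D : Fin 3 × Fin m → K) :
    deriv h (X.L j φ) D = ∑ r, algebraMap ℂ K (φ r) * deriv h (MmatPoly X.cam r j) D := by
  rw [L_eq_sum, deriv_sum, LinearMap.sum_apply]
  exact Finset.sum_congr rfl fun r _ => by rw [deriv_smul]; rfl

/-- The vectors of `K⁴` orthogonal to a subspace. -/
def orth (W : Submodule K (Fin 4 → K)) : Submodule K (Fin 4 → K) where
  carrier := {z | ∀ x ∈ W, x ⬝ᵥ z = 0}
  add_mem' hz hz' x hx := by simp [hz x hx, hz' x hx]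
  zero_mem' x _ := by simp
  smul_mem' a z hz x hx := by simp [hz x hx]

omit [Algebra ℂ K] in
lemma mem_orth {W : Submodule K (Fin 4 → K)} {z : Fin 4 → K} :
    z ∈ orth W ↔ ∀ x ∈ W, x ⬝ᵥ z = 0 := Iff.rfl

omit [Algebra ℂ K] in
lemma finrank_orth (W : Submodule K (Fin 4 → K)) :
    Module.finrank K W + Module.finrank K (orth W) = 4 := by
  let e := (dotProductEquiv K (Fin 4))
  have h1 : W.dualAnnihilator = (orth W).map e.toLinearMap := by
    ext f
    rw [Submodule.mem_dualAnnihilator, Submodule.mem_map]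
    constructor
    · intro hf
      refine ⟨e.symm f, fun x hx => ?_, e.apply_symm_apply f⟩
      rw [dotProduct_comm]
      have : e (e.symm f) x = 0 := by rw [e.apply_symm_apply]; exact hf x hx
      exact this
    · rintro ⟨z, hz, rfl⟩ x hx
      have := hz x hx
      rw [dotProduct_comm] at this
      exact this
  have h2 := Subspace.finrank_add_finrank_dualAnnihilator_eq W
  rw [h1, LinearEquiv.finrank_map_eq e] at h2
  simpa using h2

/-- A bound on the tangent space at a point where `M(ℓ)` is orthogonal to a plane `W`, in terms of
the possible first-order motions of `W`. -/
lemma finrank_tangent_le {W : Submodule K (Fin 4 → K)} (y : Fin 2 → Fin 4 → LineRing m)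
    (hy : W = Submodule.span K (Set.range fun i r => h (y i r)))
    (hW : ∀ x ∈ W, ∀ j, x ⬝ᵥ X.col h j = 0)
    (U : Fin 2 → Submodule K ((Fin 4 → K) ⧸ W))
    (hU : ∀ i, ∀ D ∈ tangent h, W.mkQ (fun r => deriv h (y i r) D) ∈ U i) :
    Module.finrank K (tangent h) ≤ ∑ i, Module.finrank K (U i) +
      ∑ j, Module.finrank K (orth (W ⊔ Submodule.span K {cK K (X.c j)})) := by
  classical
  let Φ : tangent h →ₗ[K] (∀ i, U i) := LinearMap.pi fun i =>
    LinearMap.codRestrict (U i) (W.mkQ ∘ₗ LinearMap.pi (fun r => deriv h (y i r)) ∘ₗ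
      (tangent h).subtype) fun D => hU i D D.2
  have hcol : ∀ D ∈ LinearMap.ker Φ, ∀ j, (fun r => deriv h (MmatPoly X.cam r j) D) ∈
      orth (W ⊔ Submodule.span K {cK K (X.c j)}) := by
    intro D hD j
    have hD' : ∀ i, (fun r => deriv h (y i r) (D : Fin 3 × Fin m → K)) ∈ W := by
      intro i
      have := congrArg Subtype.val (congrFun (LinearMap.mem_ker.mp hD) i)
      exact (Submodule.Quotient.mk_eq_zero W).mp this
    have h1 : W ⊔ Submodule.span K {cK K (X.c j)} = Submodule.span K
        ((Set.range fun i r => h (y i r)) ∪ {cK K (X.c j)}) := by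
      rw [Submodule.span_union, ← hy]
    rw [mem_orth, h1]
    intro x hx
    induction hx using Submodule.span_induction with
    | mem x hx =>
      rcases hx with ⟨i, rfl⟩ | rfl
      · have h2 : h (∑ r, y i r * MmatPoly X.cam r j) = 0 := by
          rw [map_sum]
          have := hW (fun r => h (y i r)) (by rw [hy]; exact Submodule.subset_span ⟨i, rfl⟩) j
          simpa [dotProduct, col] using this
        have h3 := D.2 _ h2
        rw [deriv_sum, LinearMap.sum_apply] at h3
        have h4 := hW _ (hD' i) j
        simp only [deriv_mul, LinearMap.add_apply, LinearMap.smul_apply, smul_eq_mul,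
          Finset.sum_add_distrib] at h3
        simp only [dotProduct, col] at h4 ⊢
        rw [← h3, left_eq_add, ← h4]
        exact Finset.sum_congr rfl fun r _ => mul_comm _ _
      · have := X.deriv_L h j (X.c j) D
        rw [L_c, ← C_0, deriv_C] at this
        exact this.symm
    | zero => simp
    | add x x' _ _ hx hx' => rw [add_dotProduct, hx, hx', add_zero]
    | smul a x _ hx => rw [smul_dotProduct, hx, smul_zero]
  let Ψ : LinearMap.ker Φ →ₗ[K] (∀ j, orth (W ⊔ Submodule.span K {cK K (X.c j)})) :=
    LinearMap.pi fun j => LinearMap.codRestrict _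
      (LinearMap.pi (fun r => deriv h (MmatPoly X.cam r j)) ∘ₗ (tangent h).subtype ∘ₗ
        (LinearMap.ker Φ).subtype) fun D => hcol D D.2 j
  have hΨ : Function.Injective Ψ := by
    intro D D' hD
    ext ⟨i, j⟩
    obtain ⟨φ, hφ⟩ := X.exists_L_eq_X i j
    have h1 := X.deriv_L h j φ (D : tangent h)
    have h2 := X.deriv_L h j φ (D' : tangent h)
    rw [hφ, deriv_X] at h1 h2
    rw [h1, h2]
    refine Finset.sum_congr rfl fun r _ => ?_
    have h3 := congrFun (congrArg Subtype.val (congrFun hD j)) r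
    rw [show deriv h (MmatPoly X.cam r j) (D : tangent h) =
      deriv h (MmatPoly X.cam r j) (D' : tangent h) from h3]
  have h1 := LinearMap.finrank_range_add_finrank_ker Φ
  have h2 := Submodule.finrank_le (LinearMap.range Φ)
  have h3 := LinearMap.finrank_le_finrank_of_injective hΨ
  rw [Module.finrank_pi_fintype] at h2 h3
  omega

/-- Independence of complex vectors is preserved by extension of scalars. -/
lemma mem_span_of_cK_mem_span {S : Set Vec4} {v : Vec4}
    (hv : cK K v ∈ Submodule.span K (cK K '' S)) : v ∈ Submodule.span ℂ S := by
  by_contra hn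
  obtain ⟨f, hf, hf'⟩ := Submodule.exists_dual_map_eq_bot_of_notMem hn inferInstance
  let g := (dotProductEquiv ℂ (Fin 4)).symm f
  have hg : ∀ w, f w = g ⬝ᵥ w := fun w => by
    conv_lhs => rw [← (dotProductEquiv ℂ (Fin 4)).apply_symm_apply f]
    rfl
  have hK : ∀ w, cK K g ⬝ᵥ cK K w = algebraMap ℂ K (f w) := fun w => by
    simp [hg, dotProduct, cK]
  have h1 : ∀ x ∈ Submodule.span K (cK K '' S), cK K g ⬝ᵥ x = 0 := by
    intro x hx
    induction hx using Submodule.span_induction with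
    | mem x hx =>
      obtain ⟨w, hw, rfl⟩ := hx
      have : f w ∈ (Submodule.span ℂ S).map f := ⟨w, Submodule.subset_span hw, rfl⟩
      rw [hf', Submodule.mem_bot] at this
      rw [hK, this, map_zero]
    | zero => simp
    | add x x' _ _ hx hx' => rw [dotProduct_add, hx, hx', add_zero]
    | smul a x _ hx => rw [dotProduct_smul, hx, smul_zero]
  have h2 := h1 _ hv
  rw [hK] at h2
  exact hf (by simpa using h2)

end Tangent

end CameraData

namespace CameraData

variable {m : ℕ} (X : CameraData m)

section Tangent

variable {K : Type} [Field K] [Algebra ℂ K] (h : LineRing m →ₐ[ℂ] K)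

lemma finrank_span_col_le (hI : X.I ≤ RingHom.ker h) :
    Module.finrank K (Submodule.span K (Set.range (X.col h))) ≤ 2 := by
  by_contra! hlt
  obtain ⟨f, hf, -, hli⟩ := Submodule.exists_fun_fin_finrank_span_eq K (Set.range (X.col h))
  have h3 : 3 ≤ Module.finrank K (Submodule.span K (Set.range (X.col h))) := hlt
  choose ci hci using fun i => hf (Fin.castLE h3 i)
  let N : Matrix (Fin 3) (Fin 4) K := Matrix.of fun i => X.col h (ci i)
  have hN : LinearIndependent K N.row := by
    rw [show N.row = f ∘ Fin.castLE h3 from funext hci]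
    exact hli.comp _ (Fin.castLE_injective h3)
  have hrank : N.transpose.rank = 3 := by
    rw [Matrix.rank_transpose, hN.rank_matrix, Fintype.card_fin]
  rw [Matrix.rank_eq_finrank_span_row] at hrank
  obtain ⟨g, hg, -, hgli⟩ := Submodule.exists_fun_fin_finrank_span_eq K (Set.range N.transpose.row)
  choose ri hri using fun i => hg (Fin.cast hrank.symm i)
  let A : Matrix (Fin 3) (Fin 3) K := Matrix.of fun p q => X.col h (ci q) (ri p)
  have hA : LinearIndependent K A.row := by
    rw [show A.row = g ∘ Fin.cast hrank.symm from funext hri]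
    exact hgli.comp _ (Fin.cast_injective hrank.symm)
  have hri' : Function.Injective ri := fun p q hpq => by
    apply hA.injective
    ext r
    simp [A, hpq]
  have hci' : Function.Injective ci := fun p q hpq => by
    apply hN.injective
    ext r
    simp [N, hpq]
  have hmem : ((MmatPoly X.cam).submatrix ri ci).det ∈ X.I :=
    Ideal.subset_span ⟨ri, ci, hri', hci', rfl⟩
  have h0 : h ((MmatPoly X.cam).submatrix ri ci).det = 0 := hI hmem
  rw [AlgHom.map_det] at h0
  have hu := (Matrix.isUnit_iff_isUnit_det A).mp (Matrix.linearIndependent_rows_iff_isUnit.mp hA)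
  refine hu.ne_zero ?_
  rw [← h0]
  rfl

omit [Algebra ℂ K] in
lemma finrank_orth_sup_le {W : Submodule K (Fin 4 → K)} (hW : Module.finrank K W = 2)
    (v : Fin 4 → K) [Decidable (v ∈ W)] :
    Module.finrank K (orth (W ⊔ Submodule.span K {v})) ≤ 1 + if v ∈ W then 1 else 0 := by
  have h1 := finrank_orth (W ⊔ Submodule.span K {v})
  split_ifs with hv
  · have := Submodule.finrank_mono (le_sup_left : W ≤ W ⊔ Submodule.span K {v})
    omega
  · have : W < W ⊔ Submodule.span K {v} := by
      refine lt_of_le_of_ne le_sup_left fun he => hv ?_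
      rw [he]
      exact Submodule.mem_sup_right (Submodule.mem_span_singleton_self v)
    have := Submodule.finrank_lt_finrank_of_lt this
    omega

open Classical in
lemma finrank_tangent_le_card {W : Submodule K (Fin 4 → K)} (hW2 : Module.finrank K W = 2)
    (y : Fin 2 → Fin 4 → LineRing m)
    (hy : W = Submodule.span K (Set.range fun i r => h (y i r)))
    (hW : ∀ x ∈ W, ∀ j, x ⬝ᵥ X.col h j = 0) (s : Finset (Fin 2))
    (hs : ∀ i ∈ s, ∀ r, deriv h (y i r) = 0) :
    Module.finrank K (tangent h) ≤ 2 * (2 - s.card) +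
      (m + (Finset.univ.filter fun j => cK K (X.c j) ∈ W).card) := by
  have hq : Module.finrank K ((Fin 4 → K) ⧸ W) = 2 := by
    have := Submodule.finrank_quotient_add_finrank W
    rw [hW2] at this
    simpa using this
  refine (X.finrank_tangent_le h y hy hW (fun i => if i ∈ s then ⊥ else ⊤) ?_).trans
    (Nat.add_le_add ?_ ?_)
  · intro i D _
    split_ifs with hi
    · rw [Submodule.mem_bot, Submodule.mkQ_apply, Submodule.Quotient.mk_eq_zero]
      convert W.zero_mem using 1
      ext r
      simp [hs i hi r]
    · trivial
  · have h1 : ∀ i : Fin 2, Module.finrank K ↥(if i ∈ s then ⊥ else ⊤ :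
        Submodule K ((Fin 4 → K) ⧸ W)) = if i ∈ sᶜ then 2 else 0 := by
      intro i
      by_cases hi : i ∈ s
      · simp [hi]
      · rw [if_neg hi, if_pos (Finset.mem_compl.mpr hi), finrank_top, hq]
    rw [Finset.sum_congr rfl fun i _ => h1 i, Finset.sum_ite_mem, Finset.univ_inter,
      Finset.sum_const, Finset.card_compl, Fintype.card_fin, smul_eq_mul, mul_comm]
  · refine (Finset.sum_le_sum fun j _ => finrank_orth_sup_le hW2 _).trans ?_
    rw [Finset.sum_add_distrib, Finset.card_filter, Finset.sum_const, Finset.card_univ,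
      Fintype.card_fin, smul_eq_mul, mul_one]

omit [Algebra ℂ K] in
lemma exists_mem_notMem_span {W : Submodule K (Fin 4 → K)} (hW : 2 ≤ Module.finrank K W)
    (v : Fin 4 → K) : ∃ x ∈ W, x ∉ Submodule.span K {v} := by
  by_contra! hle
  have h1 := Submodule.finrank_mono (show W ≤ Submodule.span K {v} from hle)
  have h2 := finrank_span_le_card (R := K) ({v} : Set (Fin 4 → K))
  simp at h2
  omega

omit [Algebra ℂ K] in
lemma finrank_span_range_pair {x : Fin 2 → Fin 4 → K} (h0 : x 0 ≠ 0)
    (h1 : x 1 ∉ Submodule.span K {x 0}) :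
    Module.finrank K (Submodule.span K (Set.range x)) = 2 := by
  have : LinearIndependent K ![x 0, x 1] :=
    (LinearIndependent.pair_iff' h0).mpr fun a ha => h1 (Submodule.mem_span_singleton.mpr ⟨a, ha⟩)
  rw [finrank_span_eq_card (b := x) (by convert this; ext i : 1; fin_cases i <;> rfl),
    Fintype.card_fin]

lemma cK_C (v : Vec4) : (fun r => h (C (v r))) = cK K v := by
  ext r
  rw [← algebraMap_eq, AlgHom.commutes]
  rfl

lemma cK_ne_zero {v : Vec4} (hv : v ≠ 0) : cK K v ≠ 0 := fun h0 => hv <| by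
  ext r
  have := congrFun h0 r
  simpa [cK] using this

/-- The tangent space at a point of the multiview variety has dimension at most `m + 4`. -/
theorem finrank_tangent_le_add_four (hX : X.General) (hI : X.I ≤ RingHom.ker h)
    (hfrac : ∀ x : Fin 4 → K, ∃ s : K, s ≠ 0 ∧ ∃ y : Fin 4 → LineRing m, ∀ r, h (y r) = s * x r) :
    Module.finrank K (tangent h) ≤ m + 4 := by
  classical
  obtain ⟨W₀, hW⟩ : ∃ W, W = orth (Submodule.span K (Set.range (X.col h))) := ⟨_, rfl⟩
  have hW₀ : 2 ≤ Module.finrank K W₀ := by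
    have h1 := finrank_orth (Submodule.span K (Set.range (X.col h)))
    have h2 := X.finrank_span_col_le h hI
    rw [← hW] at h1
    omega
  have hperp : ∀ x ∈ W₀, ∀ j, x ⬝ᵥ X.col h j = 0 := fun x hx j => by
    rw [dotProduct_comm]
    exact (hW ▸ hx) _ (Submodule.subset_span ⟨j, rfl⟩)
  have hsub : ∀ {x : Fin 2 → Fin 4 → K}, (∀ i, x i ∈ W₀) → Submodule.span K (Set.range x) ≤ W₀ :=
    fun hx => Submodule.span_le.mpr (Set.range_subset_iff.mpr hx)
  have hc0 : ∀ j, cK K (X.c j) ≠ 0 := fun j => cK_ne_zero (X.isCenter j).1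
  by_cases h2 : ∃ a b, a ≠ b ∧ cK K (X.c a) ∈ W₀ ∧ cK K (X.c b) ∈ W₀
  · obtain ⟨a, b, hab, ha, hb⟩ := h2
    let x : Fin 2 → Fin 4 → K := ![cK K (X.c a), cK K (X.c b)]
    have hx : ∀ i, x i ∈ W₀ := by intro i; fin_cases i <;> assumption
    let y : Fin 2 → Fin 4 → LineRing m := ![fun r => C (X.c a r), fun r => C (X.c b r)]
    have hspan : Set.range x = cK K '' {X.c a, X.c b} := by
      rw [Set.image_pair, Matrix.range_cons, Matrix.range_cons, Matrix.range_empty, Set.union_empty]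
      rfl
    have hdim : Module.finrank K (Submodule.span K (Set.range x)) = 2 :=
      finrank_span_range_pair (hc0 a) fun hmem => hX.pair b a hab.symm <|
        mem_span_of_cK_mem_span (K := K) (by rwa [Set.image_singleton])
    have h3 := X.finrank_tangent_le_card h (W := Submodule.span K (Set.range x)) hdim y
      (by
        congr 2
        ext i : 1
        fin_cases i
        · exact (cK_C h _).symm
        · exact (cK_C h _).symm)
      (fun v hv => hperp v (hsub hx hv)) Finset.univ
      (fun i _ r => by fin_cases i <;> exact deriv_C h _)
    have hcard : (Finset.univ.filter fun j => cK K (X.c j) ∈ Submodule.span K (Set.range x)).card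
        ≤ 3 := by
      by_contra! hlt
      obtain ⟨t, ht, htc⟩ := Finset.exists_subset_card_eq (Nat.succ_le_of_lt hlt)
      have hN : Module.finrank ℂ (Submodule.span ℂ {X.c a, X.c b}) = 2 := by
        have := finrank_span_range_pair (x := ![X.c a, X.c b]) (X.isCenter a).1
          (hX.pair b a hab.symm)
        rwa [Matrix.range_cons, Matrix.range_cons, Matrix.range_empty, Set.union_empty] at this
      refine hX.four _ hN t htc fun j hj => mem_span_of_cK_mem_span (K := K) ?_
      rw [← hspan]
      exact (Finset.mem_filter.mp (ht hj)).2
    simp only [Finset.card_univ, Fintype.card_fin] at h3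
    omega
  push Not at h2
  have clear : ∀ x : Fin 4 → K, ∃ s : K, s ≠ 0 ∧ ∃ y : Fin 4 → LineRing m,
      (fun r => h (y r)) = s • x := fun x => by
    obtain ⟨s, hs, y, hy⟩ := hfrac x
    exact ⟨s, hs, y, funext hy⟩
  by_cases h1 : ∃ a, cK K (X.c a) ∈ W₀
  · obtain ⟨a, ha⟩ := h1
    obtain ⟨v, hv, hva⟩ := exists_mem_notMem_span hW₀ (cK K (X.c a))
    obtain ⟨s, hs, y, hy⟩ := clear v
    let x : Fin 2 → Fin 4 → K := ![cK K (X.c a), s • v]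
    have hx : ∀ i, x i ∈ W₀ := by
      intro i
      fin_cases i
      · exact ha
      · exact W₀.smul_mem s hv
    have h3 := X.finrank_tangent_le_card h (W := Submodule.span K (Set.range x))
      (finrank_span_range_pair (hc0 a) fun hmem => hva ((Submodule.smul_mem_iff _ hs).mp hmem))
      ![fun r => C (X.c a r), y]
      (by
        congr 2
        ext i : 1
        fin_cases i
        · exact (cK_C h _).symm
        · exact hy.symm)
      (fun v hv => hperp v (hsub hx hv)) {0}
      (fun i hi r => by
        rw [Finset.mem_singleton.mp hi]
        exact deriv_C h _)
    have hcard : (Finset.univ.filter fun j => cK K (X.c j) ∈ Submodule.span K (Set.range x)).card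
        ≤ 1 := by
      refine Finset.card_le_one.mpr fun j hj j' hj' => ?_
      by_contra hne
      exact h2 j j' hne (hsub hx (Finset.mem_filter.mp hj).2) (hsub hx (Finset.mem_filter.mp hj').2)
    rw [Finset.card_singleton] at h3
    omega
  · push Not at h1
    obtain ⟨u, hu, hu0⟩ := exists_mem_notMem_span hW₀ 0
    obtain ⟨v, hv, hvu⟩ := exists_mem_notMem_span hW₀ u
    have hu0 : u ≠ 0 := fun h0 => hu0 (by simp [h0])
    obtain ⟨s, hs, y, hy⟩ := clear u
    obtain ⟨t, ht, z, hz⟩ := clear v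
    let x : Fin 2 → Fin 4 → K := ![s • u, t • v]
    have hx : ∀ i, x i ∈ W₀ := by
      intro i
      fin_cases i
      · exact W₀.smul_mem s hu
      · exact W₀.smul_mem t hv
    have h3 := X.finrank_tangent_le_card h (W := Submodule.span K (Set.range x))
      (finrank_span_range_pair (smul_ne_zero hs hu0) fun hmem => hvu <| by
        have := (Submodule.smul_mem_iff _ ht).mp hmem
        rwa [show x 0 = s • u from rfl, Submodule.span_singleton_smul_eq hs.isUnit] at this)
      ![y, z]
      (by
        congr 2
        ext i : 1
        fin_cases i
        · exact hy.symm
        · exact hz.symm)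
      (fun v hv => hperp v (hsub hx hv)) ∅ (by simp)
    have hcard : (Finset.univ.filter fun j => cK K (X.c j) ∈ Submodule.span K (Set.range x)).card
        = 0 := by
      refine Finset.card_eq_zero.mpr (Finset.filter_eq_empty_iff.mpr fun j _ hj => h1 j (hsub hx hj))
    rw [Finset.card_empty] at h3
    omega

end Tangent

/-- Every prime containing the ideal of minors has height at least `2m - 4`. -/
theorem le_height (hX : X.General) (p : Ideal (LineRing m)) [p.IsPrime] (hp : X.I ≤ p) :
    ((2 * m - 4 : ℕ) : ℕ∞) ≤ p.height := by
  let K := FractionRing (LineRing m ⧸ p)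
  let h : LineRing m →ₐ[ℂ] K :=
    (IsScalarTower.toAlgHom ℂ (LineRing m ⧸ p) K).comp (Ideal.Quotient.mkₐ ℂ p)
  have hh : ∀ f, h f = 0 ↔ f ∈ p := fun f => by
    change algebraMap (LineRing m ⧸ p) K (Ideal.Quotient.mk p f) = 0 ↔ _
    rw [FaithfulSMul.algebraMap_eq_zero_iff, Ideal.Quotient.eq_zero_iff_mem]
  have h1 := card_le_height_add_finrank_tangent h p hh
  have h2 := X.finrank_tangent_le_add_four h hX (fun f hf => (hh f).mpr (hp hf)) fun x => by
    obtain ⟨s, hs⟩ := IsLocalization.exist_integer_multiples_of_finite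
      (nonZeroDivisors (LineRing m ⧸ p)) x
    refine ⟨algebraMap (LineRing m ⧸ p) K s, IsFractionRing.to_map_ne_zero_of_mem_nonZeroDivisors s.2, ?_⟩
    choose z hz using hs
    choose y hy using fun r => Ideal.Quotient.mk_surjective (z r)
    refine ⟨y, fun r => ?_⟩
    change algebraMap (LineRing m ⧸ p) K (Ideal.Quotient.mk p (y r)) = _
    rw [hy, hz]
    exact Algebra.smul_def _ _
  rw [Fintype.card_prod, Fintype.card_fin, Fintype.card_fin] at h1
  obtain htop | hfin := eq_or_ne p.height ⊤
  · rw [htop]; exact le_top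
  · obtain ⟨n, hn⟩ := ENat.ne_top_iff_exists.mp hfin
    rw [← hn] at h1 ⊢
    norm_cast at h1 ⊢
    omega

end CameraData

/-- The length of a regular sequence is bounded by the dimension of the support. -/
lemma length_le_supportDim {S : Type} [CommRing S] [IsNoetherianRing S] (rs : List S) :
    ∀ (M : Type) [AddCommGroup M] [Module S M] [Module.Finite S M],
      RingTheory.Sequence.IsRegular M rs → (rs.length : WithBot ℕ∞) ≤ Module.supportDim S M := by
  induction rs with
  | nil =>
    intro M _ _ _ h
    have : Nontrivial M := h.nontrivial
    have : Nonempty (Module.support S M) := Module.nonempty_support_of_nontrivial.to_subtype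
    simpa [Module.supportDim] using Order.krullDim_nonneg
  | cons x rs ih =>
    intro M _ _ _ h
    rw [RingTheory.Sequence.isRegular_cons_iff] at h
    refine le_trans ?_ (Module.supportDim_quotSMulTop_succ_le_of_notMem_minimalPrimes
      (fun _ => h.1.notMem_of_mem_minimalPrimes) : _ ≤ Module.supportDim S M)
    rw [List.length_cons]
    push_cast
    exact add_le_add_left (ih _ h.2) 1

namespace CameraData

variable {m : ℕ} (X : CameraData m)

lemma ringKrullDim_quotient_le_of_le_height {J : Ideal (LineRing m)} {N d : ℕ}
    (hN : ∀ p : Ideal (LineRing m), p.IsPrime → J ≤ p → (N : ℕ∞) ≤ p.height)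
    (hd : 3 * m ≤ N + d) : ringKrullDim (LineRing m ⧸ J) ≤ d := by
  have hdim : ringKrullDim (LineRing m) = ((3 * m : ℕ) : ℕ∞) := by
    rw [MvPolynomial.ringKrullDim_of_isNoetherianRing, ringKrullDim_eq_zero_of_field]
    simp
  rw [ringKrullDim_quotient]
  refine iSup_le fun l => ?_
  have key : ∀ i : Fin (l.length + 1), ((N + i : ℕ) : ℕ∞) ≤ (l i).1.asIdeal.height := by
    intro i
    induction i using Fin.induction with
    | zero => exact hN _ (l 0).1.2 (l 0).2
    | succ i ih =>
      have hlt : (l i.castSucc).1.asIdeal < (l i.succ).1.asIdeal := l.strictMono i.castSucc_lt_succ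
      refine le_trans ?_ (Ideal.height_add_one_le_of_lt_of_isPrime hlt)
      have := add_le_add_left ih 1
      push_cast at this ⊢
      simpa [add_assoc] using this
  have h1 := key (Fin.last _)
  have h2 : (((l (Fin.last _)).1.asIdeal.height : ℕ∞) : WithBot ℕ∞) ≤ ((3 * m : ℕ) : ℕ∞) :=
    hdim ▸ Ideal.height_le_ringKrullDim_of_ne_top (l (Fin.last _)).1.2.ne_top
  have h3 : ((N + l.length : ℕ) : ℕ∞) ≤ (3 * m : ℕ) := h1.trans (WithBot.coe_le_coe.mp h2)
  norm_cast at h3 ⊢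
  omega

lemma 𝔪_ne_top : 𝔪 m ≠ ⊤ := fun h => by
  have h1 : 𝔪 m ≤ RingHom.ker (constantCoeff (R := ℂ)) :=
    Ideal.span_le.mpr (Set.range_subset_iff.mpr fun s => constantCoeff_X ℂ s)
  exact RingHom.ker_ne_top _ (top_le_iff.mp (h ▸ h1))

lemma I_le_𝔪 : X.I ≤ 𝔪 m := by
  refine X.I_le_of_minor fun i j k _ _ _ φ ψ χ => ?_
  have h := fun j φ => X.L_mem_𝔪 j φ
  exact (𝔪 m).add_mem ((𝔪 m).sub_mem ((𝔪 m).mul_mem_right _ (h i φ))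
    ((𝔪 m).mul_mem_right _ (h i ψ))) ((𝔪 m).mul_mem_right _ (h i χ))

lemma irrelevantMax_ne_top : irrelevantMax X.I ≠ ⊤ := fun h => 𝔪_ne_top (m := m) <| by
  rw [← Ideal.comap_map_mk X.I_le_𝔪]
  exact (congrArg _ h).trans Ideal.comap_top

lemma exists_isRegular {n : ℕ} (hn : DepthGE (𝔪 m) (LineRing m ⧸ X.I) n) :
    ∃ rs : List (LineRing m ⧸ X.I), rs.length = n ∧ (∀ x ∈ rs, x ∈ irrelevantMax X.I) ∧
      RingTheory.Sequence.IsRegular (LineRing m ⧸ X.I) rs := by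
  have hlt : 𝔪 m • (⊤ : Submodule (LineRing m) (LineRing m ⧸ X.I)) < ⊤ := by
    rw [lt_top_iff_ne_top, Ideal.smul_top_eq_map]
    exact fun h => X.irrelevantMax_ne_top ((Submodule.restrictScalars_eq_top_iff _ _ _).mp h)
  obtain ⟨rs, hlen, hmem, hreg⟩ := ModuleCat.exists_isRegular_of_exists_subsingleton_ext (𝔪 m) n
    (ModuleCat.of (LineRing m) (LineRing m ⧸ X.I)) hlt
    (ModuleCat.of (LineRing m) (LineRing m ⧸ 𝔪 m)) (by
      change Module.support (LineRing m) (LineRing m ⧸ 𝔪 m) = _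
      rw [Module.support_eq_zeroLocus, Ideal.annihilator_quotient]) hn
  have hmem' : ∀ x ∈ rs.map (algebraMap _ (LineRing m ⧸ X.I)), x ∈ irrelevantMax X.I := by
    intro x hx
    obtain ⟨r, hr, rfl⟩ := List.mem_map.mp hx
    exact Ideal.mem_map_of_mem _ (hmem r hr)
  refine ⟨rs.map (algebraMap _ _), by simpa using hlen, hmem', ?_⟩
  · have h1 := (RingTheory.Sequence.isWeaklyRegular_map_algebraMap_iff (LineRing m ⧸ X.I)
      (LineRing m ⧸ X.I) rs).mpr hreg.1
    refine ⟨h1, fun h => X.irrelevantMax_ne_top (top_le_iff.mp ?_)⟩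
    rw [h, smul_eq_mul, Ideal.mul_top]
    exact Ideal.span_le.mpr hmem'

theorem codim_and_depth (hX : X.General) (hm : 2 ≤ m) :
    idealCodim X.I = (2 * m - 4 : ℕ) ∧
      ringKrullDim (LineRing m ⧸ X.I) = (↑(ringDepthWrt (LineRing m ⧸ X.I) (irrelevantMax X.I)) :
        WithBot ℕ∞) := by
  obtain ⟨w, hw⟩ := exists_goodW hX
  obtain ⟨rs, hlen, hmem, hreg⟩ := X.exists_isRegular (depthGE_I hw hm)
  have hdepth_le : ∀ rs : List (LineRing m ⧸ X.I),
      RingTheory.Sequence.IsRegular (LineRing m ⧸ X.I) rs →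
        (rs.length : WithBot ℕ∞) ≤ ringKrullDim (LineRing m ⧸ X.I) := fun rs h => by
    rw [← Module.supportDim_self_eq_ringKrullDim]
    exact length_le_supportDim rs _ h
  have hge := hdepth_le rs hreg
  rw [hlen] at hge
  have hdim : ringKrullDim (LineRing m ⧸ X.I) = ((4 + m : ℕ) : ℕ∞) := by
    refine le_antisymm ?_ hge
    exact ringKrullDim_quotient_le_of_le_height
      (fun p hp hIp => X.le_height hX p hIp) (by omega)
  constructor
  · refine le_antisymm ?_ (le_iInf₂ fun J hJ => ?_)
    · by_contra! hlt
      have h1 : ringKrullDim (LineRing m ⧸ X.I) ≤ ((3 + m : ℕ) : ℕ∞) := by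
        refine ringKrullDim_quotient_le_of_le_height (N := 2 * m - 4 + 1) (fun p hp hIp => ?_)
          (by omega)
        have h2 : idealCodim X.I ≤ p.height := by
          refine (iInf₂_le (⟨p, hp⟩ : PrimeSpectrum (LineRing m)) hIp).trans ?_
          rw [← PrimeSpectrum.height_eq_orderHeight]
        have := Order.add_one_le_of_lt (hlt.trans_le h2)
        exact_mod_cast this
      rw [hdim] at h1
      norm_cast at h1
      omega
    · have := X.le_height hX J.asIdeal hJ
      rwa [PrimeSpectrum.height_eq_orderHeight] at this
  · rw [hdim]
    refine congrArg _ (le_antisymm (le_sSup ⟨rs, by rw [hlen], hmem, hreg⟩) (sSup_le ?_))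
    rintro _ ⟨rs', rfl, -, hreg'⟩
    have := hdepth_le rs' hreg'
    rw [hdim] at this
    exact_mod_cast this

end CameraData

namespace CameraData

lemma exists_of_isCameraArrangement {m : ℕ} {𝒞 : Fin m → Camera} (harr : IsCameraArrangement 𝒞) :
    ∃ X : CameraData m, X.cam = 𝒞 := by
  have h : ∀ j, ∃ c, IsCenter (𝒞 j) c := fun j => by
    have h1 := LinearMap.finrank_range_add_finrank_ker (𝒞 j).mulVecLin
    have h2 : Module.finrank ℂ (LinearMap.range (𝒞 j).mulVecLin) = 3 := harr.2.1 j
    rw [h2, Module.finrank_fin_fun] at h1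
    have h3 : LinearMap.ker (𝒞 j).mulVecLin ≠ ⊥ := fun h => by
      rw [h, finrank_bot] at h1
      omega
    obtain ⟨c, hc, hc0⟩ := Submodule.exists_mem_ne_zero_of_ne_bot h3
    exact ⟨c, hc0, hc⟩
  choose c hc using h
  exact ⟨⟨𝒞, c, hc, harr.2.1⟩, rfl⟩

lemma general_of_noFourCollinear {m : ℕ} (X : CameraData m) (harr : IsCameraArrangement X.cam)
    (h4 : NoFourCollinear X.cam) : X.General where
  pair i j hij h := by
    obtain ⟨a, ha⟩ := Submodule.mem_span_singleton.mp h
    refine harr.2.2 i j hij ⟨X.c i, X.isCenter i, (X.isCenter i).1, ?_⟩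
    rw [← ha, Matrix.mulVec_smul, (X.isCenter j).2, smul_zero]
  four N hN s hs h := h4 s hs ⟨N, hN.le, fun j hj => ⟨X.c j, X.isCenter j, h j hj⟩⟩

end CameraData

/-- **Proposition 2.4.** If no four cameras are collinear, then the ideal `I_𝒞` has
codimension `2m − 4` and is Cohen–Macaulay: the Krull dimension of `R/I_𝒞` equals its
depth (with respect to the irrelevant maximal ideal). -/
theorem minorsIdeal_codim_and_cohenMacaulay {m : ℕ} (𝒞 : Fin m → Camera)
    (harr : IsCameraArrangement 𝒞) (h4 : NoFourCollinear 𝒞) :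
    idealCodim (minorsIdeal 𝒞) = (2 * m - 4 : ℕ) ∧
      ringKrullDim (LineRing m ⧸ minorsIdeal 𝒞) =
        (↑(ringDepthWrt (LineRing m ⧸ minorsIdeal 𝒞) (irrelevantMax (minorsIdeal 𝒞))) : WithBot ℕ∞) := by
  obtain ⟨X, rfl⟩ := CameraData.exists_of_isCameraArrangement harr
  exact X.codim_and_depth (X.general_of_noFourCollinear harr h4) harr.1

end
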